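/- arXiv:2312.13014 — 4 statements merged into one kernel-verified Lean document; each statement's English description precedes it below -/
import Mathlib

section
/- Suppose k is algebraically closed of characteristic 0 and let ξ ∈ k be a primitive third root of unity. Let A = S(1,0,−1) be the quotient of k⟨x,y,z⟩ by the relations xy − z², yz − x², and zx − y². Then the elements X = x+y+z, Y = x+ξy+ξ²z, Z = x+ξ²y+ξz satisfy YX = ξXY, ZY = ξYZ, XZ = ξZX, so that A is isomorphic to a skew polynomial ring in three variables, and the ozone group Oz(A) is isomorphic to ℤ/3 × ℤ/3. -/
noncomputable section

/-- The **ozone group** of a `k`-algebra `A`: the group of `k`-algebra automorphisms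
of `A` that fix the center of `A` pointwise. -/
def ozoneGroup (k A : Type*) [CommSemiring k] [Semiring A] [Algebra k A] :
    Subgroup (A ≃ₐ[k] A) where
  carrier := {σ | ∀ z ∈ Subalgebra.center k A, σ z = z}
  one_mem' := fun _ _ => rfl
  mul_mem' := by
    intro σ τ hσ hτ z hz
    show σ (τ z) = z
    rw [hτ z hz, hσ z hz]
  inv_mem' := by
    intro σ hσ z hz
    show σ.symm z = z
    conv_lhs => rw [← hσ z hz]
    exact σ.symm_apply_apply z

/-- An element `a` of a ring is **normal** if `a·A = A·a`. -/
def IsNormal {A : Type*} [Mul A] (a : A) : Prop :=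
  Set.range (fun x => a * x) = Set.range (fun x => x * a)

/-- The defining relations of the skew polynomial ring `k_p[x_1,...,x_n]`:
`x_j x_i = p_{ij}·x_i x_j` for `i < j`. -/
inductive SkewPolyRel (k : Type*) [Field k] (n : ℕ) (p : Fin n → Fin n → k) :
    FreeAlgebra k (Fin n) → FreeAlgebra k (Fin n) → Prop
  | rel (i j : Fin n) (hij : i < j) :
      SkewPolyRel k n p (FreeAlgebra.ι k j * FreeAlgebra.ι k i)
        (p i j • (FreeAlgebra.ι k i * FreeAlgebra.ι k j))

/-- The skew polynomial ring `k_p[x_1,...,x_n]`. -/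
abbrev SkewPoly (k : Type*) [Field k] (n : ℕ) (p : Fin n → Fin n → k) :=
  RingQuot (SkewPolyRel k n p)

/-- The defining relations of the Sklyanin algebra `S(1,0,−1)`:
`xy = z²`, `yz = x²`, `zx = y²` (generators `x = ι 0`, `y = ι 1`, `z = ι 2`). -/
inductive Skly0Rel (k : Type*) [Field k] :
    FreeAlgebra k (Fin 3) → FreeAlgebra k (Fin 3) → Prop
  | xy : Skly0Rel k (FreeAlgebra.ι k 0 * FreeAlgebra.ι k 1) (FreeAlgebra.ι k 2 ^ 2)
  | yz : Skly0Rel k (FreeAlgebra.ι k 1 * FreeAlgebra.ι k 2) (FreeAlgebra.ι k 0 ^ 2)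
  | zx : Skly0Rel k (FreeAlgebra.ι k 2 * FreeAlgebra.ι k 0) (FreeAlgebra.ι k 1 ^ 2)

/-- The Sklyanin algebra `S(1,0,−1) = k⟨x,y,z⟩/(xy − z², yz − x², zx − y²)`. -/
abbrev Skly0 (k : Type*) [Field k] := RingQuot (Skly0Rel k)

/-- The generator `x` of `S(1,0,−1)`. -/
def Skly0.x (k : Type*) [Field k] : Skly0 k :=
  RingQuot.mkAlgHom k (Skly0Rel k) (FreeAlgebra.ι k 0)

/-- The generator `y` of `S(1,0,−1)`. -/
def Skly0.y (k : Type*) [Field k] : Skly0 k :=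
  RingQuot.mkAlgHom k (Skly0Rel k) (FreeAlgebra.ι k 1)

/-- The generator `z` of `S(1,0,−1)`. -/
def Skly0.z (k : Type*) [Field k] : Skly0 k :=
  RingQuot.mkAlgHom k (Skly0Rel k) (FreeAlgebra.ι k 2)


namespace Ozone9

open AddMonoidAlgebra

section General

lemma single_of_cube {R M : Type*} [Ring R] [AddCommMonoid M] [TwoUniqueSums M]
    (f : AddMonoidAlgebra R M) (hf : ∀ m, f.coeff m = 0 ∨ IsUnit (f.coeff m))
    (t : M) (r : R) (hr : r ≠ 0) (h : f ^ 3 = AddMonoidAlgebra.single t r) :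
    ∃ m, f.coeff.support = {m} := by
  classical
  have hne : f ^ 3 ≠ 0 := by
    rw [h]
    intro h0
    apply hr
    have := congrArg (fun g => g.coeff t) h0
    simpa using this
  have h2 : (f ^ 2) ≠ 0 := by
    intro h0
    apply hne
    rw [pow_succ, h0, zero_mul]
  have h1 : f ≠ 0 := by
    rintro rfl
    apply hne
    simp
  have hT : (f ^ 2).coeff.support.Nonempty := by
    rw [Finsupp.support_nonempty_iff]
    simpa using h2
  have hS : f.coeff.support.Nonempty := by
    rw [Finsupp.support_nonempty_iff]
    simpa using h1
  rw [← Finset.card_eq_one]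
  by_contra hc
  have hS1 := hS.card_pos
  have hT1 := hT.card_pos
  have : 1 < f.coeff.support.card * (f ^ 2).coeff.support.card := by
    have : 2 ≤ f.coeff.support.card := by omega
    nlinarith
  obtain ⟨p1, hp1, p2, hp2, hne12, hu1, hu2⟩ := TwoUniqueSums.uniqueAdd_of_one_lt_card this
  have key : ∀ p ∈ f.coeff.support ×ˢ (f ^ 2).coeff.support,
      UniqueAdd f.coeff.support (f ^ 2).coeff.support p.1 p.2 → p.1 + p.2 = t := by
    intro p hp hu
    by_contra hpt
    have e := AddMonoidAlgebra.coeff_mul_add_of_uniqueAdd hu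
    rw [← pow_succ', h] at e
    rw [Finset.mem_product, Finsupp.mem_support_iff, Finsupp.mem_support_iff] at hp
    have hunit := (hf p.1).resolve_left hp.1
    have : f.coeff p.1 * (f ^ 2).coeff p.2 = 0 := by
      rw [← e]
      simp [Finsupp.single_apply, Ne.symm hpt]
    exact hp.2 (hunit.mul_right_eq_zero.1 this)
  have e1 := key p1 hp1 hu1
  have e2 := key p2 hp2 hu2
  rw [Finset.mem_product] at hp1
  have := hu2 hp1.1 hp1.2 (e1.trans e2.symm)
  exact hne12 (Prod.ext this.1 this.2)

end General

section Main

variable {k : Type*} [Field k] {ξ : k}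

/-- The parameter matrix. -/
def P (ξ : k) : Fin 3 → Fin 3 → k := ![![1, ξ, ξ ^ 2], ![ξ ^ 2, 1, ξ], ![ξ, ξ ^ 2, 1]]

abbrev B (ξ : k) := SkewPoly k 3 (P ξ)

def gen (ξ : k) (i : Fin 3) : B ξ := RingQuot.mkAlgHom k (SkewPolyRel k 3 (P ξ)) (FreeAlgebra.ι k i)

lemma gen_rel (i j : Fin 3) (h : i < j) : gen ξ j * gen ξ i = P ξ i j • (gen ξ i * gen ξ j) := by
  have := RingQuot.mkAlgHom_rel k (SkewPolyRel.rel (k := k) (p := P ξ) i j h)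
  simp only [map_mul, map_smul] at this
  exact this

lemma rYX : gen ξ 1 * gen ξ 0 = ξ • (gen ξ 0 * gen ξ 1) := by
  simpa [P] using gen_rel (ξ := ξ) 0 1 (by decide)

lemma rZY : gen ξ 2 * gen ξ 1 = ξ • (gen ξ 1 * gen ξ 2) := by
  simpa [P] using gen_rel (ξ := ξ) 1 2 (by decide)

lemma rZX : gen ξ 2 * gen ξ 0 = ξ ^ 2 • (gen ξ 0 * gen ξ 2) := by
  simpa [P] using gen_rel (ξ := ξ) 0 2 (by decide)

/-- The universal property. -/
def lift {C : Type*} [Semiring C] [Algebra k C] (v : Fin 3 → C)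
    (h10 : v 1 * v 0 = ξ • (v 0 * v 1)) (h21 : v 2 * v 1 = ξ • (v 1 * v 2))
    (h20 : v 2 * v 0 = ξ ^ 2 • (v 0 * v 2)) : B ξ →ₐ[k] C :=
  RingQuot.liftAlgHom k ⟨FreeAlgebra.lift k v, by
    rintro _ _ ⟨i, j, hij⟩
    simp only [map_mul, map_smul, FreeAlgebra.lift_ι_apply]
    fin_cases i <;> fin_cases j <;> first | exact absurd hij (by decide) | simpa [P]⟩

lemma lift_gen {C : Type*} [Semiring C] [Algebra k C] (v : Fin 3 → C) (h10 h21 h20) (i : Fin 3) :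
    lift (ξ := ξ) v h10 h21 h20 (gen ξ i) = v i := by
  simp [lift, gen]

lemma ext_gen {C : Type*} [Semiring C] [Algebra k C] {f g : B ξ →ₐ[k] C}
    (h : ∀ i, f (gen ξ i) = g (gen ξ i)) : f = g := by
  apply RingQuot.ringQuot_ext'
  apply FreeAlgebra.hom_ext
  funext i
  exact h i

lemma B_induction {p : B ξ → Prop} (hC : ∀ r, p (algebraMap k _ r)) (hg : ∀ i, p (gen ξ i))
    (hm : ∀ a b, p a → p b → p (a * b)) (ha : ∀ a b, p a → p b → p (a + b)) (b : B ξ) : p b := by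
  obtain ⟨b, rfl⟩ := RingQuot.mkAlgHom_surjective k _ b
  induction b using FreeAlgebra.induction with
  | grade0 r => simpa using hC r
  | grade1 i => exact hg i
  | mul a b h1 h2 => rw [map_mul]; exact hm _ _ h1 h2
  | add a b h1 h2 => rw [map_add]; exact ha _ _ h1 h2

/-- diagonal automorphisms -/
def scalHom (ξ : k) (v : Fin 3 → k) : B ξ →ₐ[k] B ξ :=
  lift (fun i => v i • gen ξ i)
    (by simp only [smul_mul_smul_comm, rYX]; module)
    (by simp only [smul_mul_smul_comm, rZY]; module)
    (by simp only [smul_mul_smul_comm, rZX]; module)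

lemma scalHom_gen (v : Fin 3 → k) (i) : scalHom ξ v (gen ξ i) = v i • gen ξ i := lift_gen ..

lemma scalHom_comp (v w : Fin 3 → k) : (scalHom ξ v).comp (scalHom ξ w) = scalHom ξ (v * w) := by
  apply ext_gen
  intro i
  simp [scalHom_gen, smul_smul, mul_comm]

lemma scalHom_one : scalHom ξ 1 = AlgHom.id k _ := by
  apply ext_gen
  intro i
  simp [scalHom_gen]

def scal (ξ : k) : (Fin 3 → kˣ) →* (B ξ ≃ₐ[k] B ξ) where
  toFun v := AlgEquiv.ofAlgHom (scalHom ξ fun i => v i) (scalHom ξ fun i => ↑(v i)⁻¹)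
    (by rw [scalHom_comp, ← scalHom_one]; congr 1; ext i; simp)
    (by rw [scalHom_comp, ← scalHom_one]; congr 1; ext i; simp)
  map_one' := by
    ext x
    exact DFunLike.congr_fun (scalHom_one (ξ := ξ)) x
  map_mul' v w := by
    ext x
    exact (DFunLike.congr_fun (scalHom_comp (ξ := ξ) (fun i => v i) (fun i => w i)) x).symm

lemma scal_gen (v : Fin 3 → kˣ) (i) : scal ξ v (gen ξ i) = (v i : k) • gen ξ i := scalHom_gen _ i

/-- monomials -/
def Psi (ξ : k) : (ℕ × ℕ × ℕ →₀ k) →ₗ[k] B ξ :=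
  Finsupp.linearCombination k fun m => gen ξ 0 ^ m.1 * (gen ξ 1 ^ m.2.1 * gen ξ 2 ^ m.2.2)

lemma qcomm {C : Type*} [Semiring C] [Algebra k C] {a b : C} {q : k} (h : a * b = q • (b * a)) (n : ℕ) :
    a * b ^ n = q ^ n • (b ^ n * a) := by
  induction n with
  | zero => simp
  | succ n ih =>
    rw [pow_succ, ← mul_assoc, ih, smul_mul_assoc, mul_assoc, h, mul_smul_comm, smul_smul, ← pow_succ,
      mul_assoc]

lemma gen_mul_Psi (i : Fin 3) (g) : ∃ g', gen ξ i * Psi ξ g = Psi ξ g' := by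
  induction g using Finsupp.induction_linear with
  | zero => exact ⟨0, by simp⟩
  | add f g hf hg =>
    obtain ⟨f', hf⟩ := hf
    obtain ⟨g', hg⟩ := hg
    exact ⟨f' + g', by rw [map_add, mul_add, hf, hg, map_add]⟩
  | single m c =>
    obtain ⟨a, b, d⟩ := m
    simp only [Psi]
    fin_cases i
    · refine ⟨Finsupp.single (a + 1, b, d) c, ?_⟩
      simp [pow_succ', mul_assoc]
    · refine ⟨Finsupp.single (a, b + 1, d) (ξ ^ a * c), ?_⟩
      simp only [Finsupp.linearCombination_single, mul_smul_comm, Fin.mk_one, ← mul_assoc,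
        qcomm (rYX (ξ := ξ)) a]
      simp only [smul_mul_assoc, mul_assoc, pow_succ', smul_smul]
      rw [mul_comm c]
    · refine ⟨Finsupp.single (a, b, d + 1) ((ξ ^ 2) ^ a * ξ ^ b * c), ?_⟩
      simp only [Finsupp.linearCombination_single, mul_smul_comm, Fin.reduceFinMk, ← mul_assoc,
        qcomm (rZX (ξ := ξ)) a]
      simp only [smul_mul_assoc, mul_assoc]
      rw [← mul_assoc (gen ξ 2), qcomm (rZY (ξ := ξ)) b]
      simp only [smul_mul_assoc, mul_smul_comm, mul_assoc, pow_succ' _ d, smul_smul]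
      congr 1
      ring

lemma Psi_surj : Function.Surjective (Psi ξ) := by
  have : ∀ b : B ξ, ∀ g, ∃ g', b * Psi ξ g = Psi ξ g' := by
    intro b
    induction b using B_induction with
    | hC r => exact fun g => ⟨r • g, by rw [map_smul, Algebra.smul_def]⟩
    | hg i => exact fun g => gen_mul_Psi i g
    | hm a b ha hb =>
      intro g
      obtain ⟨g', hg'⟩ := hb g
      obtain ⟨g'', hg''⟩ := ha g'
      exact ⟨g'', by rw [mul_assoc, hg', hg'']⟩
    | ha a b ha hb =>
      intro g
      obtain ⟨g', hg'⟩ := hb g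
      obtain ⟨g'', hg''⟩ := ha g
      exact ⟨g'' + g', by rw [add_mul, hg', hg'', map_add]⟩
  intro b
  obtain ⟨g', hg'⟩ := this b (Finsupp.single 0 1)
  refine ⟨g', ?_⟩
  rw [← hg']
  simp [Psi]

/-- clock -/
def D (ξ : k) : Matrix (Fin 3) (Fin 3) k := !![1, 0, 0; 0, ξ, 0; 0, 0, ξ ^ 2]
/-- shift -/
def S (k : Type*) [Field k] : Matrix (Fin 3) (Fin 3) k := !![0, 0, 1; 1, 0, 0; 0, 1, 0]
/-- third -/
def W (ξ : k) : Matrix (Fin 3) (Fin 3) k := S k ^ 2 * D ξ ^ 2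

lemma S3 : S k ^ 3 = 1 := by
  ext i j
  fin_cases i <;> fin_cases j <;> simp [S, pow_succ, Matrix.mul_apply, Fin.sum_univ_three]

variable (h3 : ξ ^ 3 = 1)

include h3

lemma D3 : D ξ ^ 3 = 1 := by
  ext i j
  fin_cases i <;> fin_cases j <;> simp [D, pow_succ, Matrix.mul_apply, Fin.sum_univ_three] <;> grind

lemma DS : D ξ * S k = ξ • (S k * D ξ) := by
  ext i j
  fin_cases i <;> fin_cases j <;> simp [S, D, pow_succ, Matrix.mul_apply, Fin.sum_univ_three] <;> grind

lemma WD : W ξ * D ξ = ξ • (D ξ * W ξ) := by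
  ext i j
  fin_cases i <;> fin_cases j <;>
    simp [W, S, D, pow_succ, Matrix.mul_apply, Fin.sum_univ_three] <;> grind

lemma WS : W ξ * S k = ξ ^ 2 • (S k * W ξ) := by
  ext i j
  fin_cases i <;> fin_cases j <;>
    simp [W, S, D, pow_succ, Matrix.mul_apply, Fin.sum_univ_three] <;> grind

omit h3 in
lemma unitS : IsUnit (S k) := IsUnit.of_pow_eq_one S3 (by norm_num)
lemma unitD : IsUnit (D ξ) := IsUnit.of_pow_eq_one (D3 h3) (by norm_num)
lemma unitW : IsUnit (W ξ) := (unitS.pow 2).mul ((unitD h3).pow 2)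

/-- The faithful representation. -/
def Phi : B ξ →ₐ[k] AddMonoidAlgebra (Matrix (Fin 3) (Fin 3) k) (ℕ × ℕ × ℕ) :=
  lift ![AddMonoidAlgebra.single (1, 0, 0) (S k), AddMonoidAlgebra.single (0, 1, 0) (D ξ),
      AddMonoidAlgebra.single (0, 0, 1) (W ξ)]
    (by simp [AddMonoidAlgebra.single_mul_single, DS h3])
    (by simp [AddMonoidAlgebra.single_mul_single, WD h3])
    (by simp [AddMonoidAlgebra.single_mul_single, WS h3])

omit h3 in
/-- coefficient of monomials -/
def U (ξ : k) (m : ℕ × ℕ × ℕ) : Matrix (Fin 3) (Fin 3) k := S k ^ m.1 * (D ξ ^ m.2.1 * W ξ ^ m.2.2)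

lemma unitU (m) : IsUnit (U ξ m) := (unitS.pow _).mul (((unitD h3).pow _).mul ((unitW h3).pow _))

lemma Phi0 : Phi h3 (gen ξ 0) = AddMonoidAlgebra.single (1, 0, 0) (S k) := lift_gen ..
lemma Phi1 : Phi h3 (gen ξ 1) = AddMonoidAlgebra.single (0, 1, 0) (D ξ) := lift_gen ..
lemma Phi2 : Phi h3 (gen ξ 2) = AddMonoidAlgebra.single (0, 0, 1) (W ξ) := lift_gen ..

lemma Phi_Psi (g m) : (Phi h3 (Psi ξ g)).coeff m = g m • U ξ m := by
  induction g using Finsupp.induction_linear with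
  | zero => simp
  | add f g hf hg => simp [add_smul, hf, hg]
  | single n c =>
    obtain ⟨a, b, d⟩ := n
    simp only [Psi, Finsupp.linearCombination_single, map_smul, map_mul, map_pow, Phi0, Phi1, Phi2,
      AddMonoidAlgebra.single_pow, AddMonoidAlgebra.single_mul_single]
    by_cases hm : (a, b, d) = m
    · subst hm
      simp [U]
    · simp [Finsupp.single_apply, hm]

lemma Phi_inj : Function.Injective (Phi h3) := by
  rw [injective_iff_map_eq_zero]
  intro b hb
  obtain ⟨g, rfl⟩ := Psi_surj b
  have : g = 0 := by
    ext m
    have := Phi_Psi h3 g m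
    rw [hb] at this
    have h2 : g m • U ξ m = 0 := by rw [← this]; simp
    exact (smul_eq_zero.1 h2).resolve_right (unitU h3 m).ne_zero
  simp [this]

lemma mul_left_cancel_of {b u v : B ξ} {m r} (hr : IsUnit r)
    (hb : Phi h3 b = AddMonoidAlgebra.single m r) (h : b * u = b * v) : u = v := by
  apply Phi_inj h3
  have h2 := congrArg (Phi h3) h
  rw [map_mul, map_mul, hb] at h2
  ext1
  ext1 n
  have h4 := congrArg (fun f => f.coeff (m + n)) h2
  simp only [AddMonoidAlgebra.coeff_single_mul_add] at h4
  exact hr.mul_left_cancel h4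

lemma cube_root {u b : B ξ} {m r} (hr : IsUnit r) (hb : Phi h3 b = AddMonoidAlgebra.single m r)
    (h : u ^ 3 = b ^ 3) : ∃ c : k, u = c • Psi ξ (Finsupp.single m 1) := by
  obtain ⟨g, rfl⟩ := Psi_surj u
  have e : Phi h3 (Psi ξ g) ^ 3 = AddMonoidAlgebra.single (3 • m) (r ^ 3) := by
    rw [← map_pow, h, map_pow, hb, AddMonoidAlgebra.single_pow]
  have hc : ∀ n, (Phi h3 (Psi ξ g)).coeff n = 0 ∨ IsUnit ((Phi h3 (Psi ξ g)).coeff n) := by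
    intro n
    rw [Phi_Psi]
    by_cases h0 : g n = 0
    · left; simp [h0]
    · right
      rw [Algebra.smul_def]
      exact ((IsUnit.mk0 _ h0).map (algebraMap k _)).mul (unitU h3 n)
  obtain ⟨n, hn⟩ := single_of_cube _ hc _ _ (hr.pow 3).ne_zero e
  have hg : g = Finsupp.single n (g n) := by
    ext x
    by_cases hx : n = x
    · subst hx; simp
    · have : x ∉ (Phi h3 (Psi ξ g)).coeff.support := by
        rw [hn]; simpa using Ne.symm hx
      rw [Finsupp.notMem_support_iff, Phi_Psi] at this
      rw [(smul_eq_zero.1 this).resolve_right (unitU h3 x).ne_zero]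
      simp [Finsupp.single_apply, hx]
  have hf : Phi h3 (Psi ξ g) = AddMonoidAlgebra.single n (g n • U ξ n) := by
    ext1
    ext1 x
    rw [Phi_Psi, AddMonoidAlgebra.coeff_single]
    by_cases hx : n = x
    · subst hx; simp
    · rw [hg]; simp [Finsupp.single_apply, hx]
  have hnm : n = m := by
    rw [hf, AddMonoidAlgebra.single_pow] at e
    have e2 := congrArg (fun f => f.coeff (3 • m)) e
    simp only [AddMonoidAlgebra.coeff_single, Finsupp.single_apply, if_true] at e2
    split_ifs at e2 with h0
    · obtain ⟨a, b, d⟩ := n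
      obtain ⟨a', b', d'⟩ := m
      simp at h0
      simp [h0]
    · exact absurd e2.symm (hr.pow 3).ne_zero
  subst hnm
  refine ⟨g n, ?_⟩
  rw [← map_smul, hg]
  simp

omit h3 in
lemma Psi0 : Psi ξ (Finsupp.single (1, 0, 0) 1) = gen ξ 0 := by simp [Psi]
omit h3 in
lemma Psi1 : Psi ξ (Finsupp.single (0, 1, 0) 1) = gen ξ 1 := by simp [Psi]
omit h3 in
lemma Psi2 : Psi ξ (Finsupp.single (0, 0, 1) 1) = gen ξ 2 := by simp [Psi]

lemma gen_ex (i : Fin 3) : ∃ m r, IsUnit r ∧ Phi h3 (gen ξ i) = AddMonoidAlgebra.single m r ∧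
    Psi ξ (Finsupp.single m 1) = gen ξ i := by
  fin_cases i
  · exact ⟨_, _, unitS, Phi0 h3, Psi0⟩
  · exact ⟨_, _, unitD h3, Phi1 h3, Psi1⟩
  · exact ⟨_, _, unitW h3, Phi2 h3, Psi2⟩

lemma gen_cancel (i : Fin 3) {u v : B ξ} (h : gen ξ i * u = gen ξ i * v) : u = v := by
  obtain ⟨m, r, hr, h1, h2⟩ := gen_ex h3 i
  exact mul_left_cancel_of h3 hr h1 h

lemma gen_cube (i : Fin 3) {u : B ξ} (h : u ^ 3 = gen ξ i ^ 3) : ∃ c : k, u = c • gen ξ i := by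
  obtain ⟨m, r, hr, h1, h2⟩ := gen_ex h3 i
  rw [← h2]
  exact cube_root h3 hr h1 h

lemma scalar_inj (c : k) (n : ℕ) (i : Fin 3) (h : c • gen ξ i ^ n = gen ξ i ^ n) : c = 1 := by
  induction n with
  | zero =>
    have h2 := congrArg (fun f => (Phi h3 f).coeff 0 0 0) h
    simpa [AddMonoidAlgebra.one_def] using h2
  | succ n ih =>
    apply ih
    apply gen_cancel h3 i
    rw [mul_smul_comm, ← pow_succ', h]

lemma scalar_inj1 (c d : k) (i : Fin 3) (h : c • gen ξ i = d • gen ξ i) : c = d := by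
  have h1 : (c - d + 1) • gen ξ i ^ 1 = gen ξ i ^ 1 := by
    rw [pow_one, add_smul, sub_smul, h]; simp
  have := scalar_inj h3 _ _ _ h1
  linear_combination this

omit h3 in
lemma mem_center_of {b : B ξ} (h : ∀ i, gen ξ i * b = b * gen ξ i) :
    b ∈ Subalgebra.center k (B ξ) := by
  rw [Subalgebra.mem_center_iff]
  intro f
  induction f using B_induction with
  | hC r => exact Algebra.commutes r b
  | hg i => exact h i
  | hm x y hx hy => rw [mul_assoc, hy, ← mul_assoc, hx, mul_assoc]
  | ha x y hx hy => rw [add_mul, hx, hy, mul_add]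

lemma rXY : gen ξ 0 * gen ξ 1 = ξ ^ 2 • (gen ξ 1 * gen ξ 0) := by
  rw [rYX, smul_smul, ← pow_succ, h3, one_smul]
lemma rYZ : gen ξ 1 * gen ξ 2 = ξ ^ 2 • (gen ξ 2 * gen ξ 1) := by
  rw [rZY, smul_smul, ← pow_succ, h3, one_smul]
lemma rXZ : gen ξ 0 * gen ξ 2 = ξ • (gen ξ 2 * gen ξ 0) := by
  rw [rZX, smul_smul, ← pow_succ', h3, one_smul]

lemma q_ex (i j : Fin 3) : ∃ q : k, q ^ 3 = 1 ∧ gen ξ i * gen ξ j = q • (gen ξ j * gen ξ i) := by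
  have h6 : (ξ ^ 2) ^ 3 = 1 := by rw [← pow_mul, mul_comm, pow_mul, h3, one_pow]
  fin_cases i <;> fin_cases j
  · exact ⟨1, by simp, by simp⟩
  · exact ⟨_, h6, rXY h3⟩
  · exact ⟨_, h3, rXZ h3⟩
  · exact ⟨_, h3, rYX⟩
  · exact ⟨1, by simp, by simp⟩
  · exact ⟨_, h6, rYZ h3⟩
  · exact ⟨_, h6, rZX⟩
  · exact ⟨_, h3, rZY⟩
  · exact ⟨1, by simp, by simp⟩

lemma cube_central (i : Fin 3) : gen ξ i ^ 3 ∈ Subalgebra.center k (B ξ) := by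
  apply mem_center_of
  intro j
  obtain ⟨q, hq, h⟩ := q_ex h3 j i
  rw [qcomm h, hq, one_smul]

lemma prod_central : gen ξ 0 * gen ξ 1 * gen ξ 2 ∈ Subalgebra.center k (B ξ) := by
  have key : ∀ (g x y z : B ξ) (a b c : k), a * b * c = 1 → g * x = a • (x * g) → g * y = b • (y * g) →
      g * z = c • (z * g) → g * (x * y * z) = x * y * z * g := by
    intro g x y z a b c h hx hy hz
    rw [← mul_assoc, ← mul_assoc, hx, smul_mul_assoc, mul_assoc x, hy, smul_mul_assoc, mul_smul_comm,
      smul_mul_assoc, ← mul_assoc x, mul_assoc _ g, hz, mul_smul_comm, smul_smul, smul_smul, h, one_smul]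
    simp only [mul_assoc]
  apply mem_center_of
  intro i
  fin_cases i
  · exact key _ _ _ _ 1 (ξ ^ 2) ξ (by grind) (by simp) (rXY h3) (rXZ h3)
  · exact key _ _ _ _ ξ 1 (ξ ^ 2) (by grind) rYX (by simp) (rYZ h3)
  · exact key _ _ _ _ (ξ ^ 2) ξ 1 (by grind) rZX rZY (by simp)

omit h3 in
/-- embedding of pairs -/
def tri (k : Type*) [Field k] : kˣ × kˣ →* (Fin 3 → kˣ) where
  toFun v := ![v.1, v.2, (v.1 * v.2)⁻¹]
  map_one' := by ext i; fin_cases i <;> simp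
  map_mul' v w := by
    funext i
    fin_cases i
    · simp
    · simp
    · show (v.1 * w.1 * (v.2 * w.2))⁻¹ = (v.1 * v.2)⁻¹ * (w.1 * w.2)⁻¹
      rw [← mul_inv, mul_mul_mul_comm]

lemma oz_of_conj (v : Fin 3 → kˣ) (j : Fin 3)
    (h : ∀ i, gen ξ i * gen ξ j = (v i : k) • (gen ξ j * gen ξ i)) : scal ξ v ∈ ozoneGroup k (B ξ) := by
  have key : ∀ f, f * gen ξ j = gen ξ j * scal ξ v f := by
    intro f
    induction f using B_induction with
    | hC r => rw [AlgEquiv.commutes, Algebra.commutes]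
    | hg i => rw [h, scal_gen, mul_smul_comm]
    | hm x y hx hy => rw [map_mul, mul_assoc, hy, ← mul_assoc, hx, mul_assoc]
    | ha x y hx hy => rw [map_add, add_mul, hx, hy, mul_add]
  intro z hz
  apply gen_cancel h3 j
  rw [← key]
  exact ((Subalgebra.mem_center_iff.1 hz) (gen ξ j)).symm

lemma exists_scal {σ : B ξ ≃ₐ[k] B ξ} (hσ : σ ∈ ozoneGroup k (B ξ)) :
    ∃ a b : rootsOfUnity 3 k, σ = scal ξ (tri k (a, b)) := by
  have h1 : ∀ i, ∃ c : k, c ^ 3 = 1 ∧ σ (gen ξ i) = c • gen ξ i := by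
    intro i
    have e : σ (gen ξ i) ^ 3 = gen ξ i ^ 3 := by
      rw [← map_pow]; exact hσ _ (cube_central h3 i)
    obtain ⟨c, hc⟩ := gen_cube h3 i e
    refine ⟨c, ?_, hc⟩
    rw [hc, smul_pow] at e
    exact scalar_inj h3 _ _ _ e
  choose c hc hs using h1
  have hprod : c 0 * c 1 * c 2 = 1 := by
    have e := hσ _ (prod_central h3)
    rw [map_mul, map_mul, hs, hs, hs, smul_mul_smul_comm, smul_mul_smul_comm, mul_assoc, ← mul_smul_comm] at e
    have e2 := gen_cancel h3 0 ((mul_assoc _ _ _).symm.trans (e.trans (mul_assoc _ _ _)))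
    have e3 := gen_cancel h3 1 e2
    exact scalar_inj h3 _ 1 2 (by simpa [mul_assoc] using e3)
  refine ⟨rootsOfUnity.mkOfPowEq (c 0) (hc 0), rootsOfUnity.mkOfPowEq (c 1) (hc 1), ?_⟩
  have : (σ : B ξ →ₐ[k] B ξ) = (scal ξ (tri k (rootsOfUnity.mkOfPowEq (c 0) (hc 0),
      rootsOfUnity.mkOfPowEq (c 1) (hc 1))) : B ξ →ₐ[k] B ξ) := by
    apply ext_gen
    intro i
    show σ (gen ξ i) = scal ξ _ (gen ξ i)
    rw [hs, scal_gen]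
    congr 1
    fin_cases i
    · simp [tri]
    · simp [tri]
    · simp [tri]
      have : c 0 ≠ 0 := by intro h; simp [h] at hprod
      have : c 1 ≠ 0 := by intro h; simp [h] at hprod
      field_simp
      linear_combination hprod
  ext x
  exact DFunLike.congr_fun this x

omit h3
variable (hξ : IsPrimitiveRoot ξ 3)
include hξ

lemma scal_mem (a b : rootsOfUnity 3 k) : scal ξ (tri k (a, b)) ∈ ozoneGroup k (B ξ) := by
  have h3 := hξ.pow_eq_one
  have hroot : ∀ a : rootsOfUnity 3 k, ∃ n : ℕ, (a : kˣ) = (hξ.isUnit (by norm_num)).unit ^ n := by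
    intro a
    have : ((a : kˣ) : k) ^ 3 = 1 := by
      have := (mem_rootsOfUnity 3 (a : kˣ)).1 a.2
      rw [← Units.val_pow_eq_pow_val, this, Units.val_one]
    obtain ⟨i, hi, h⟩ := hξ.eq_pow_of_pow_eq_one this
    refine ⟨i, ?_⟩
    ext
    simp [h]
  obtain ⟨n, hn⟩ := hroot a
  obtain ⟨m, hm⟩ := hroot b
  set u := (hξ.isUnit (by norm_num)).unit with hu
  have huv : (u : k) = ξ := rfl
  have hinv : ξ⁻¹ = ξ ^ 2 := by
    have := hξ.ne_zero (by norm_num)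
    field_simp
    exact h3.symm
  have e : ((a : kˣ), (b : kˣ)) = (u⁻¹, 1)⁻¹ ^ n * (1, u) ^ m := by
    simp [hn, hm]
  rw [e, map_mul, map_mul, map_pow, map_pow, map_inv, map_pow, map_pow, map_inv]
  refine mul_mem (pow_mem (inv_mem ?_) _) (pow_mem ?_ _)
  · apply oz_of_conj h3 _ 1
    intro i
    fin_cases i
    · simpa [tri, huv, hinv] using rXY h3
    · simp [tri]
    · simpa [tri, huv] using rZY
  · apply oz_of_conj h3 _ 0
    intro i
    fin_cases i
    · simp [tri]
    · simpa [tri, huv] using rYX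
    · simpa [tri, huv, hinv] using rZX

lemma oz_B : Nonempty (↥(ozoneGroup k (B ξ)) ≃*
      Multiplicative (ZMod 3) × Multiplicative (ZMod 3)) := by
  have h3 := hξ.pow_eq_one
  let F : rootsOfUnity 3 k × rootsOfUnity 3 k →* ozoneGroup k (B ξ) :=
    (((scal ξ).comp (tri k)).comp
      ((rootsOfUnity 3 k).subtype.prodMap (rootsOfUnity 3 k).subtype)).codRestrict _
      (fun x => scal_mem hξ x.1 x.2)
  have hF : Function.Bijective F := by
    constructor
    · rw [injective_iff_map_eq_one]
      rintro ⟨a, b⟩ hab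
      have h1 : scal ξ (tri k (a, b)) = 1 := congrArg Subtype.val hab
      have h2 : ∀ i, ((tri k (a, b) i : kˣ) : k) = 1 := by
        intro i
        apply scalar_inj1 h3 _ _ i
        rw [← scal_gen, h1]
        simp
      have ha := h2 0
      have hb := h2 1
      simp [tri] at ha hb
      simp [ha, hb]
    · rintro ⟨σ, hσ⟩
      obtain ⟨a, b, rfl⟩ := exists_scal h3 hσ
      exact ⟨(a, b), rfl⟩
  have hcard : Nat.card (rootsOfUnity 3 k) = 3 := hξ.card_rootsOfUnity
  have : Fact (Nat.Prime 3) := ⟨by norm_num⟩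
  have e : rootsOfUnity 3 k ≃* Multiplicative (ZMod 3) :=
    mulEquivOfPrimeCardEq (p := 3) hcard (by simp)
  exact ⟨(MulEquiv.ofBijective F hF).symm.trans (e.prodCongr e)⟩

end Main

/-- Transport of ozone groups. -/
lemma oz_congr {k A C : Type*} [Field k] [Ring A] [Ring C] [Algebra k A] [Algebra k C]
    (e : A ≃ₐ[k] C) : Nonempty (ozoneGroup k A ≃* ozoneGroup k C) := by
  have key : ∀ z, z ∈ Subalgebra.center k A → e z ∈ Subalgebra.center k C := by
    intro z hz
    rw [Subalgebra.mem_center_iff] at hz ⊢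
    intro b
    have := congrArg e (hz (e.symm b))
    simpa using this
  have key2 : ∀ z, z ∈ Subalgebra.center k C → e.symm z ∈ Subalgebra.center k A := by
    intro z hz
    rw [Subalgebra.mem_center_iff] at hz ⊢
    intro b
    have := congrArg e.symm (hz (e b))
    simpa using this
  have hmap : (ozoneGroup k A).map (AlgEquiv.autCongr e).toMonoidHom = ozoneGroup k C := by
    ext τ
    constructor
    · rintro ⟨σ, hσ, rfl⟩ z hz
      have := hσ _ (key2 z hz)
      show e (σ (e.symm z)) = z
      rw [this, AlgEquiv.apply_symm_apply]
    · intro hτ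
      refine ⟨(AlgEquiv.autCongr e).symm τ, ?_, (AlgEquiv.autCongr e).apply_symm_apply τ⟩
      intro z hz
      have := hτ _ (key z hz)
      show e.symm (τ (e z)) = z
      rw [this, AlgEquiv.symm_apply_apply]
  exact ⟨((AlgEquiv.autCongr e).subgroupMap _).trans (MulEquiv.subgroupCongr hmap)⟩

section Skly

variable {k : Type*} [Field k] {ξ : k}

lemma sxy : Skly0.x k * Skly0.y k = Skly0.z k * Skly0.z k := by
  have := RingQuot.mkAlgHom_rel k (Skly0Rel.xy (k := k))
  simp only [map_mul, map_pow, pow_two] at this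
  exact this
lemma syz : Skly0.y k * Skly0.z k = Skly0.x k * Skly0.x k := by
  have := RingQuot.mkAlgHom_rel k (Skly0Rel.yz (k := k))
  simp only [map_mul, map_pow, pow_two] at this
  exact this
lemma szx : Skly0.z k * Skly0.x k = Skly0.y k * Skly0.y k := by
  have := RingQuot.mkAlgHom_rel k (Skly0Rel.zx (k := k))
  simp only [map_mul, map_pow, pow_two] at this
  exact this

variable (h : 1 + ξ + ξ ^ 2 = 0)
include h

lemma sYX : (Skly0.x k + ξ • Skly0.y k + (ξ ^ 2) • Skly0.z k) * (Skly0.x k + Skly0.y k + Skly0.z k) =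
        ξ • ((Skly0.x k + Skly0.y k + Skly0.z k) *
          (Skly0.x k + ξ • Skly0.y k + (ξ ^ 2) • Skly0.z k)) := by
  simp only [mul_add, add_mul, smul_mul_assoc, mul_smul_comm, smul_smul, smul_add, sxy, syz, szx]
  match_scalars <;> grind

lemma sZY : (Skly0.x k + (ξ ^ 2) • Skly0.y k + ξ • Skly0.z k) *
        (Skly0.x k + ξ • Skly0.y k + (ξ ^ 2) • Skly0.z k) =
      ξ • ((Skly0.x k + ξ • Skly0.y k + (ξ ^ 2) • Skly0.z k) *
        (Skly0.x k + (ξ ^ 2) • Skly0.y k + ξ • Skly0.z k)) := by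
  simp only [mul_add, add_mul, smul_mul_assoc, mul_smul_comm, smul_smul, smul_add, sxy, syz, szx]
  match_scalars <;> grind

lemma sXZ : (Skly0.x k + Skly0.y k + Skly0.z k) *
        (Skly0.x k + (ξ ^ 2) • Skly0.y k + ξ • Skly0.z k) =
      ξ • ((Skly0.x k + (ξ ^ 2) • Skly0.y k + ξ • Skly0.z k) *
        (Skly0.x k + Skly0.y k + Skly0.z k)) := by
  simp only [mul_add, add_mul, smul_mul_assoc, mul_smul_comm, smul_smul, smul_add, sxy, syz, szx]
  match_scalars <;> grind

/-- `B → A` -/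
def toA : B ξ →ₐ[k] Skly0 k :=
  lift ![Skly0.x k + Skly0.y k + Skly0.z k, Skly0.x k + ξ • Skly0.y k + (ξ ^ 2) • Skly0.z k,
      Skly0.x k + (ξ ^ 2) • Skly0.y k + ξ • Skly0.z k]
    (sYX h) (sZY h) (by
      have h3 : ξ ^ 2 * ξ = 1 := by grind
      show (Skly0.x k + (ξ ^ 2) • Skly0.y k + ξ • Skly0.z k) *
        (Skly0.x k + Skly0.y k + Skly0.z k) = ξ ^ 2 • ((Skly0.x k + Skly0.y k + Skly0.z k) *
        (Skly0.x k + (ξ ^ 2) • Skly0.y k + ξ • Skly0.z k))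
      rw [sXZ h, smul_smul, h3, one_smul])

lemma toA0 : toA h (gen ξ 0) = Skly0.x k + Skly0.y k + Skly0.z k := lift_gen ..
lemma toA1 : toA h (gen ξ 1) = Skly0.x k + ξ • Skly0.y k + (ξ ^ 2) • Skly0.z k := lift_gen ..
lemma toA2 : toA h (gen ξ 2) = Skly0.x k + (ξ ^ 2) • Skly0.y k + ξ • Skly0.z k := lift_gen ..

omit h in
/-- images of x, y, z -/
def vB (ξ : k) : Fin 3 → B ξ :=
  ![(3⁻¹ : k) • (gen ξ 0 + gen ξ 1 + gen ξ 2), (3⁻¹ : k) • (gen ξ 0 + ξ ^ 2 • gen ξ 1 + ξ • gen ξ 2),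
    (3⁻¹ : k) • (gen ξ 0 + ξ • gen ξ 1 + ξ ^ 2 • gen ξ 2)]

/-- `A → B` -/
def toB : Skly0 k →ₐ[k] B ξ :=
  RingQuot.liftAlgHom k ⟨FreeAlgebra.lift k (vB ξ), by
    rintro _ _ (_ | _ | _)
    all_goals
      simp only [map_mul, map_pow, FreeAlgebra.lift_ι_apply, pow_two (vB ξ _)]
      simp only [vB, Matrix.cons_val]
      simp only [mul_add, add_mul, smul_mul_assoc, mul_smul_comm, smul_smul, smul_add, rYX, rZY, rZX]
      match_scalars <;> grind⟩

lemma toBx : toB h (Skly0.x k) = (3⁻¹ : k) • (gen ξ 0 + gen ξ 1 + gen ξ 2) := by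
  simp [toB, Skly0.x, vB]
lemma toBy : toB h (Skly0.y k) = (3⁻¹ : k) • (gen ξ 0 + ξ ^ 2 • gen ξ 1 + ξ • gen ξ 2) := by
  simp [toB, Skly0.y, vB]
lemma toBz : toB h (Skly0.z k) = (3⁻¹ : k) • (gen ξ 0 + ξ • gen ξ 1 + ξ ^ 2 • gen ξ 2) := by
  simp [toB, Skly0.z, vB]

/-- The isomorphism. -/
def equivAB [CharZero k] : Skly0 k ≃ₐ[k] B ξ :=
  have h30 : (3 : k) ≠ 0 := by norm_num
  AlgEquiv.ofAlgHom (toB h) (toA h)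
    (by
      apply ext_gen
      intro i
      fin_cases i
      · show toB h (toA h (gen ξ 0)) = gen ξ 0
        simp only [toA0, map_add, map_smul, toBx, toBy, toBz]
        match_scalars <;> grind
      · show toB h (toA h (gen ξ 1)) = gen ξ 1
        simp only [toA1, map_add, map_smul, toBx, toBy, toBz]
        match_scalars <;> grind
      · show toB h (toA h (gen ξ 2)) = gen ξ 2
        simp only [toA2, map_add, map_smul, toBx, toBy, toBz]
        match_scalars <;> grind)
    (by
      apply RingQuot.ringQuot_ext'
      apply FreeAlgebra.hom_ext
      funext i
      fin_cases i
      · show toA h (toB h (Skly0.x k)) = Skly0.x k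
        simp only [toA0, toA1, toA2, map_add, map_smul, toBx]
        match_scalars <;> grind
      · show toA h (toB h (Skly0.y k)) = Skly0.y k
        simp only [toA0, toA1, toA2, map_add, map_smul, toBy]
        match_scalars <;> grind
      · show toA h (toB h (Skly0.z k)) = Skly0.z k
        simp only [toA0, toA1, toA2, map_add, map_smul, toBz]
        match_scalars <;> grind)

end Skly

end Ozone9

/-- Suppose `k` is algebraically closed of characteristic 0 and let
`ξ ∈ k` be a primitive third root of unity. In `A = S(1,0,−1)` the elements
`X = x+y+z`, `Y = x+ξy+ξ²z`, `Z = x+ξ²y+ξz` satisfy `YX = ξXY`, `ZY = ξYZ`, `XZ = ξZX`,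
`A` is isomorphic to a skew polynomial ring in three variables, and the ozone group of
`A` is isomorphic to `ℤ/3 × ℤ/3`. -/
theorem stmt9 (k : Type*) [Field k] [CharZero k] [IsAlgClosed k]
    (ξ : k) (hξ : IsPrimitiveRoot ξ 3) :
    (Skly0.x k + ξ • Skly0.y k + (ξ ^ 2) • Skly0.z k) * (Skly0.x k + Skly0.y k + Skly0.z k) =
        ξ • ((Skly0.x k + Skly0.y k + Skly0.z k) *
          (Skly0.x k + ξ • Skly0.y k + (ξ ^ 2) • Skly0.z k)) ∧
    (Skly0.x k + (ξ ^ 2) • Skly0.y k + ξ • Skly0.z k) *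
        (Skly0.x k + ξ • Skly0.y k + (ξ ^ 2) • Skly0.z k) =
      ξ • ((Skly0.x k + ξ • Skly0.y k + (ξ ^ 2) • Skly0.z k) *
        (Skly0.x k + (ξ ^ 2) • Skly0.y k + ξ • Skly0.z k)) ∧
    (Skly0.x k + Skly0.y k + Skly0.z k) *
        (Skly0.x k + (ξ ^ 2) • Skly0.y k + ξ • Skly0.z k) =
      ξ • ((Skly0.x k + (ξ ^ 2) • Skly0.y k + ξ • Skly0.z k) *
        (Skly0.x k + Skly0.y k + Skly0.z k)) ∧
    (∃ p : Fin 3 → Fin 3 → k, (∀ i, p i i = 1) ∧ (∀ i j, p j i = (p i j)⁻¹) ∧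
      Nonempty (Skly0 k ≃ₐ[k] SkewPoly k 3 p)) ∧
    Nonempty (↥(ozoneGroup k (Skly0 k)) ≃*
      Multiplicative (ZMod 3) × Multiplicative (ZMod 3)) := by
  have h : 1 + ξ + ξ ^ 2 = 0 := by
    have := hξ.geom_sum_eq_zero (by norm_num)
    simpa [Finset.sum_range_succ] using this
  have h3 := hξ.pow_eq_one
  have h0 : ξ ≠ 0 := hξ.ne_zero (by norm_num)
  refine ⟨Ozone9.sYX h, Ozone9.sZY h, Ozone9.sXZ h, ⟨Ozone9.P ξ, ?_, ?_, ⟨Ozone9.equivAB h⟩⟩, ?_⟩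
  · intro i
    fin_cases i <;> rfl
  · intro i j
    fin_cases i <;> fin_cases j <;> simp [Ozone9.P] <;> field_simp <;> grind
  · obtain ⟨e1⟩ := Ozone9.oz_congr (Ozone9.equivAB (ξ := ξ) h)
    obtain ⟨e2⟩ := Ozone9.oz_B hξ
    exact ⟨e1.trans e2⟩
end
end

section
/- Suppose k is algebraically closed of characteristic 0. Let α ∈ k be a primitive mth root of unity with m ≥ 2 and 3 not dividing m, and let S_α be the quotient of k⟨x,y,z⟩ by the relations yx − αz², xz − αy², and zy − αx². Then the ozone group Oz(S_α) is isomorphic to ℤ/3 × ℤ/3, generated by the cyclic-permutation automorphism τ: x ↦ z ↦ y ↦ x and the automorphism ρ scaling x, y, z by a fixed primitive third root of unity. -/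
noncomputable section

/-- The defining relations of the algebra `S_α`:
`yx = αz²`, `xz = αy²`, `zy = αx²` (generators `x = ι 0`, `y = ι 1`, `z = ι 2`). -/
inductive SalphaRel (k : Type*) [Field k] (α : k) :
    FreeAlgebra k (Fin 3) → FreeAlgebra k (Fin 3) → Prop
  | yx : SalphaRel k α (FreeAlgebra.ι k 1 * FreeAlgebra.ι k 0) (α • (FreeAlgebra.ι k 2 ^ 2))
  | xz : SalphaRel k α (FreeAlgebra.ι k 0 * FreeAlgebra.ι k 2) (α • (FreeAlgebra.ι k 1 ^ 2))
  | zy : SalphaRel k α (FreeAlgebra.ι k 2 * FreeAlgebra.ι k 1) (α • (FreeAlgebra.ι k 0 ^ 2))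

/-- The algebra `S_α = k⟨x,y,z⟩/(yx − αz², xz − αy², zy − αx²)`. -/
abbrev Salpha (k : Type*) [Field k] (α : k) := RingQuot (SalphaRel k α)

/-- The generator `x` of `S_α`. -/
def Salpha.x (k : Type*) [Field k] (α : k) : Salpha k α :=
  RingQuot.mkAlgHom k (SalphaRel k α) (FreeAlgebra.ι k 0)

/-- The generator `y` of `S_α`. -/
def Salpha.y (k : Type*) [Field k] (α : k) : Salpha k α :=
  RingQuot.mkAlgHom k (SalphaRel k α) (FreeAlgebra.ι k 1)

/-- The generator `z` of `S_α`. -/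
def Salpha.z (k : Type*) [Field k] (α : k) : Salpha k α :=
  RingQuot.mkAlgHom k (SalphaRel k α) (FreeAlgebra.ι k 2)


namespace Sal

open Salpha

/-! ### Generic facts -/

theorem qcomm {k R : Type*} [Field k] [Semiring R] [Algebra k R] {a b : R} {q : k}
    (h : b * a = q • (a * b)) (m n : ℕ) : b ^ m * a ^ n = q ^ (m * n) • (a ^ n * b ^ m) := by
  have h1 : ∀ n : ℕ, b * a ^ n = q ^ n • (a ^ n * b) := by
    intro n
    induction n with
    | zero => simp
    | succ n ih =>
      rw [pow_succ, ← mul_assoc, ih, smul_mul_assoc, mul_assoc, h, mul_smul_comm, smul_smul,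
        mul_assoc, pow_succ]
  induction m with
  | zero => simp
  | succ m ih =>
    rw [pow_succ, mul_assoc, h1, mul_smul_comm, ← mul_assoc, ih, smul_mul_assoc, smul_smul,
      mul_assoc, Nat.succ_mul, pow_add, mul_comm (q ^ n)]

theorem qcommE {k M : Type*} [Field k] [AddCommMonoid M] [Module k M] {a b : Module.End k M} {q : k}
    (h : b * a = q • (a * b)) (m n : ℕ) : b ^ m * a ^ n = q ^ (m * n) • (a ^ n * b ^ m) :=
  qcomm (k := k) (R := Module.End k M) h m n

section gen
variable {k R : Type*} [Field k] [Ring R] [Algebra k R] {α : k} {x y z : R}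

theorem cube1 (hxz : x * z = α • y ^ 2) (hα : α ≠ 0)
    (hzy : z * y = α • x ^ 2) : x ^ 3 = y ^ 3 := by
  have h : x * (z * y) = (x * z) * y := by rw [mul_assoc]
  rw [hxz, hzy, mul_smul_comm, smul_mul_assoc] at h
  have := smul_right_injective R hα h
  rw [pow_succ' x 2, this, ← pow_succ]

theorem XY_y (hyx : y * x = α • z ^ 2) (hxz : x * z = α • y ^ 2)
    (hzy : z * y = α • x ^ 2) : (x * y * z) * y = α ^ 3 • (y * (y * z * x)) := by
  calc (x * y * z) * y = x * y * (z * y) := by rw [mul_assoc]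
    _ = α • (x * (y * x) * x) := by rw [hzy, mul_smul_comm]; simp only [pow_two, mul_assoc]
    _ = (α * α) • ((x * z) * z * x) := by
        rw [hyx, mul_smul_comm, smul_mul_assoc, smul_smul]; simp only [pow_two, mul_assoc]
    _ = _ := by
        rw [hxz, smul_mul_assoc, smul_mul_assoc, smul_smul]; simp only [pow_succ, pow_zero, one_mul, mul_assoc]

theorem XY_z (hyx : y * x = α • z ^ 2) (hxz : x * z = α • y ^ 2)
    (hzy : z * y = α • x ^ 2) : z * (y * z * x) = α ^ 3 • ((x * y * z) * z) := by
  calc z * (y * z * x) = (z * y) * z * x := by simp only [mul_assoc]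
    _ = α • (x * (x * z) * x) := by
        rw [hzy, smul_mul_assoc, smul_mul_assoc]; simp only [pow_two, mul_assoc]
    _ = (α * α) • (x * y * (y * x)) := by
        rw [hxz, mul_smul_comm, smul_mul_assoc, smul_smul]; simp only [pow_two, mul_assoc]
    _ = _ := by
        rw [hyx, mul_smul_comm, smul_smul]; simp only [pow_succ, pow_zero, one_mul, mul_assoc]

theorem powconj {X Y g : R} {q : k} (h : X * g = q • (g * Y)) (s : ℕ) :
    X ^ s * g = q ^ s • (g * Y ^ s) := by
  induction s with
  | zero => simp
  | succ s ih =>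
    rw [pow_succ, mul_assoc, h, mul_smul_comm, ← mul_assoc, ih, smul_mul_assoc, smul_smul,
      mul_assoc, ← pow_succ', ← pow_succ]

theorem powconj' {X Y g : R} {q : k} (h : g * Y = q • (X * g)) (s : ℕ) :
    g * Y ^ s = q ^ s • (X ^ s * g) := by
  induction s with
  | zero => simp
  | succ s ih =>
    rw [pow_succ', ← mul_assoc, h, smul_mul_assoc, mul_assoc, ih, mul_smul_comm, smul_smul,
      ← mul_assoc, ← pow_succ', ← pow_succ']

/-- conjugation by `X^s x`. -/
theorem Aconj (hyx : y * x = α • z ^ 2) (hxz : x * z = α • y ^ 2)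
    (hzy : z * y = α • x ^ 2) (s : ℕ) (hs : α ^ (3 * s + 1) = 1) :
    ((x * y * z) ^ s * x) * x = z * ((y * z * x) ^ s * y) ∧
    ((x * y * z) ^ s * x) * y = x * ((y * z * x) ^ s * y) ∧
    ((x * y * z) ^ s * x) * z = y * ((y * z * x) ^ s * y) := by
  have hx := powconj (k := k) (X := x * y * z) (Y := y * z * x) (g := x) (q := 1)
    (by simp only [one_smul, mul_assoc]) s
  have hy := powconj (XY_y hyx hxz hzy) s
  have hz := powconj' (XY_z hyx hxz hzy) s
  rw [one_pow, one_smul] at hx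
  have hs2 : (α ^ 3) ^ s * α = 1 := by rw [← hs, pow_succ _ (3 * s), pow_mul]
  have hs3 : α * (α ^ 3) ^ s = 1 := by rw [mul_comm, hs2]
  refine ⟨?_, ?_, ?_⟩
  · rw [← mul_assoc z, hz, smul_mul_assoc, mul_assoc _ z, hzy, mul_smul_comm, smul_smul, hs2,
      one_smul, pow_two, mul_assoc]
  · rw [hx, mul_assoc]
  · rw [mul_assoc, hxz, mul_smul_comm, pow_two, ← mul_assoc _ y, hy, smul_mul_assoc, smul_smul,
      hs3, one_smul, mul_assoc]

end gen

/-! ### Presentation -/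

section pres
variable (k : Type*) [Field k] (α : k)

theorem rel_yx : y k α * x k α = α • z k α ^ 2 := by
  have := RingQuot.mkAlgHom_rel k (SalphaRel.yx (k := k) (α := α))
  rw [map_mul, map_smul, map_pow] at this
  exact this

theorem rel_xz : x k α * z k α = α • y k α ^ 2 := by
  have := RingQuot.mkAlgHom_rel k (SalphaRel.xz (k := k) (α := α))
  rw [map_mul, map_smul, map_pow] at this
  exact this

theorem rel_zy : z k α * y k α = α • x k α ^ 2 := by
  have := RingQuot.mkAlgHom_rel k (SalphaRel.zy (k := k) (α := α))
  rw [map_mul, map_smul, map_pow] at this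
  exact this

variable {k α}

theorem ind {p : Salpha k α → Prop} (hc : ∀ c : k, p (algebraMap k _ c))
    (hx : p (x k α)) (hy : p (y k α)) (hz : p (z k α))
    (ha : ∀ a b, p a → p b → p (a + b)) (hm : ∀ a b, p a → p b → p (a * b)) (s : Salpha k α) :
    p s := by
  obtain ⟨f, rfl⟩ := RingQuot.mkAlgHom_surjective k (SalphaRel k α) s
  induction f using FreeAlgebra.induction with
  | grade0 r => rw [AlgHom.commutes]; exact hc r
  | grade1 i => fin_cases i; exacts [hx, hy, hz]
  | mul a b h1 h2 => rw [map_mul]; exact hm _ _ h1 h2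
  | add a b h1 h2 => rw [map_add]; exact ha _ _ h1 h2

def liftS {R : Type*} [Ring R] [Algebra k R] (a b c : R) (h1 : b * a = α • c ^ 2)
    (h2 : a * c = α • b ^ 2) (h3 : c * b = α • a ^ 2) : Salpha k α →ₐ[k] R :=
  RingQuot.liftAlgHom k ⟨FreeAlgebra.lift k ![a, b, c], by
    intro u v h
    cases h <;> simpa⟩

section
variable {R : Type*} [Ring R] [Algebra k R] {a b c : R} (h1 : b * a = α • c ^ 2)
    (h2 : a * c = α • b ^ 2) (h3 : c * b = α • a ^ 2)

theorem liftS_x : liftS a b c h1 h2 h3 (x k α) = a := by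
  simp [liftS, Salpha.x]
theorem liftS_y : liftS a b c h1 h2 h3 (y k α) = b := by
  simp [liftS, Salpha.y]
theorem liftS_z : liftS a b c h1 h2 h3 (z k α) = c := by
  simp [liftS, Salpha.z]
end

theorem hom_ext {R : Type*} [Ring R] [Algebra k R] {f g : Salpha k α →ₐ[k] R}
    (hx : f (x k α) = g (x k α)) (hy : f (y k α) = g (y k α)) (hz : f (z k α) = g (z k α)) :
    f = g := by
  refine AlgHom.ext fun s => ?_
  refine ind (p := fun s => f s = g s) ?_ hx hy hz ?_ ?_ s
  · intro c; simp
  · intro a b h h'; simp [h, h']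
  · intro a b h h'; simp [h, h']

theorem equiv_ext {f g : Salpha k α ≃ₐ[k] Salpha k α}
    (hx : f (x k α) = g (x k α)) (hy : f (y k α) = g (y k α)) (hz : f (z k α) = g (z k α)) :
    f = g := by
  ext s
  exact DFunLike.congr_fun (hom_ext (f := (f : Salpha k α →ₐ[k] Salpha k α)) (g := g) hx hy hz) s

variable (k α) in
def tauHom : Salpha k α →ₐ[k] Salpha k α :=
  liftS (z k α) (x k α) (y k α) (rel_xz k α) (rel_zy k α) (rel_yx k α)

variable (k α) in
def tauInvHom : Salpha k α →ₐ[k] Salpha k α :=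
  liftS (y k α) (z k α) (x k α) (rel_zy k α) (rel_yx k α) (rel_xz k α)

variable (k α) in
def tau : Salpha k α ≃ₐ[k] Salpha k α :=
  AlgEquiv.ofAlgHom (tauHom k α) (tauInvHom k α)
    (by apply hom_ext <;> simp [tauHom, tauInvHom, liftS_x, liftS_y, liftS_z])
    (by apply hom_ext <;> simp [tauHom, tauInvHom, liftS_x, liftS_y, liftS_z])

theorem tau_x : tau k α (x k α) = z k α := by simp [tau, tauHom, liftS_x]
theorem tau_y : tau k α (y k α) = x k α := by simp [tau, tauHom, liftS_y]
theorem tau_z : tau k α (z k α) = y k α := by simp [tau, tauHom, liftS_z]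
theorem tau_symm_x : (tau k α).symm (x k α) = y k α := by simp [tau, tauInvHom, liftS_x]
theorem tau_symm_y : (tau k α).symm (y k α) = z k α := by simp [tau, tauInvHom, liftS_y]
theorem tau_symm_z : (tau k α).symm (z k α) = x k α := by simp [tau, tauInvHom, liftS_z]

theorem scale_rel {c : k} {R : Type*} [Ring R] [Algebra k R] {a b d : R}
    (h : a * b = α • d ^ 2) : (c • a) * (c • b) = α • (c • d) ^ 2 := by
  rw [smul_mul_smul_comm, h, smul_pow, smul_smul, smul_smul, pow_two c, mul_comm α]

def scaleHom (α c : k) : Salpha k α →ₐ[k] Salpha k α :=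
  liftS (c • x k α) (c • y k α) (c • z k α) (scale_rel (rel_yx k α)) (scale_rel (rel_xz k α))
    (scale_rel (rel_zy k α))

def rho (α c : k) (hc : c ≠ 0) : Salpha k α ≃ₐ[k] Salpha k α :=
  AlgEquiv.ofAlgHom (scaleHom α c) (scaleHom α c⁻¹)
    (by apply hom_ext <;> simp [scaleHom, liftS_x, liftS_y, liftS_z, smul_smul, hc])
    (by apply hom_ext <;> simp [scaleHom, liftS_x, liftS_y, liftS_z, smul_smul, hc])

theorem rho_x (c : k) (hc : c ≠ 0) : rho α c hc (x k α) = c • x k α := by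
  simp [rho, scaleHom, liftS_x]
theorem rho_y (c : k) (hc : c ≠ 0) : rho α c hc (y k α) = c • y k α := by
  simp [rho, scaleHom, liftS_y]
theorem rho_z (c : k) (hc : c ≠ 0) : rho α c hc (z k α) = c • z k α := by
  simp [rho, scaleHom, liftS_z]

end pres

/-! ### The monomial model -/

section model
variable {k : Type*} [Field k] (α : k)

/-- The underlying space of the model. -/
abbrev V (k : Type*) [Field k] := (ℕ × ℕ × ℕ) →₀ k

abbrev E (u : ℕ × ℕ × ℕ) : V k := Finsupp.single u 1

def Lx : Module.End k (V k) := Finsupp.linearCombination k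
  (fun u : ℕ × ℕ × ℕ => α ^ ((u.1 : ℤ) * u.2.1 - u.1 * u.2.2) • (E (u.2.1 + 1, u.2.2, u.1) : V k))
def Ly : Module.End k (V k) := Finsupp.linearCombination k
  (fun u : ℕ × ℕ × ℕ => α ^ ((u.1 : ℤ) * u.2.1 - u.1 * u.2.2 - u.2.1) •
    (E (u.2.1, u.2.2 + 1, u.1) : V k))
def Lz : Module.End k (V k) := Finsupp.linearCombination k
  (fun u : ℕ × ℕ × ℕ => α ^ ((u.1 : ℤ) * u.2.1 - u.1 * u.2.2 + u.2.1 - u.2.2) •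
    (E (u.2.1, u.2.2, u.1 + 1) : V k))

theorem Lx_E (i j l : ℕ) : Lx α (E (i, j, l)) =
    α ^ ((i : ℤ) * j - i * l) • (E (j + 1, l, i) : V k) := by
  simp [Lx, E]
theorem Ly_E (i j l : ℕ) : Ly α (E (i, j, l)) =
    α ^ ((i : ℤ) * j - i * l - j) • (E (j, l + 1, i) : V k) := by
  simp [Ly, E]
theorem Lz_E (i j l : ℕ) : Lz α (E (i, j, l)) =
    α ^ ((i : ℤ) * j - i * l + j - l) • (E (j, l, i + 1) : V k) := by
  simp [Lz, E]

theorem V_ext {M : Type*} [AddCommMonoid M] [Module k M] {f g : V k →ₗ[k] M}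
    (h : ∀ i j l, f (E (i, j, l)) = g (E (i, j, l))) : f = g := by
  apply Finsupp.lhom_ext'
  rintro ⟨i, j, l⟩
  apply LinearMap.ext_ring
  exact h i j l

variable {α}

def phi (hα : α ≠ 0) : Salpha k α →ₐ[k] Module.End k (V k) :=
  liftS (Lx α) (Ly α) (Lz α)
    (by
      apply V_ext; intro i j l
      simp only [pow_two, Module.End.mul_apply, LinearMap.smul_apply, Lx_E, Ly_E, Lz_E, map_smul,
        smul_smul, ← zpow_add₀ hα, ← zpow_one_add₀ hα]
      congr 2; push_cast; ring)
    (by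
      apply V_ext; intro i j l
      simp only [pow_two, Module.End.mul_apply, LinearMap.smul_apply, Lx_E, Ly_E, Lz_E, map_smul,
        smul_smul, ← zpow_add₀ hα, ← zpow_one_add₀ hα]
      congr 2; push_cast; ring)
    (by
      apply V_ext; intro i j l
      simp only [pow_two, Module.End.mul_apply, LinearMap.smul_apply, Lx_E, Ly_E, Lz_E, map_smul,
        smul_smul, ← zpow_add₀ hα, ← zpow_one_add₀ hα]
      congr 2; push_cast; ring)

theorem phi_x (hα : α ≠ 0) : phi hα (x k α) = Lx α := liftS_x _ _ _
theorem phi_y (hα : α ≠ 0) : phi hα (y k α) = Ly α := liftS_y _ _ _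
theorem phi_z (hα : α ≠ 0) : phi hα (z k α) = Lz α := liftS_z _ _ _

/-- Untwisted left multiplication on `S`. -/
def hat (g : Salpha k α) : Module.End k (Salpha k α) :=
  LinearMap.mulLeft k g * (tau k α).symm.toLinearMap

theorem hat_apply (g s : Salpha k α) : hat g s = g * (tau k α).symm s := rfl

def tauL : Module.End k (Salpha k α) := (tau k α).toLinearMap

theorem tauL_apply (s : Salpha k α) : tauL s = tau k α s := rfl

theorem hat_tau (g s : Salpha k α) : hat g (tauL s) = g * s := by
  simp [hat_apply, tauL_apply]

theorem semi (g : Salpha k α) : SemiconjBy tauL (hat g) (hat (tau k α g)) := by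
  ext s
  simp [hat_apply, tauL_apply, Module.End.mul_apply]

theorem hat_zx : hat (z k α) * hat (x k α) = α • (hat (x k α) * hat (z k α)) := by
  refine LinearMap.ext fun s => ?_
  simp only [Module.End.mul_apply, LinearMap.smul_apply, hat_apply, map_mul, tau_symm_x,
    tau_symm_z, ← mul_assoc, rel_zy, pow_two, smul_mul_assoc]

theorem hat_zy (hα : α ≠ 0) :
    hat (z k α) * hat (y k α) = α⁻¹ • (hat (y k α) * hat (z k α)) := by
  refine LinearMap.ext fun s => ?_
  simp only [Module.End.mul_apply, LinearMap.smul_apply, hat_apply, map_mul, tau_symm_y,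
    tau_symm_z, ← mul_assoc, rel_yx, pow_two, smul_mul_assoc, smul_smul,
    inv_mul_cancel₀ hα, one_smul]

theorem hat_yx (hα : α ≠ 0) :
    hat (y k α) * hat (x k α) = α⁻¹ • (hat (x k α) * hat (y k α)) := by
  refine LinearMap.ext fun s => ?_
  simp only [Module.End.mul_apply, LinearMap.smul_apply, hat_apply, map_mul, tau_symm_x,
    tau_symm_y, ← mul_assoc, rel_xz, pow_two, smul_mul_assoc, smul_smul,
    inv_mul_cancel₀ hα, one_smul]

variable (k α) in
def w (u : ℕ × ℕ × ℕ) : Salpha k α :=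
  (hat (x k α) ^ u.1 * hat (y k α) ^ u.2.1 * hat (z k α) ^ u.2.2) 1

theorem tau_w (hα : α ≠ 0) (i j l : ℕ) :
    tauL (w k α (i, j, l)) = α ^ ((i : ℤ) * j - i * l) • w k α (j, l, i) := by
  have h := (((semi (x k α)).pow_right i).mul_right ((semi (y k α)).pow_right j)).mul_right
    ((semi (z k α)).pow_right l)
  have h2 := LinearMap.congr_fun h.eq 1
  simp only [tau_x, tau_y, tau_z] at h2
  have h1 : tauL (1 : Salpha k α) = 1 := by simp [tauL_apply]
  rw [Module.End.mul_apply tauL, Module.End.mul_apply _ tauL, h1] at h2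
  unfold w
  rw [h2, ← LinearMap.smul_apply]
  congr 1
  rw [qcommE hat_zx, smul_mul_assoc, mul_assoc, qcommE (hat_zy hα), mul_smul_comm, smul_smul,
    mul_assoc]
  congr 1
  rw [zpow_sub₀ hα, inv_pow, div_eq_mul_inv]
  norm_cast

theorem x_w (hα : α ≠ 0) (i j l : ℕ) :
    x k α * w k α (i, j, l) = α ^ ((i : ℤ) * j - i * l) • w k α (j + 1, l, i) := by
  rw [← hat_tau, tau_w hα, map_smul]
  congr 1
  unfold w
  simp only [pow_succ', ← Module.End.mul_apply, mul_assoc]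

theorem y_w (hα : α ≠ 0) (i j l : ℕ) :
    y k α * w k α (i, j, l) = α ^ ((i : ℤ) * j - i * l - j) • w k α (j, l + 1, i) := by
  rw [← hat_tau, tau_w hα, map_smul, zpow_sub₀ hα _ (j : ℤ), div_eq_mul_inv, ← smul_smul]
  congr 1
  unfold w
  have := qcommE (hat_yx (k := k) hα) 1 j
  rw [pow_one, one_mul] at this
  rw [← Module.End.mul_apply, ← LinearMap.smul_apply]
  congr 1
  dsimp only
  rw [← mul_assoc, ← mul_assoc, this, pow_succ']
  simp only [smul_mul_assoc, mul_assoc, inv_pow, zpow_natCast]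

theorem z_w (hα : α ≠ 0) (i j l : ℕ) :
    z k α * w k α (i, j, l) = α ^ ((i : ℤ) * j - i * l + j - l) • w k α (j, l, i + 1) := by
  rw [← hat_tau, tau_w hα, map_smul, zpow_sub₀ hα _ (l : ℤ), zpow_add₀ hα, mul_div_assoc,
    ← smul_smul]
  congr 1
  unfold w
  have h1 := qcommE (hat_zx (k := k) (α := α)) 1 j
  have h2 := qcommE (hat_zy (k := k) hα) 1 l
  rw [pow_one, one_mul] at h1 h2
  rw [← Module.End.mul_apply, ← LinearMap.smul_apply]
  congr 1
  dsimp only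
  rw [← mul_assoc, ← mul_assoc, h1, smul_mul_assoc, mul_assoc _ (hat (z k α)), h2, pow_succ']
  simp only [smul_mul_assoc, mul_smul_comm, smul_smul, mul_assoc, inv_pow, zpow_natCast,
    div_eq_mul_inv]

variable (k α) in
def psi : V k →ₗ[k] Salpha k α := Finsupp.linearCombination k (w k α)

theorem psi_E (u : ℕ × ℕ × ℕ) : psi k α (E u) = w k α u := by simp [psi, E]

theorem psi_phi (hα : α ≠ 0) (s : Salpha k α) : ∀ v, psi k α (phi hα s v) = s * psi k α v := by
  refine ind (p := fun s => ∀ v, psi k α (phi hα s v) = s * psi k α v) ?_ ?_ ?_ ?_ ?_ ?_ s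
  · intro c v
    rw [AlgHom.commutes, Module.algebraMap_end_apply, map_smul, Algebra.smul_def]
  · intro v
    rw [phi_x]
    have : psi k α ∘ₗ Lx α = LinearMap.mulLeft k (x k α) ∘ₗ psi k α := by
      apply V_ext; intro i j l
      rw [LinearMap.comp_apply, LinearMap.comp_apply, Lx_E, map_smul, psi_E, psi_E,
        LinearMap.mulLeft_apply, x_w hα]
    exact LinearMap.congr_fun this v
  · intro v
    rw [phi_y]
    have : psi k α ∘ₗ Ly α = LinearMap.mulLeft k (y k α) ∘ₗ psi k α := by
      apply V_ext; intro i j l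
      rw [LinearMap.comp_apply, LinearMap.comp_apply, Ly_E, map_smul, psi_E, psi_E,
        LinearMap.mulLeft_apply, y_w hα]
    exact LinearMap.congr_fun this v
  · intro v
    rw [phi_z]
    have : psi k α ∘ₗ Lz α = LinearMap.mulLeft k (z k α) ∘ₗ psi k α := by
      apply V_ext; intro i j l
      rw [LinearMap.comp_apply, LinearMap.comp_apply, Lz_E, map_smul, psi_E, psi_E,
        LinearMap.mulLeft_apply, z_w hα]
    exact LinearMap.congr_fun this v
  · intro a b ha hb v
    rw [map_add, LinearMap.add_apply, map_add, ha, hb, add_mul]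
  · intro a b ha hb v
    rw [map_mul, Module.End.mul_apply, ha, hb, mul_assoc]

theorem w_zero : w k α (0, 0, 0) = 1 := by simp [w]

/-- `s ↦ s · e₀`. -/
def vec (hα : α ≠ 0) (s : Salpha k α) : V k := phi hα s (E (0, 0, 0))

theorem psi_vec (hα : α ≠ 0) (s : Salpha k α) : psi k α (vec hα s) = s := by
  rw [vec, psi_phi, psi_E, w_zero, mul_one]

theorem vec_inj (hα : α ≠ 0) {s t : Salpha k α} (h : vec hα s = vec hα t) : s = t := by
  rw [← psi_vec hα s, h, psi_vec]

theorem vec_mul (hα : α ≠ 0) (s t : Salpha k α) : vec hα (s * t) = phi hα s (vec hα t) := by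
  simp [vec]

/-! ### Monomial elements -/

def Mono (hα : α ≠ 0) (s : Salpha k α) (f : ℕ × ℕ × ℕ → ℕ × ℕ × ℕ) : Prop :=
  ∀ v, ∃ c : k, c ≠ 0 ∧ phi hα s (E v) = c • E (f v)

theorem Mono.mul {hα : α ≠ 0} {s t : Salpha k α} {f g : ℕ × ℕ × ℕ → ℕ × ℕ × ℕ}
    (hs : Mono hα s f) (ht : Mono hα t g) : Mono hα (s * t) (fun v => f (g v)) := by
  intro v
  obtain ⟨c, hc, h⟩ := ht v
  obtain ⟨d, hd, h'⟩ := hs (g v)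
  exact ⟨c * d, mul_ne_zero hc hd, by
    rw [map_mul, Module.End.mul_apply, h, map_smul, h', smul_smul]⟩

theorem Mono.x (hα : α ≠ 0) : Mono hα (x k α) (fun v => (v.2.1 + 1, v.2.2, v.1)) := by
  rintro ⟨i, j, l⟩
  exact ⟨_, zpow_ne_zero _ hα, by rw [phi_x, Lx_E]⟩
theorem Mono.y (hα : α ≠ 0) : Mono hα (y k α) (fun v => (v.2.1, v.2.2 + 1, v.1)) := by
  rintro ⟨i, j, l⟩
  exact ⟨_, zpow_ne_zero _ hα, by rw [phi_y, Ly_E]⟩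
theorem Mono.z (hα : α ≠ 0) : Mono hα (z k α) (fun v => (v.2.1, v.2.2, v.1 + 1)) := by
  rintro ⟨i, j, l⟩
  exact ⟨_, zpow_ne_zero _ hα, by rw [phi_z, Lz_E]⟩

theorem Mono.one (hα : α ≠ 0) : Mono hα (1 : Salpha k α) (fun v => v) := by
  intro v
  exact ⟨1, one_ne_zero, by simp⟩

def rot (v : ℕ × ℕ × ℕ) : ℕ × ℕ × ℕ := (v.2.1, v.2.2, v.1)

theorem rot_inj : Function.Injective rot := by
  rintro ⟨a, b, c⟩ ⟨d, e, f⟩ h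
  simp only [rot, Prod.mk.injEq] at h ⊢
  tauto

def deg (v : ℕ × ℕ × ℕ) : ℕ := v.1 + v.2.1 + v.2.2

theorem rot_add (u v : ℕ × ℕ × ℕ) : rot (u + v) = rot u + rot v := rfl
theorem deg_rot (v : ℕ × ℕ × ℕ) : deg (rot v) = deg v := by simp [deg, rot]; omega
theorem deg_rot_iter (n : ℕ) (v : ℕ × ℕ × ℕ) : deg (rot^[n] v) = deg v := by
  induction n with
  | zero => rfl
  | succ n ih => rw [Function.iterate_succ_apply', deg_rot, ih]
theorem deg_add (u v : ℕ × ℕ × ℕ) : deg (u + v) = deg u + deg v := by simp [deg]; omega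

/-- Each basis vector is hit by a monomial element. -/
theorem exists_mono (hα : α ≠ 0) (n : ℕ) : ∀ u, deg u = n →
    ∃ s : Salpha k α, Mono hα s (fun v => u + rot^[n] v) := by
  induction n with
  | zero =>
    rintro ⟨a, b, c⟩ h
    have : ((a, b, c) : ℕ × ℕ × ℕ) = 0 := by
      simp only [deg] at h
      simp only [Prod.mk_eq_zero]; omega
    rw [this]
    exact ⟨1, by simpa using Mono.one hα⟩
  | succ n ih =>
    rintro ⟨a, b, c⟩ h
    simp only [deg] at h
    rcases a with _ | a
    · rcases b with _ | b
      · obtain ⟨c, rfl⟩ : ∃ c', c = c' + 1 := ⟨c - 1, by omega⟩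
        obtain ⟨s, hs⟩ := ih (c, 0, 0) (by simp [deg]; omega)
        have := (Mono.z hα).mul hs
        refine ⟨z k α * s, ?_⟩
        · convert this using 2 with v
          rw [Function.iterate_succ_apply']
          simp [rot]; omega
      · obtain ⟨s, hs⟩ := ih (c, 0, b) (by simp [deg]; omega)
        have := (Mono.y hα).mul hs
        refine ⟨y k α * s, ?_⟩
        · convert this using 2 with v
          rw [Function.iterate_succ_apply']
          simp [rot]; omega
    · obtain ⟨s, hs⟩ := ih (c, a, b) (by simp [deg]; omega)
      have := (Mono.x hα).mul hs
      refine ⟨x k α * s, ?_⟩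
      · convert this using 2 with v
        rw [Function.iterate_succ_apply']
        simp [rot]; omega

/-- the product rule for basis vectors -/
theorem w_act (hα : α ≠ 0) (u v : ℕ × ℕ × ℕ) :
    ∃ c : k, c ≠ 0 ∧ phi hα (w k α u) (E v) = c • E (u + rot^[deg u] v) := by
  obtain ⟨s, hs⟩ := exists_mono (k := k) hα (deg u) u rfl
  obtain ⟨c, hc, h⟩ := hs 0
  obtain ⟨d, hd, h'⟩ := hs v
  have h0 : ∀ n, rot^[n] 0 = 0 := by
    intro n
    induction n with
    | zero => rfl
    | succ n ih => rw [Function.iterate_succ_apply', ih]; rfl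
  simp only [h0, add_zero] at h
  have h1 : s = c • w k α u := by
    rw [← psi_vec hα s, vec]
    change psi k α (phi hα s (E 0)) = _
    rw [h, map_smul, psi_E]
  have h2 : w k α u = c⁻¹ • s := by rw [h1, smul_smul, inv_mul_cancel₀ hc, one_smul]
  exact ⟨c⁻¹ * d, mul_ne_zero (inv_ne_zero hc) hd, by
    rw [h2, map_smul, LinearMap.smul_apply, h', smul_smul]⟩

def key (u : ℕ × ℕ × ℕ) : ℕ ×ₗ (ℕ ×ₗ ℕ) := toLex (deg u, toLex (u.1, u.2.1))

theorem key_inj : Function.Injective key := by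
  rintro ⟨a, b, c⟩ ⟨d, e, f⟩ h
  simp only [key, deg, EmbeddingLike.apply_eq_iff_eq, Prod.mk.injEq] at h ⊢
  omega

theorem key_lt {u u' : ℕ × ℕ × ℕ} (h : key u < key u') (v : ℕ × ℕ × ℕ) :
    key (u + rot^[deg u] v) < key (u' + rot^[deg u'] v) := by
  unfold key at h ⊢
  rw [Prod.Lex.toLex_lt_toLex] at h ⊢
  simp only [deg_add, deg_rot_iter] at h ⊢
  rcases h with h | ⟨h1, h⟩
  · left; omega
  · right
    rw [h1]
    refine ⟨rfl, ?_⟩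
    rw [Prod.Lex.toLex_lt_toLex] at h ⊢
    simp only [Prod.fst_add, Prod.snd_add] at h ⊢
    omega

theorem mul_ne_zero' (hα : α ≠ 0) {a b : Salpha k α} (ha : a ≠ 0) (hb : b ≠ 0) : a * b ≠ 0 := by
  intro hab
  choose c hc hw using w_act (k := k) hα
  set A := vec hα a with hA
  set B := vec hα b with hB
  have hz : vec hα (0 : Salpha k α) = 0 := by simp [vec]
  have hA0 : A ≠ 0 := fun h => ha (vec_inj hα (by rw [← hA, h, hz]))
  have hB0 : B ≠ 0 := fun h => hb (vec_inj hα (by rw [← hB, h, hz]))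
  have key0 : phi hα a B = 0 := by rw [hB, ← vec_mul, hab, hz]
  have haw : a = A.sum fun u r => r • w k α u := by
    rw [← psi_vec hα a, ← hA]; rfl
  have hexp : phi hα a B = A.sum fun u r => B.sum fun v t =>
      Finsupp.single (u + rot^[deg u] v) (r * t * c u v) := by
    have hBs : B = B.sum fun v t => t • E v := by
      conv_lhs => rw [← Finsupp.sum_single B]
      simp [E]
    rw [haw, Finsupp.sum, map_sum, LinearMap.sum_apply]
    refine Finset.sum_congr rfl fun u _ => ?_
    conv_lhs => rw [hBs]
    rw [map_smul, LinearMap.smul_apply, Finsupp.sum, map_sum, Finset.smul_sum]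
    refine Finset.sum_congr rfl fun v _ => ?_
    rw [map_smul, hw, smul_smul, smul_smul, Finsupp.smul_single, smul_eq_mul, mul_one]
  obtain ⟨u, hu, humax⟩ := Finset.exists_max_image A.support key
    (Finsupp.support_nonempty_iff.2 hA0)
  obtain ⟨v, hv, hvmax⟩ := Finset.exists_max_image B.support (fun v => key (u + rot^[deg u] v))
    (Finsupp.support_nonempty_iff.2 hB0)
  have hcoef := DFunLike.congr_fun key0 (u + rot^[deg u] v)
  rw [hexp, Finsupp.sum, Finsupp.finsetSum_apply, Finset.sum_eq_single u, Finsupp.sum,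
    Finsupp.finsetSum_apply, Finset.sum_eq_single v] at hcoef
  · rw [Finsupp.single_eq_same, Finsupp.zero_apply] at hcoef
    exact mul_ne_zero (mul_ne_zero (Finsupp.mem_support_iff.1 hu) (Finsupp.mem_support_iff.1 hv))
      (hc u v) hcoef
  · intro v' hv' hne
    rw [Finsupp.single_eq_of_ne]
    intro h
    exact hne ((rot_inj.iterate _ (add_left_cancel h)).symm)
  · intro h; exact absurd hv h
  · intro u' hu' hne
    rw [Finsupp.sum, Finsupp.finsetSum_apply]
    refine Finset.sum_eq_zero fun v' hv' => ?_
    rw [Finsupp.single_eq_of_ne]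
    intro h
    have h1 : key u' < key u := lt_of_le_of_ne (humax u' hu') (fun h => hne (key_inj h))
    have h2 := key_lt h1 v'
    have h3 := hvmax v' hv'
    rw [← h] at h2
    exact absurd h3 (not_le.2 h2)
  · intro h; exact absurd hu h

end model

/-! ### Grading and cube roots -/

section grading
variable {k : Type*} [Field k] {α : k}

open Polynomial in
def gam : Salpha k α →ₐ[k] Polynomial (Salpha k α) :=
  liftS (monomial 1 (x k α)) (monomial 1 (y k α)) (monomial 1 (z k α))
    (by rw [monomial_mul_monomial, rel_yx, monomial_pow, smul_monomial])
    (by rw [monomial_mul_monomial, rel_xz, monomial_pow, smul_monomial])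
    (by rw [monomial_mul_monomial, rel_zy, monomial_pow, smul_monomial])

theorem gam_x : gam (x k α) = Polynomial.monomial 1 (x k α) := liftS_x _ _ _
theorem gam_y : gam (y k α) = Polynomial.monomial 1 (y k α) := liftS_y _ _ _
theorem gam_z : gam (z k α) = Polynomial.monomial 1 (z k α) := liftS_z _ _ _

theorem gam_eval (s : Salpha k α) :
    Polynomial.eval₂RingHom' (RingHom.id _) 1 (fun a => Commute.one_right a) (gam s) = s := by
  refine ind (p := fun s => Polynomial.eval₂RingHom' (RingHom.id _) 1
    (fun a => Commute.one_right a) (gam s) = s) ?_ ?_ ?_ ?_ ?_ ?_ s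
  · intro c
    rw [AlgHom.commutes, Polynomial.algebraMap_apply]
    simp [Polynomial.eval₂RingHom']
  · rw [gam_x]; simp [Polynomial.eval₂RingHom']
  · rw [gam_y]; simp [Polynomial.eval₂RingHom']
  · rw [gam_z]; simp [Polynomial.eval₂RingHom']
  · intro a b ha hb; rw [map_add, map_add, ha, hb]
  · intro a b ha hb; rw [map_mul, map_mul, ha, hb]

theorem gam_low (s : Salpha k α) :
    (∃ c : k, (gam s).coeff 0 = algebraMap k _ c) ∧
    ∃ a b c : k, (gam s).coeff 1 = a • x k α + b • y k α + c • z k α := by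
  refine ind (p := fun s => (∃ c : k, (gam s).coeff 0 = algebraMap k _ c) ∧
    ∃ a b c : k, (gam s).coeff 1 = a • x k α + b • y k α + c • z k α) ?_ ?_ ?_ ?_ ?_ ?_ s
  · intro c
    rw [AlgHom.commutes, Polynomial.algebraMap_apply]
    refine ⟨⟨c, by simp⟩, 0, 0, 0, by simp⟩
  · rw [gam_x]
    exact ⟨⟨0, by simp [Polynomial.coeff_monomial]⟩, 1, 0, 0, by simp⟩
  · rw [gam_y]
    exact ⟨⟨0, by simp [Polynomial.coeff_monomial]⟩, 0, 1, 0, by simp⟩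
  · rw [gam_z]
    exact ⟨⟨0, by simp [Polynomial.coeff_monomial]⟩, 0, 0, 1, by simp⟩
  · rintro s t ⟨⟨e, he⟩, a, b, c, h⟩ ⟨⟨e', he'⟩, a', b', c', h'⟩
    rw [map_add, Polynomial.coeff_add, Polynomial.coeff_add, he, he', h, h']
    exact ⟨⟨e + e', by rw [map_add]⟩, a + a', b + b', c + c', by simp only [add_smul]; abel⟩
  · rintro s t ⟨⟨e, he⟩, a, b, c, h⟩ ⟨⟨e', he'⟩, a', b', c', h'⟩
    rw [map_mul]
    refine ⟨⟨e * e', by rw [Polynomial.mul_coeff_zero, he, he', map_mul]⟩,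
      e * a' + e' * a, e * b' + e' * b, e * c' + e' * c, ?_⟩
    rw [Polynomial.mul_coeff_one, he, he', h, h', ← Algebra.smul_def, ← Algebra.commutes,
      ← Algebra.smul_def]
    simp only [smul_add, add_smul, smul_smul]
    abel

theorem nzd (hα : α ≠ 0) : NoZeroDivisors (Salpha k α) where
  eq_zero_or_eq_zero_of_mul_eq_zero := by
    intro a b h
    by_contra! hh
    exact mul_ne_zero' hα hh.1 hh.2 h

theorem vec_x (hα : α ≠ 0) : vec hα (x k α) = E (1, 0, 0) := by simp [vec, phi_x, Lx_E]
theorem vec_y (hα : α ≠ 0) : vec hα (y k α) = E (0, 1, 0) := by simp [vec, phi_y, Ly_E]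
theorem vec_z (hα : α ≠ 0) : vec hα (z k α) = E (0, 0, 1) := by simp [vec, phi_z, Lz_E]
theorem vec_add (hα : α ≠ 0) (s t : Salpha k α) : vec hα (s + t) = vec hα s + vec hα t := by
  simp [vec]
theorem vec_smul (hα : α ≠ 0) (c : k) (s : Salpha k α) : vec hα (c • s) = c • vec hα s := by
  simp [vec]
theorem vec_zero (hα : α ≠ 0) : vec hα (0 : Salpha k α) = 0 := by
  simp [vec]

theorem smul_cancel (hα : α ≠ 0) {s : Salpha k α} (hs : s ≠ 0) {a b : k} (h : a • s = b • s) :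
    a = b := by
  have hv : vec hα s ≠ 0 := fun h0 => hs (vec_inj hα (by rw [h0, vec_zero]))
  apply smul_left_injective k hv
  change a • vec hα s = b • vec hα s
  rw [← vec_smul, ← vec_smul, h]

theorem x_ne (hα : α ≠ 0) : x k α ≠ 0 := by
  intro h
  have := congrArg (fun s => vec hα s (1, 0, 0)) h
  simp [vec_x, vec_zero] at this

theorem lin3 (hα : α ≠ 0) {a b c a' b' c' : k}
    (h : a • x k α + b • y k α + c • z k α = a' • x k α + b' • y k α + c' • z k α) :
    a = a' ∧ b = b' ∧ c = c' := by
  have h1 := congrArg (fun s => vec hα s (1, 0, 0)) h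
  have h2 := congrArg (fun s => vec hα s (0, 1, 0)) h
  have h3 := congrArg (fun s => vec hα s (0, 0, 1)) h
  simp [vec_x, vec_y, vec_z, vec_add, vec_smul, E] at h1 h2 h3
  exact ⟨h1, h2, h3⟩

theorem x3y3 (hα : α ≠ 0) : x k α ^ 3 = y k α ^ 3 :=
  cube1 (rel_xz k α) hα (rel_zy k α)
theorem y3z3 (hα : α ≠ 0) : y k α ^ 3 = z k α ^ 3 :=
  cube1 (rel_yx k α) hα (rel_xz k α)

theorem central_of {a : Salpha k α} (hx : a * x k α = x k α * a) (hy : a * y k α = y k α * a)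
    (hz : a * z k α = z k α * a) : a ∈ Subalgebra.center k (Salpha k α) := by
  rw [Subalgebra.mem_center_iff]
  intro b
  refine (ind (p := fun b => b * a = a * b) ?_ hx.symm hy.symm hz.symm ?_ ?_ b)
  · intro c; exact Algebra.commutes c a
  · intro s t h h'; rw [add_mul, mul_add, h, h']
  · intro s t h h'; rw [mul_assoc, h', ← mul_assoc, h, mul_assoc]

theorem x3_central (hα : α ≠ 0) : x k α ^ 3 ∈ Subalgebra.center k (Salpha k α) := by
  apply central_of
  · rw [← pow_succ, ← pow_succ']
  · rw [x3y3 hα, ← pow_succ, ← pow_succ']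
  · rw [x3y3 hα, y3z3 hα, ← pow_succ, ← pow_succ']

theorem cube_lin (hα : α ≠ 0) {a b c : k}
    (h : (a • x k α + b • y k α + c • z k α) ^ 3 = x k α ^ 3) :
    (b = 0 ∧ c = 0) ∨ (a = 0 ∧ c = 0) ∨ (a = 0 ∧ b = 0) := by
  have hv := congrArg (vec hα) h
  simp only [pow_succ, pow_zero, one_mul, vec_mul, map_mul, Module.End.mul_apply, vec_add,
    vec_smul, vec_x, vec_y, vec_z, map_add, map_smul, LinearMap.add_apply, LinearMap.smul_apply,
    phi_x, phi_y, phi_z, Lx_E, Ly_E, Lz_E] at hv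
  have h1 := DFunLike.congr_fun hv (3, 0, 0)
  have h2 := DFunLike.congr_fun hv (2, 1, 0)
  simp [E] at h1 h2
  rcases h1 with rfl | rfl | rfl <;> simp [hα] at h2 <;> tauto

theorem cube_root (hα : α ≠ 0) {u : Salpha k α} (h : u ^ 3 = x k α ^ 3) :
    ∃ a : k, a ^ 3 = 1 ∧ (u = a • x k α ∨ u = a • y k α ∨ u = a • z k α) := by
  have := nzd (k := k) hα
  have hx3 : x k α ^ 3 ≠ 0 := pow_ne_zero 3 (x_ne hα)
  have hg : gam u ^ 3 = Polynomial.monomial 3 (x k α ^ 3) := by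
    rw [← map_pow, h, map_pow, gam_x, Polynomial.monomial_pow]
  have hd : (gam u).natDegree = 1 := by
    have := congrArg Polynomial.natDegree hg
    rw [Polynomial.natDegree_pow, Polynomial.natDegree_monomial_eq _ hx3] at this
    omega
  have h0 : (gam u).coeff 0 = 0 := by
    have := congrArg (fun p => Polynomial.coeff p 0) hg
    simp only [pow_succ, pow_zero, one_mul, Polynomial.mul_coeff_zero,
      Polynomial.coeff_monomial] at this
    simpa using this
  have hu : u = (gam u).coeff 1 := by
    have h1 := gam_eval u
    rw [Polynomial.eq_X_add_C_of_natDegree_le_one hd.le, h0] at h1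
    conv_lhs => rw [← h1]
    simp [Polynomial.eval₂RingHom']
  obtain ⟨-, a, b, c, habc⟩ := gam_low u
  rw [← hu] at habc
  have h3 : ∀ (t : k), t • x k α ^ 3 = x k α ^ 3 → t = 1 := by
    intro t ht
    exact smul_cancel hα hx3 (by rw [ht, one_smul])
  have hlin := h
  rw [habc] at hlin
  rcases cube_lin hα hlin with ⟨rfl, rfl⟩ | ⟨rfl, rfl⟩ | ⟨rfl, rfl⟩
  · refine ⟨a, ?_, Or.inl (by simpa using habc)⟩
    apply h3
    rw [zero_smul, zero_smul, add_zero, add_zero] at habc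
    rw [← smul_pow, ← habc, h]
  · refine ⟨b, ?_, Or.inr (Or.inl (by simpa using habc))⟩
    apply h3
    rw [zero_smul, zero_smul, add_zero, zero_add] at habc
    rw [x3y3 hα, ← smul_pow, ← habc, h, x3y3 hα]
  · refine ⟨c, ?_, Or.inr (Or.inr (by simpa using habc))⟩
    apply h3
    rw [zero_smul, zero_smul, add_zero, zero_add] at habc
    rw [x3y3 hα, y3z3 hα, ← smul_pow, ← habc, h, x3y3 hα, y3z3 hα]

end grading

/-! ### Normal elements inducing the ozone group -/

section normal
variable {k : Type*} [Field k] {α : k}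

variable (k α) in
def nA (s : ℕ) : Salpha k α := (x k α * y k α * z k α) ^ s * x k α
variable (k α) in
def nB (s : ℕ) : Salpha k α := (y k α * z k α * x k α) ^ s * y k α
variable (k α) in
def nC (s : ℕ) : Salpha k α := (z k α * x k α * y k α) ^ s * z k α


section
variable {s : ℕ}

theorem A_conj (hs : α ^ (3 * s + 1) = 1) : nA k α s * x k α = z k α * nB k α s ∧ nA k α s * y k α = x k α * nB k α s ∧
    nA k α s * z k α = y k α * nB k α s :=
  Aconj (rel_yx k α) (rel_xz k α) (rel_zy k α) s hs

theorem B_conj (hs : α ^ (3 * s + 1) = 1) : nB k α s * x k α = z k α * nC k α s ∧ nB k α s * y k α = x k α * nC k α s ∧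
    nB k α s * z k α = y k α * nC k α s := by
  obtain ⟨h1, h2, h3⟩ := Aconj (rel_zy k α) (rel_yx k α) (rel_xz k α) s hs
  exact ⟨h3, h1, h2⟩

theorem C_conj (hs : α ^ (3 * s + 1) = 1) : nC k α s * x k α = z k α * nA k α s ∧ nC k α s * y k α = x k α * nA k α s ∧
    nC k α s * z k α = y k α * nA k α s := by
  obtain ⟨h1, h2, h3⟩ := Aconj (rel_xz k α) (rel_zy k α) (rel_yx k α) s hs
  exact ⟨h2, h3, h1⟩

/-- `A + B + C` induces `τ`. -/
theorem d_conj (hs : α ^ (3 * s + 1) = 1) (a : Salpha k α) : (nA k α s + nB k α s + nC k α s) * a =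
    tau k α a * (nA k α s + nB k α s + nC k α s) := by
  obtain ⟨a1, a2, a3⟩ := A_conj (k := k) hs
  obtain ⟨b1, b2, b3⟩ := B_conj (k := k) hs
  obtain ⟨c1, c2, c3⟩ := C_conj (k := k) hs
  refine ind (p := fun a => (nA k α s + nB k α s + nC k α s) * a =
    tau k α a * (nA k α s + nB k α s + nC k α s)) ?_ ?_ ?_ ?_ ?_ ?_ a
  · intro c; rw [AlgEquiv.commutes, Algebra.commutes]
  · rw [tau_x, add_mul, add_mul, a1, b1, c1, mul_add, mul_add]; abel
  · rw [tau_y, add_mul, add_mul, a2, b2, c2, mul_add, mul_add]; abel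
  · rw [tau_z, add_mul, add_mul, a3, b3, c3, mul_add, mul_add]; abel
  · intro u v hu hv; rw [mul_add, hu, hv, map_add, add_mul]
  · intro u v hu hv; rw [← mul_assoc, hu, mul_assoc, hv, map_mul, mul_assoc]

theorem trip {P Q R P' Q' R' : Salpha k α}
    (hP : P * x k α = z k α * P' ∧ P * y k α = x k α * P' ∧ P * z k α = y k α * P')
    (hQ : Q * x k α = z k α * Q' ∧ Q * y k α = x k α * Q' ∧ Q * z k α = y k α * Q')
    (hR : R * x k α = z k α * R' ∧ R * y k α = x k α * R' ∧ R * z k α = y k α * R') :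
    (P * Q * R) * x k α = x k α * (P' * Q' * R') ∧
    (P * Q * R) * y k α = y k α * (P' * Q' * R') ∧
    (P * Q * R) * z k α = z k α * (P' * Q' * R') := by
  obtain ⟨p1, p2, p3⟩ := hP
  obtain ⟨q1, q2, q3⟩ := hQ
  obtain ⟨r1, r2, r3⟩ := hR
  refine ⟨?_, ?_, ?_⟩
  · rw [mul_assoc, r1, mul_assoc, ← mul_assoc Q, q3, ← mul_assoc, ← mul_assoc, p2]
    simp only [mul_assoc]
  · rw [mul_assoc, r2, mul_assoc, ← mul_assoc Q, q1, ← mul_assoc, ← mul_assoc, p3]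
    simp only [mul_assoc]
  · rw [mul_assoc, r3, mul_assoc, ← mul_assoc Q, q2, ← mul_assoc, ← mul_assoc, p1]
    simp only [mul_assoc]

end

variable (α) in
def dw (ω : k) (s : ℕ) : Salpha k α :=
  nB k α s * nA k α s * nB k α s + ω • (nC k α s * nB k α s * nC k α s) +
    ω ^ 2 • (nA k α s * nC k α s * nA k α s)

theorem dw_conj {s : ℕ} (hs : α ^ (3 * s + 1) = 1) {ω : k} (hω : ω ^ 3 = 1) :
    ω • (dw α ω s * x k α) = x k α * dw α ω s ∧ ω • (dw α ω s * y k α) = y k α * dw α ω s ∧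
    ω • (dw α ω s * z k α) = z k α * dw α ω s := by
  have hA := A_conj (k := k) hs
  have hB := B_conj (k := k) hs
  have hC := C_conj (k := k) hs
  obtain ⟨p1, p2, p3⟩ := trip hB hA hB
  obtain ⟨q1, q2, q3⟩ := trip hC hB hC
  obtain ⟨r1, r2, r3⟩ := trip hA hC hA
  have e : ω * ω ^ 2 = 1 := by rw [← hω]; ring
  refine ⟨?_, ?_, ?_⟩
  · simp only [dw, add_mul, mul_add, smul_mul_assoc, mul_smul_comm, p1, q1, r1, smul_add,
      smul_smul, e, one_smul, ← pow_two]
    abel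
  · simp only [dw, add_mul, mul_add, smul_mul_assoc, mul_smul_comm, p2, q2, r2, smul_add,
      smul_smul, e, one_smul, ← pow_two]
    abel
  · simp only [dw, add_mul, mul_add, smul_mul_assoc, mul_smul_comm, p3, q3, r3, smul_add,
      smul_smul, e, one_smul, ← pow_two]
    abel

theorem dw_conj' {s : ℕ} (hs : α ^ (3 * s + 1) = 1) {ω : k} (hω : ω ^ 3 = 1) (h0 : ω ≠ 0)
    (a : Salpha k α) : dw α ω s * rho α ω h0 a = a * dw α ω s := by
  obtain ⟨h1, h2, h3⟩ := dw_conj hs hω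
  refine ind (p := fun a => dw α ω s * rho α ω h0 a = a * dw α ω s) ?_ ?_ ?_ ?_ ?_ ?_ a
  · intro c; rw [AlgEquiv.commutes, Algebra.commutes]
  · rw [rho_x, mul_smul_comm, h1]
  · rw [rho_y, mul_smul_comm, h2]
  · rw [rho_z, mul_smul_comm, h3]
  · intro u v hu hv; rw [map_add, mul_add, hu, hv, add_mul]
  · intro u v hu hv; rw [map_mul, ← mul_assoc, hu, mul_assoc, hv, mul_assoc]

/-! nonvanishing -/

theorem Mono.pow3 {hα : α ≠ 0} {t : Salpha k α} {p : ℕ × ℕ × ℕ} (h : Mono hα t (fun v => v + p))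
    (s : ℕ) : Mono hα (t ^ s) (fun v => v + s • p) := by
  induction s with
  | zero => simpa using Mono.one hα
  | succ s ih =>
    rw [pow_succ']
    have := h.mul ih
    convert this using 2 with v
    rw [succ_nsmul, add_assoc]

theorem Mono_A (hα : α ≠ 0) (s : ℕ) :
    Mono hα (nA k α s) (fun v => (v.2.1 + (3 * s + 1), v.2.2, v.1)) := by
  have h := (Mono.pow3 (p := (3, 0, 0)) (((Mono.x hα).mul (Mono.y hα)).mul (Mono.z hα)) s).mul
    (Mono.x hα)
  convert h using 2 with v
  · rfl
  · simp; omega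
theorem Mono_B (hα : α ≠ 0) (s : ℕ) :
    Mono hα (nB k α s) (fun v => (v.2.1, v.2.2 + (3 * s + 1), v.1)) := by
  have h := (Mono.pow3 (p := (0, 3, 0)) (((Mono.y hα).mul (Mono.z hα)).mul (Mono.x hα)) s).mul
    (Mono.y hα)
  convert h using 2 with v
  · rfl
  · simp; omega
theorem Mono_C (hα : α ≠ 0) (s : ℕ) :
    Mono hα (nC k α s) (fun v => (v.2.1, v.2.2, v.1 + (3 * s + 1))) := by
  have h := (Mono.pow3 (p := (0, 0, 3)) (((Mono.z hα).mul (Mono.x hα)).mul (Mono.y hα)) s).mul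
    (Mono.z hα)
  convert h using 2 with v
  · rfl
  · simp; omega

theorem Mono.vec {hα : α ≠ 0} {t : Salpha k α} {f : ℕ × ℕ × ℕ → ℕ × ℕ × ℕ} (h : Mono hα t f) :
    ∃ c : k, c ≠ 0 ∧ vec hα t = c • E (f (0, 0, 0)) := h (0, 0, 0)

theorem d_ne (hα : α ≠ 0) (s : ℕ) : nA k α s + nB k α s + nC k α s ≠ 0 := by
  intro h
  obtain ⟨a, ha, h1⟩ := (Mono_A (k := k) hα s).vec
  obtain ⟨b, hb, h2⟩ := (Mono_B (k := k) hα s).vec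
  obtain ⟨c, hc, h3⟩ := (Mono_C (k := k) hα s).vec
  have := congrArg (fun t => vec hα t (3 * s + 1, 0, 0)) h
  simp [vec_add, h1, h2, h3, vec_zero] at this
  exact ha this

theorem dw_ne (hα : α ≠ 0) (ω : k) (s : ℕ) : dw α ω s ≠ 0 := by
  intro h
  have mA := Mono_A (k := k) hα s
  have mB := Mono_B (k := k) hα s
  have mC := Mono_C (k := k) hα s
  obtain ⟨a, ha, h1⟩ := ((mB.mul mA).mul mB).vec
  obtain ⟨b, hb, h2⟩ := ((mC.mul mB).mul mC).vec
  obtain ⟨c, hc, h3⟩ := ((mA.mul mC).mul mA).vec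
  have := congrArg (fun t => vec hα t (0, 3 * s + 1, 2 * (3 * s + 1))) h
  simp only [dw, vec_add, vec_smul, h1, h2, h3, vec_zero] at this
  simp [two_mul] at this
  exact ha this

/-! ### fixing the center -/

theorem tau_fix (hα : α ≠ 0) {s : ℕ} (hs : α ^ (3 * s + 1) = 1) :
    tau k α ∈ ozoneGroup k (Salpha k α) := by
  intro c hc
  have := nzd (k := k) hα
  rw [Subalgebra.mem_center_iff] at hc
  have h := d_conj hs c
  rw [hc] at h
  exact (mul_right_cancel₀ (d_ne hα s) h).symm

theorem rho_fix (hα : α ≠ 0) {s : ℕ} (hs : α ^ (3 * s + 1) = 1) {ω : k} (hω : ω ^ 3 = 1)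
    (h0 : ω ≠ 0) : rho α ω h0 ∈ ozoneGroup k (Salpha k α) := by
  intro c hc
  have := nzd (k := k) hα
  rw [Subalgebra.mem_center_iff] at hc
  have h := dw_conj' hs hω h0 c
  rw [← hc] at h
  exact mul_left_cancel₀ (dw_ne hα ω s) h

theorem cube_gen (hα : α ≠ 0) {σ : Salpha k α ≃ₐ[k] Salpha k α}
    (hσ : σ ∈ ozoneGroup k (Salpha k α)) {g : Salpha k α} (hg : g ^ 3 = x k α ^ 3) :
    ∃ a : k, a ^ 3 = 1 ∧ (σ g = a • x k α ∨ σ g = a • y k α ∨ σ g = a • z k α) := by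
  apply cube_root hα
  rw [← map_pow, hg]
  exact hσ _ (x3_central hα)

theorem fix_one (hα : α ≠ 0) {s : ℕ} (hs : α ^ (3 * s + 1) = 1)
    {σ : Salpha k α ≃ₐ[k] Salpha k α}
    (hσ : σ ∈ ozoneGroup k (Salpha k α)) (hx : σ (x k α) = x k α) : σ = 1 := by
  obtain ⟨b, hb, hy⟩ := cube_gen hα hσ (x3y3 hα).symm
  obtain ⟨c, hc, hz⟩ := cube_gen hα hσ ((x3y3 hα).trans (y3z3 hα)).symm
  have hb0 : b ≠ 0 := by rintro rfl; simp at hb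
  have hc0 : c ≠ 0 := by rintro rfl; simp at hc
  have hr := congrArg σ (rel_yx k α)
  rw [map_mul, map_smul, map_pow, hx] at hr
  have hyb : σ (y k α) = b • y k α := by
    rcases hy with hy | hy | hy
    · exfalso
      have h : y k α = b • x k α := σ.injective (by rw [hy, map_smul, hx])
      have := lin3 hα (a := 0) (b := 1) (c := 0) (a' := b) (b' := 0) (c' := 0) (by simpa using h)
      exact hb0 this.1.symm
    · exact hy
    · exfalso
      rcases hz with hz | hz | hz
      · have h : z k α = c • x k α := σ.injective (by rw [hz, map_smul, hx])
        have := lin3 hα (a := 0) (b := 0) (c := 1) (a' := c) (b' := 0) (c' := 0) (by simpa using h)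
        exact hc0 this.1.symm
      · rw [hy, hz, smul_pow, smul_comm α, ← rel_xz] at hr
        have h := congrArg (fun t => vec hα t (0, 0, 2)) hr
        simp [vec_mul, vec_smul, vec_x, vec_z, phi_x, phi_z, Lx_E, Lz_E] at h
        exact hb0 h
      · have h : c • y k α = b • z k α :=
          σ.injective (by rw [map_smul, map_smul, hz, hy, smul_comm])
        have := lin3 hα (a := 0) (b := c) (c := 0) (a' := 0) (b' := 0) (c' := b) (by simpa using h)
        exact hc0 this.2.1
  have hzc : σ (z k α) = c • z k α := by
    rcases hz with hz | hz | hz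
    · exfalso
      have h : z k α = c • x k α := σ.injective (by rw [hz, map_smul, hx])
      have := lin3 hα (a := 0) (b := 0) (c := 1) (a' := c) (b' := 0) (c' := 0) (by simpa using h)
      exact hc0 this.1.symm
    · exfalso
      have h : c • y k α = b • z k α :=
        σ.injective (by rw [map_smul, map_smul, hz, hyb, smul_comm])
      have := lin3 hα (a := 0) (b := c) (c := 0) (a' := 0) (b' := 0) (c' := b) (by simpa using h)
      exact hc0 this.2.1
    · exact hz
  have := nzd (k := k) hα
  have hbc : b = c ^ 2 := by
    rw [hyb, hzc, smul_pow, smul_comm α, ← rel_yx, smul_mul_assoc] at hr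
    refine smul_cancel hα ?_ hr
    refine mul_ne_zero ?_ (x_ne hα)
    intro h
    have := x3y3 (k := k) hα
    rw [h, zero_pow (by norm_num)] at this
    exact pow_ne_zero 3 (x_ne hα) this
  subst hbc
  -- the central element
  have hcen : dw α 1 s ∈ Subalgebra.center k (Salpha k α) := by
    obtain ⟨h1, h2, h3⟩ := dw_conj (k := k) hs (ω := 1) (one_pow 3)
    rw [one_smul] at h1 h2 h3
    exact central_of h1 h2 h3
  have hfix := hσ _ hcen
  have e1 : c ^ 2 * c = 1 := by rw [← hc]; ring
  have e2 : c * c ^ 2 = 1 := by rw [← hc]; ring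
  have hA : σ (nA k α s) = nA k α s := by
    simp only [nA, map_mul, map_pow, hx, hyb, hzc, smul_mul_assoc, mul_smul_comm, smul_smul, e1, e2,
      one_smul]
  have hB : σ (nB k α s) = c ^ 2 • nB k α s := by
    simp only [nB, map_mul, map_pow, hx, hyb, hzc, smul_mul_assoc, mul_smul_comm, smul_smul, e1, e2,
      one_smul]
  have hC : σ (nC k α s) = c • nC k α s := by
    simp only [nC, map_mul, map_pow, hx, hyb, hzc, smul_mul_assoc, mul_smul_comm, smul_smul, e1, e2,
      one_smul]
  have hsc : σ (dw α 1 s) = c • dw α 1 s := by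
    have e3 : c ^ 2 * c ^ 2 = c := by
      calc c ^ 2 * c ^ 2 = c ^ 3 * c := by ring
        _ = c := by rw [hc, one_mul]
    simp only [dw, map_add, map_mul, map_smul, hA, hB, hC, smul_mul_assoc, mul_smul_comm,
      smul_smul, smul_add, one_pow, one_smul, one_mul, mul_one, e3, e1, e2]
  rw [hsc] at hfix
  have hc1 : c = 1 := smul_cancel hα (dw_ne hα 1 s) (by rw [hfix, one_smul])
  subst hc1
  apply equiv_ext
  · rw [hx]; rfl
  · rw [hyb]; simp
  · rw [hzc]; simp

end normal

/-! ### The group -/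

section grp
variable {G : Type*} [Group G]

def zhom (t : G) (h : t ^ 3 = 1) : Multiplicative (ZMod 3) →* G :=
  AddMonoidHom.toMultiplicativeLeft (ZMod.lift 3 ⟨zmultiplesHom (Additive G) (Additive.ofMul t), by
    simp only [zmultiplesHom_apply]
    rw [natCast_zsmul, ← ofMul_pow, h, ofMul_one]⟩)

theorem zhom_apply (t : G) (h : t ^ 3 = 1) (n : ℕ) :
    zhom t h (Multiplicative.ofAdd (n : ZMod 3)) = t ^ n := by
  have : ((n : ℕ) : ZMod 3) = ((n : ℤ) : ZMod 3) := by simp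
  rw [this]
  change Additive.toMul (ZMod.lift 3 _ ((n : ℤ) : ZMod 3)) = t ^ n
  rw [ZMod.lift_coe]
  simp

theorem zhom_cases {P : Multiplicative (ZMod 3) → Prop}
    (h : ∀ n < 3, P (Multiplicative.ofAdd ((n : ℕ) : ZMod 3))) (a : Multiplicative (ZMod 3)) :
    P a := by
  have h1 : ∀ b : ZMod 3, P (Multiplicative.ofAdd b) := by
    intro b
    rw [← ZMod.natCast_zmod_val b]
    exact h _ (ZMod.val_lt b)
  exact h1 (Multiplicative.toAdd a)

theorem grp_main (t r : G) (H : Subgroup G) (ht : t ^ 3 = 1) (hr : r ^ 3 = 1) (hc : Commute t r)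
    (hH : ∀ g ∈ H, ∃ i j : ℕ, g = t ^ i * r ^ j) (htH : t ∈ H) (hrH : r ∈ H)
    (hinj : ∀ i < 3, ∀ j < 3, t ^ i * r ^ j = 1 → i = 0 ∧ j = 0) :
    H = Subgroup.closure {t, r} ∧
    Nonempty (H ≃* Multiplicative (ZMod 3) × Multiplicative (ZMod 3)) := by
  refine ⟨le_antisymm ?_ ?_, ?_⟩
  · intro g hg
    obtain ⟨i, j, rfl⟩ := hH g hg
    exact mul_mem (pow_mem (Subgroup.subset_closure (by simp)) _)
      (pow_mem (Subgroup.subset_closure (by simp)) _)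
  · rw [Subgroup.closure_le]
    rintro g (rfl | rfl)
    · exact htH
    · exact hrH
  · have hcomm : ∀ a b, Commute (zhom t ht a) (zhom r hr b) := by
      refine zhom_cases fun i _ => zhom_cases fun j _ => ?_
      rw [zhom_apply, zhom_apply]
      exact hc.pow_pow i j
    let F := MonoidHom.noncommCoprod (zhom t ht) (zhom r hr) hcomm
    have hF : ∀ i j : ℕ, F (Multiplicative.ofAdd (i : ZMod 3), Multiplicative.ofAdd (j : ZMod 3)) =
        t ^ i * r ^ j := by
      intro i j
      rw [MonoidHom.noncommCoprod_apply, zhom_apply, zhom_apply]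
    have hFi : Function.Injective F := by
      rw [injective_iff_map_eq_one]
      rintro ⟨a, b⟩
      revert a b
      refine zhom_cases fun i hi => zhom_cases fun j hj => ?_
      intro h
      rw [hF] at h
      obtain ⟨rfl, rfl⟩ := hinj i hi j hj h
      simp
    have hr : F.range = H := by
      apply le_antisymm
      · rintro _ ⟨⟨a, b⟩, rfl⟩
        revert a b
        refine zhom_cases fun i hi => zhom_cases fun j hj => ?_
        rw [hF]
        exact mul_mem (pow_mem htH _) (pow_mem hrH _)
      · intro g hg
        obtain ⟨i, j, rfl⟩ := hH g hg
        exact ⟨_, hF i j⟩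
    exact ⟨(MulEquiv.subgroupCongr hr.symm).trans (MonoidHom.ofInjective hFi).symm⟩

end grp

end Sal

/-- Suppose `k` is algebraically closed of characteristic 0. Let `α ∈ k`
be a primitive `m`th root of unity with `m ≥ 2` and `3 ∤ m`. Then the ozone group of
`S_α` is isomorphic to `ℤ/3 × ℤ/3`, generated by the cyclic-permutation automorphism
`τ : x ↦ z ↦ y ↦ x` and the automorphism `ρ` scaling `x`, `y`, `z` by a fixed primitive
third root of unity. -/
theorem stmt11 (k : Type*) [Field k] [CharZero k] [IsAlgClosed k]
    (α : k) (m : ℕ) (hα : IsPrimitiveRoot α m) (hm2 : 2 ≤ m) (hm3 : ¬ (3 ∣ m)) :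
    ∃ (τ ρ : Salpha k α ≃ₐ[k] Salpha k α) (ω : k),
      IsPrimitiveRoot ω 3 ∧
      τ (Salpha.x k α) = Salpha.z k α ∧
      τ (Salpha.z k α) = Salpha.y k α ∧
      τ (Salpha.y k α) = Salpha.x k α ∧
      ρ (Salpha.x k α) = ω • Salpha.x k α ∧
      ρ (Salpha.y k α) = ω • Salpha.y k α ∧
      ρ (Salpha.z k α) = ω • Salpha.z k α ∧
      ozoneGroup k (Salpha k α) = Subgroup.closure {τ, ρ} ∧
      Nonempty (↥(ozoneGroup k (Salpha k α)) ≃*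
        Multiplicative (ZMod 3) × Multiplicative (ZMod 3)) := by
  obtain ⟨ω, hω⟩ : ∃ ω : k, IsPrimitiveRoot ω 3 := HasEnoughRootsOfUnity.exists_primitiveRoot k 3
  have hα0 : α ≠ 0 := hα.ne_zero (by omega)
  obtain ⟨s, hs⟩ : ∃ s : ℕ, α ^ (3 * s + 1) = 1 := by
    have h1 : m * m % 3 = 1 := by
      have : m % 3 = 1 ∨ m % 3 = 2 := by omega
      rcases this with h | h <;> simp [Nat.mul_mod, h]
    refine ⟨m * m / 3, ?_⟩
    have h2 : 3 * (m * m / 3) + 1 = m * m := by omega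
    rw [h2, pow_mul, hα.pow_eq_one, one_pow]
  have hω0 : ω ≠ 0 := hω.ne_zero (by omega)
  have hω3 : ω ^ 3 = 1 := hω.pow_eq_one
  have hτ := Sal.tau_fix (k := k) hα0 hs
  have hρ := Sal.rho_fix hα0 hs hω3 hω0
  have hpow : ∀ j : ℕ, (Sal.rho α ω hω0 ^ j) (Salpha.x k α) = ω ^ j • Salpha.x k α := by
    intro j
    induction j with
    | zero => simp
    | succ j ih =>
      rw [pow_succ', AlgEquiv.mul_apply, ih, map_smul, Sal.rho_x, smul_smul, pow_succ]
  have hτ3 : Sal.tau k α ^ 3 = 1 := by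
    apply Sal.equiv_ext <;>
      simp [pow_succ, AlgEquiv.mul_apply, Sal.tau_x, Sal.tau_y, Sal.tau_z]
  have hρ3 : Sal.rho α ω hω0 ^ 3 = 1 := by
    apply Sal.equiv_ext <;>
      simp [pow_succ, AlgEquiv.mul_apply, Sal.rho_x, Sal.rho_y, Sal.rho_z, smul_smul] <;>
      rw [← pow_two, ← pow_succ', hω3, one_smul]
  have hcomm : Commute (Sal.tau k α) (Sal.rho α ω hω0) := by
    apply Sal.equiv_ext <;>
      simp [AlgEquiv.mul_apply, Sal.rho_x, Sal.rho_y, Sal.rho_z, Sal.tau_x, Sal.tau_y, Sal.tau_z]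
  have hH : ∀ σ ∈ ozoneGroup k (Salpha k α), ∃ i j : ℕ,
      σ = Sal.tau k α ^ i * Sal.rho α ω hω0 ^ j := by
    intro σ hσ
    obtain ⟨a, ha, h⟩ := Sal.cube_gen hα0 hσ (g := Salpha.x k α) rfl
    obtain ⟨j, -, rfl⟩ := hω.eq_pow_of_pow_eq_one ha
    have key : ∀ i : ℕ, σ (Salpha.x k α) = ω ^ j • (Sal.tau k α ^ i) (Salpha.x k α) →
        σ = Sal.tau k α ^ i * Sal.rho α ω hω0 ^ j := by
      intro i hi
      have hmem : Sal.tau k α ^ i * Sal.rho α ω hω0 ^ j ∈ ozoneGroup k (Salpha k α) :=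
        mul_mem (pow_mem hτ _) (pow_mem hρ _)
      have h1 := Sal.fix_one hα0 hs (mul_mem (inv_mem hmem) hσ) (by
        have : σ (Salpha.x k α) =
            (Sal.tau k α ^ i * Sal.rho α ω hω0 ^ j) (Salpha.x k α) := by
          rw [AlgEquiv.mul_apply, hpow, map_smul, hi]
        rw [AlgEquiv.mul_apply, this, ← AlgEquiv.mul_apply, inv_mul_cancel, AlgEquiv.one_apply])
      exact (inv_mul_eq_one.1 h1).symm
    rcases h with h | h | h
    · exact ⟨0, j, key 0 (by simpa using h)⟩
    · exact ⟨2, j, key 2 (by rw [h, pow_two, AlgEquiv.mul_apply, Sal.tau_x, Sal.tau_z])⟩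
    · exact ⟨1, j, key 1 (by rw [h, pow_one, Sal.tau_x])⟩
  have hinj : ∀ i < 3, ∀ j < 3, Sal.tau k α ^ i * Sal.rho α ω hω0 ^ j = 1 → i = 0 ∧ j = 0 := by
    intro i hi j hj h
    have h1 := DFunLike.congr_fun h (Salpha.x k α)
    rw [AlgEquiv.mul_apply, hpow, map_smul, AlgEquiv.one_apply] at h1
    interval_cases i
    · refine ⟨rfl, ?_⟩
      rw [pow_zero, AlgEquiv.one_apply] at h1
      have h2 := Sal.smul_cancel hα0 (Sal.x_ne hα0) (h1.trans (one_smul k _).symm)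
      have := (hω.pow_eq_one_iff_dvd j).1 h2
      omega
    · exfalso
      rw [pow_one, Sal.tau_x] at h1
      have := Sal.lin3 hα0 (a := 0) (b := 0) (c := ω ^ j) (a' := 1) (b' := 0) (c' := 0)
        (by simpa using h1)
      exact zero_ne_one this.1
    · exfalso
      rw [pow_two, AlgEquiv.mul_apply, Sal.tau_x, Sal.tau_z] at h1
      have := Sal.lin3 hα0 (a := 0) (b := ω ^ j) (c := 0) (a' := 1) (b' := 0) (c' := 0)
        (by simpa using h1)
      exact zero_ne_one this.1
  obtain ⟨h1, h2⟩ := Sal.grp_main (Sal.tau k α) (Sal.rho α ω hω0) (ozoneGroup k (Salpha k α))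
    hτ3 hρ3 hcomm hH hτ hρ hinj
  exact ⟨Sal.tau k α, Sal.rho α ω hω0, ω, hω, Sal.tau_x, Sal.tau_z, Sal.tau_y, Sal.rho_x _ _,
    Sal.rho_y _ _, Sal.rho_z _ _, h1, h2⟩
end
end

section
/- Suppose k is algebraically closed of characteristic 0. Let α ∈ k be a primitive mth root of unity with m ∉ {1,3}, and let S_α be the quotient of k⟨x,y,z⟩ by the relations yx − αz², xz − αy², and zy − αx², graded with deg x = deg y = deg z = 1. Then the center Z(S_α) is contained in the 3-Veronese subalgebra of S_α: every homogeneous central element of S_α has degree divisible by 3. -/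
noncomputable section

/-! ### Generalities on `S_α` -/

section aux

variable {k : Type*} [Field k] {α : k}

theorem Salpha.rel_yx : Salpha.y k α * Salpha.x k α = α • (Salpha.z k α * Salpha.z k α) := by
  have h := RingQuot.mkAlgHom_rel k (SalphaRel.yx (k := k) (α := α))
  simpa [Salpha.x, Salpha.y, Salpha.z, pow_two] using h

theorem Salpha.rel_xz : Salpha.x k α * Salpha.z k α = α • (Salpha.y k α * Salpha.y k α) := by
  have h := RingQuot.mkAlgHom_rel k (SalphaRel.xz (k := k) (α := α))
  simpa [Salpha.x, Salpha.y, Salpha.z, pow_two] using h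

theorem Salpha.rel_zy : Salpha.z k α * Salpha.y k α = α • (Salpha.x k α * Salpha.x k α) := by
  have h := RingQuot.mkAlgHom_rel k (SalphaRel.zy (k := k) (α := α))
  simpa [Salpha.x, Salpha.y, Salpha.z, pow_two] using h

/-- Universal property of `S_α`. -/
def Salpha.lift {B : Type*} [Ring B] [Algebra k B] (X Y Z : B)
    (h1 : Y * X = α • (Z * Z)) (h2 : X * Z = α • (Y * Y)) (h3 : Z * Y = α • (X * X)) :
    Salpha k α →ₐ[k] B :=
  RingQuot.liftAlgHom k ⟨FreeAlgebra.lift k ![X, Y, Z], by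
    intro a b hab
    cases hab with
    | yx => simpa [pow_two] using h1
    | xz => simpa [pow_two] using h2
    | zy => simpa [pow_two] using h3⟩

theorem Salpha.lift_xyz {B : Type*} [Ring B] [Algebra k B] (X Y Z : B)
    (h1 : Y * X = α • (Z * Z)) (h2 : X * Z = α • (Y * Y)) (h3 : Z * Y = α • (X * X)) :
    Salpha.lift X Y Z h1 h2 h3 (Salpha.x k α) = X ∧
    Salpha.lift X Y Z h1 h2 h3 (Salpha.y k α) = Y ∧
    Salpha.lift X Y Z h1 h2 h3 (Salpha.z k α) = Z := by
  refine ⟨?_, ?_, ?_⟩ <;>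
    simp [Salpha.lift, Salpha.x, Salpha.y, Salpha.z]

/-- A subspace containing `1` and stable under left multiplication by the generators is all. -/
theorem Salpha.left_induction (N : Submodule k (Salpha k α)) (h1 : 1 ∈ N)
    (hx : ∀ a ∈ N, Salpha.x k α * a ∈ N) (hy : ∀ a ∈ N, Salpha.y k α * a ∈ N)
    (hz : ∀ a ∈ N, Salpha.z k α * a ∈ N) (a : Salpha k α) : a ∈ N := by
  obtain ⟨p, rfl⟩ := RingQuot.mkAlgHom_surjective k (SalphaRel k α) a
  have key : ∀ n ∈ N, RingQuot.mkAlgHom k (SalphaRel k α) p * n ∈ N := by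
    induction p using FreeAlgebra.induction with
    | grade0 r =>
      intro n hn
      rw [AlgHom.commutes, ← Algebra.smul_def]
      exact N.smul_mem _ hn
    | grade1 i =>
      intro n hn
      fin_cases i
      · exact hx n hn
      · exact hy n hn
      · exact hz n hn
    | mul a b ha hb =>
      intro n hn
      rw [map_mul, mul_assoc]
      exact ha _ (hb _ hn)
    | add a b ha hb =>
      intro n hn
      rw [map_add, add_mul]
      exact N.add_mem (ha _ hn) (hb _ hn)
  simpa using key 1 h1

/-- Homogeneous elements lie in any family of subspaces through which the generators act with
degree one. -/
theorem Salpha.graded_le (𝒜 : ℕ → Submodule k (Salpha k α)) [GradedAlgebra 𝒜]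
    (hx : Salpha.x k α ∈ 𝒜 1) (hy : Salpha.y k α ∈ 𝒜 1) (hz : Salpha.z k α ∈ 𝒜 1)
    (B : ℕ → Submodule k (Salpha k α)) (h1 : 1 ∈ B 0)
    (hBx : ∀ d, ∀ a ∈ B d, Salpha.x k α * a ∈ B (d + 1))
    (hBy : ∀ d, ∀ a ∈ B d, Salpha.y k α * a ∈ B (d + 1))
    (hBz : ∀ d, ∀ a ∈ B d, Salpha.z k α * a ∈ B (d + 1))
    (d : ℕ) (a : Salpha k α) (ha : a ∈ 𝒜 d) : a ∈ B d := by
  have step : ∀ u ∈ 𝒜 1, (∀ d, ∀ a ∈ B d, u * a ∈ B (d + 1)) → ∀ a : Salpha k α,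
      (∀ d, GradedAlgebra.proj 𝒜 d a ∈ B d) → ∀ d, GradedAlgebra.proj 𝒜 d (u * a) ∈ B d := by
    intro u hu hB a h d
    rw [GradedAlgebra.proj_apply]
    cases d with
    | zero =>
      rw [DirectSum.coe_decompose_mul_of_left_mem_of_not_le 𝒜 hu (by omega)]
      exact Submodule.zero_mem _
    | succ d =>
      rw [DirectSum.coe_decompose_mul_of_left_mem_of_le 𝒜 hu (by omega)]
      exact hB d _ (h d)
  let N : Submodule k (Salpha k α) := ⨅ d, (B d).comap (GradedAlgebra.proj 𝒜 d)
  have memN : ∀ a, a ∈ N ↔ ∀ d, GradedAlgebra.proj 𝒜 d a ∈ B d := by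
    intro a
    simp [N]
  have hN := Salpha.left_induction N
    (by
      rw [memN]
      intro d
      rw [GradedAlgebra.proj_apply]
      by_cases hd : d = 0
      · subst hd
        rw [DirectSum.decompose_of_mem_same 𝒜 SetLike.GradedOne.one_mem]
        exact h1
      · rw [DirectSum.decompose_of_mem_ne 𝒜 SetLike.GradedOne.one_mem (Ne.symm hd)]
        exact Submodule.zero_mem _)
    (fun a h => (memN _).2 (step _ hx hBx a ((memN _).1 h)))
    (fun a h => (memN _).2 (step _ hy hBy a ((memN _).1 h)))
    (fun a h => (memN _).2 (step _ hz hBz a ((memN _).1 h))) a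
  have := (memN a).1 hN d
  rwa [GradedAlgebra.proj_apply, DirectSum.decompose_of_mem_same 𝒜 ha] at this

/-! ### Monomial operators -/

/-- The operator `e_w ↦ s(w) e_{φ w}`. -/
def monoOp {ι : Type*} (φ : ι → ι) (s : ι → k) : Module.End k (ι →₀ k) :=
  Finsupp.linearCombination k (fun w => Finsupp.single (φ w) (s w))

theorem monoOp_single {ι : Type*} (φ : ι → ι) (s : ι → k) (w : ι) (c : k) :
    monoOp φ s (Finsupp.single w c) = Finsupp.single (φ w) (c * s w) := by
  simp [monoOp]

theorem monoOp_mul {ι : Type*} (φ φ' : ι → ι) (s s' : ι → k) :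
    monoOp φ s * monoOp φ' s' = monoOp (fun w => φ (φ' w)) (fun w => s (φ' w) * s' w) := by
  refine Finsupp.lhom_ext fun w c => ?_
  rw [Module.End.mul_apply, monoOp_single, monoOp_single, monoOp_single]
  congr 1
  ring

theorem monoOp_smul {ι : Type*} (φ : ι → ι) (s : ι → k) (c : k) :
    c • monoOp φ s = monoOp φ (fun w => c * s w) := by
  refine Finsupp.lhom_ext fun w d => ?_
  rw [LinearMap.smul_apply, monoOp_single, monoOp_single, Finsupp.smul_single]
  congr 1
  simp only [smul_eq_mul]
  ring

theorem monoOp_ne {ι : Type*} (φ : ι → ι) (s : ι → k) (f : ι →₀ k) (v : ι)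
    (h : monoOp φ s f v ≠ 0) : ∃ w, f w ≠ 0 ∧ φ w = v := by
  classical
  by_contra hc
  push Not at hc
  apply h
  rw [monoOp, Finsupp.linearCombination_apply, Finsupp.sum, Finsupp.finsetSum_apply]
  refine Finset.sum_eq_zero fun w hw => ?_
  rw [Finsupp.smul_apply, Finsupp.single_eq_of_ne (Ne.symm (hc w (by simpa using hw))), smul_zero]

theorem monoOp_apply {ι : Type*} (φ : ι → ι) (hφ : Function.Injective φ) (s : ι → k)
    (f : ι →₀ k) (w : ι) : monoOp φ s f (φ w) = f w * s w := by
  classical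
  induction f using Finsupp.induction_linear with
  | zero => simp
  | add f g hf hg => simp [hf, hg, add_mul]
  | single v c =>
    rw [monoOp_single, Finsupp.single_apply, Finsupp.single_apply]
    by_cases h : v = w
    · subst h; simp
    · rw [if_neg h, if_neg (fun h' => h (hφ h')), zero_mul]

/-- comparison of `π(a) 1` with `a` -/
theorem Salpha.model {V : Type*} [AddCommGroup V] [Module k V]
    (π : Salpha k α →ₐ[k] Module.End k V) (Ψ : V →ₗ[k] Salpha k α)
    (hx : ∀ f, Ψ (π (Salpha.x k α) f) = Salpha.x k α * Ψ f)
    (hy : ∀ f, Ψ (π (Salpha.y k α) f) = Salpha.y k α * Ψ f)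
    (hz : ∀ f, Ψ (π (Salpha.z k α) f) = Salpha.z k α * Ψ f)
    (a : Salpha k α) (f : V) : Ψ (π a f) = a * Ψ f := by
  let N : Submodule k (Salpha k α) :=
    { carrier := {a | Ψ (π a f) = a * Ψ f}
      zero_mem' := by simp
      add_mem' := by
        intro a b ha hb
        simp only [Set.mem_ofPred_eq] at *
        simp [ha, hb, add_mul]
      smul_mem' := by
        intro c a ha
        simp only [Set.mem_ofPred_eq] at *
        simp [ha] }
  refine Salpha.left_induction N ?_ ?_ ?_ ?_ a
  · show Ψ (π 1 f) = 1 * Ψ f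
    simp
  · intro a ha
    have ha : Ψ (π a f) = a * Ψ f := ha
    show Ψ (π (_ * a) f) = _ * a * Ψ f
    rw [map_mul, Module.End.mul_apply, hx, ha, mul_assoc]
  · intro a ha
    have ha : Ψ (π a f) = a * Ψ f := ha
    show Ψ (π (_ * a) f) = _ * a * Ψ f
    rw [map_mul, Module.End.mul_apply, hy, ha, mul_assoc]
  · intro a ha
    have ha : Ψ (π a f) = a * Ψ f := ha
    show Ψ (π (_ * a) f) = _ * a * Ψ f
    rw [map_mul, Module.End.mul_apply, hz, ha, mul_assoc]

end aux

/-! ### The case `α = 0` -/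

section zero

variable {k : Type*} [Field k]

open Classical in
/-- Left multiplication by the letter `u` on words. -/
def wordL (k : Type*) [Field k] (u : Fin 3) : Module.End k (List (Fin 3) →₀ k) :=
  monoOp (fun w => u :: w) (fun w => if w.head? = some (u - 1) then 0 else 1)

open Classical in
/-- Right multiplication by the letter `u` on words. -/
def wordR (k : Type*) [Field k] (u : Fin 3) : Module.End k (List (Fin 3) →₀ k) :=
  monoOp (fun w => w ++ [u]) (fun w => if w.getLast? = some (u + 1) then 0 else 1)

theorem wordL_single (u : Fin 3) (w : List (Fin 3)) (c : k) : wordL k u (Finsupp.single w c) =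
    if w.head? = some (u - 1) then 0 else Finsupp.single (u :: w) c := by
  rw [wordL, monoOp_single]
  split_ifs <;> simp

theorem wordL_mul (u v : Fin 3) (h : v = u - 1) : wordL k u * wordL k v = 0 := by
  refine Finsupp.lhom_ext fun w c => ?_
  rw [Module.End.mul_apply, wordL_single]
  split_ifs
  · simp
  · rw [wordL_single, if_pos (by simp [h])]
    simp

theorem wordLR (u v : Fin 3) : wordL k u * wordR k v = wordR k v * wordL k u := by
  rw [wordL, wordR, monoOp_mul, monoOp_mul]
  congr 1
  funext w
  rcases w with _ | ⟨b, t⟩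
  · have : (v = u - 1) ↔ (u = v + 1) := by
      constructor <;> intro h <;> subst h <;> simp
    simp [this]
  · simp [mul_comm]

/-- The representation of `S_0` on words. -/
def wordPi (k : Type*) [Field k] : Salpha k (0 : k) →ₐ[k] Module.End k (List (Fin 3) →₀ k) :=
  Salpha.lift (wordL k 0) (wordL k 1) (wordL k 2)
    (by rw [wordL_mul _ _ (by decide), zero_smul])
    (by rw [wordL_mul _ _ (by decide), zero_smul])
    (by rw [wordL_mul _ _ (by decide), zero_smul])

/-- The generators. -/
def genS (k : Type*) [Field k] (α : k) : Fin 3 → Salpha k α :=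
  ![Salpha.x k α, Salpha.y k α, Salpha.z k α]

theorem wordPi_gen (u : Fin 3) : wordPi k (genS k 0 u) = wordL k u := by
  have h := Salpha.lift_xyz (α := (0 : k)) (wordL k 0) (wordL k 1) (wordL k 2)
    (by rw [wordL_mul _ _ (by decide), zero_smul])
    (by rw [wordL_mul _ _ (by decide), zero_smul])
    (by rw [wordL_mul _ _ (by decide), zero_smul])
  fin_cases u
  · exact h.1
  · exact h.2.1
  · exact h.2.2

theorem genS_zero_mul (u : Fin 3) : genS k 0 u * genS k 0 (u - 1) = 0 := by
  fin_cases u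
  · exact Salpha.rel_xz.trans (zero_smul _ _)
  · exact Salpha.rel_yx.trans (zero_smul _ _)
  · exact Salpha.rel_zy.trans (zero_smul _ _)

/-- Evaluation of words. -/
def wordPsi (k : Type*) [Field k] : (List (Fin 3) →₀ k) →ₗ[k] Salpha k (0 : k) :=
  Finsupp.linearCombination k (fun w => (w.map (genS k 0)).prod)

theorem wordPsi_L (u : Fin 3) (f : List (Fin 3) →₀ k) :
    wordPsi k (wordL k u f) = genS k 0 u * wordPsi k f := by
  have : wordPsi k ∘ₗ wordL k u = LinearMap.mulLeft k (genS k 0 u) ∘ₗ wordPsi k := by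
    refine Finsupp.lhom_ext fun w c => ?_
    rw [LinearMap.comp_apply, LinearMap.comp_apply, wordL_single]
    split_ifs with h
    · rcases w with _ | ⟨b, t⟩
      · simp at h
      · have hb : b = u - 1 := by simpa using h
        subst hb
        simp only [wordPsi, map_zero, Finsupp.linearCombination_single, LinearMap.mulLeft_apply,
          List.map_cons, List.prod_cons, mul_smul_comm, ← mul_assoc, genS_zero_mul, zero_mul,
          smul_zero]
    · simp [wordPsi]
  exact LinearMap.congr_fun this f

theorem stmt12_zero (𝒜 : ℕ → Submodule k (Salpha k (0 : k))) [GradedAlgebra 𝒜]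
    (d : ℕ) (a : Salpha k (0 : k)) (had : a ∈ 𝒜 d)
    (hc : a ∈ Subalgebra.center k (Salpha k (0 : k))) (ha0 : a ≠ 0) : d = 0 := by
  set f := wordPi k a (Finsupp.single [] 1) with hf
  have hmodel : ∀ (a : Salpha k (0 : k)) f, wordPsi k (wordPi k a f) = a * wordPsi k f :=
    fun a f => Salpha.model (wordPi k) (wordPsi k)
      (fun f => by
        rw [show Salpha.x k (0 : k) = genS k 0 0 from rfl, wordPi_gen, wordPsi_L])
      (fun f => by
        rw [show Salpha.y k (0 : k) = genS k 0 1 from rfl, wordPi_gen, wordPsi_L])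
      (fun f => by
        rw [show Salpha.z k (0 : k) = genS k 0 2 from rfl, wordPi_gen, wordPsi_L]) a f
  have hΨ : wordPsi k f = a := by
    rw [hf, hmodel]
    simp [wordPsi]
  have hcomm : ∀ (v : Fin 3) (a : Salpha k (0 : k)),
      wordPi k a * wordR k v = wordR k v * wordPi k a := by
    intro v a
    let N : Submodule k (Salpha k (0 : k)) := Subalgebra.toSubmodule
      ((Subalgebra.centralizer k {wordR k v}).comap (wordPi k))
    have memN : ∀ a, a ∈ N ↔ wordPi k a * wordR k v = wordR k v * wordPi k a := by
      intro a
      simp [N, Subalgebra.mem_centralizer_iff, eq_comm]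
    have hg : ∀ u, ∀ a ∈ N, genS k 0 u * a ∈ N := by
      intro u a ha
      rw [memN] at ha ⊢
      rw [map_mul, mul_assoc, ha, ← mul_assoc, wordPi_gen, wordLR, mul_assoc]
    exact (memN a).1 (Salpha.left_induction N ((memN 1).2 (by simp)) (hg 0) (hg 1) (hg 2) a)
  have hLR : ∀ u, wordL k u f = wordR k u f := by
    intro u
    have h1 : wordL k u f = wordPi k (genS k 0 u * a) (Finsupp.single [] 1) := by
      rw [map_mul, wordPi_gen, Module.End.mul_apply]
    have h2 : genS k 0 u * a = a * genS k 0 u := by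
      rw [Subalgebra.mem_center_iff] at hc
      exact hc _
    have h3 : wordL k u (Finsupp.single [] 1) = wordR k u (Finsupp.single [] 1) := by
      simp [wordL, wordR, monoOp_single]
    rw [h1, h2, map_mul, Module.End.mul_apply, wordPi_gen, h3, ← Module.End.mul_apply, hcomm,
      Module.End.mul_apply]
  have hsupp : ∀ w, w ≠ [] → f w = 0 := by
    intro w hw
    by_contra hfw
    have key : ∀ u, w.head? ≠ some (u - 1) → w.getLast? = some u := by
      intro u hu
      have h1 : wordL k u f (u :: w) ≠ 0 := by
        rw [wordL, monoOp_apply _ (fun a b h => by simpa using h), if_neg hu]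
        simpa using hfw
      rw [hLR, wordR] at h1
      obtain ⟨w', -, h2⟩ := monoOp_ne _ _ _ _ h1
      have h3 := congrArg List.getLast? h2
      rcases w with _ | ⟨b, t⟩
      · exact absurd rfl hw
      · simp only [List.getLast?_append, List.getLast?_singleton, List.getLast?_cons_cons] at h3
        simpa using h3.symm
    rcases w with _ | ⟨b, t⟩
    · exact hw rfl
    · have h1 := key b (by
        rw [List.head?_cons, Ne, Option.some_inj]
        exact (by decide : ∀ b : Fin 3, ¬ b = b - 1) b)
      have h2 := key (b - 1) (by
        rw [List.head?_cons, Ne, Option.some_inj]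
        exact (by decide : ∀ b : Fin 3, ¬ b = b - 1 - 1) b)
      rw [h1, Option.some_inj] at h2
      revert h2
      clear * -
      revert b; decide
  have hfs : f = Finsupp.single [] (f []) := by
    ext w
    by_cases hw : w = []
    · subst hw; simp
    · rw [hsupp w hw, Finsupp.single_eq_of_ne hw]
  have ha : a = f [] • (1 : Salpha k (0 : k)) := by
    rw [← hΨ, hfs]
    simp [wordPsi]
  have ha1 : a ∈ 𝒜 0 := by
    rw [ha]
    exact Submodule.smul_mem _ _ SetLike.GradedOne.one_mem
  exact DirectSum.degree_eq_of_mem_mem 𝒜 had ha1 ha0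

end zero

/-! ### The case `α ≠ 0` -/

section nonzero

variable {k : Type*} [Field k] {α : k}

/-- `q`-commutation of powers. -/
theorem qcomm_pow {M : Type*} [AddCommMonoid M] [Module k M] {A B : Module.End k M} {c : k}
    (h : A * B = c • (B * A)) (i j : ℕ) : A ^ i * B ^ j = c ^ (i * j) • (B ^ j * A ^ i) := by
  have h1 : ∀ j : ℕ, A * B ^ j = c ^ j • (B ^ j * A) := by
    intro j
    induction j with
    | zero => simp
    | succ j ih =>
      rw [pow_succ, ← mul_assoc, ih, smul_mul_assoc, mul_assoc, h, mul_smul_comm, smul_smul,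
        mul_assoc, pow_succ]
  induction i with
  | zero => simp
  | succ i ih =>
    rw [pow_succ', mul_assoc, ih, mul_smul_comm, ← mul_assoc, h1, smul_mul_assoc, smul_smul,
      mul_assoc, ← pow_add]
    congr 2
    ring

/-- index set of monomials -/
abbrev Idx := ℕ × ℕ × ℕ

/-- left multiplication by `x` -/
def opX (α : k) : Module.End k (Idx →₀ k) :=
  monoOp (fun w => (w.2.1 + 1, w.2.2, w.1)) (fun w => α ^ ((w.1 * w.2.1 : ℤ) - w.1 * w.2.2))

/-- left multiplication by `y` -/
def opY (α : k) : Module.End k (Idx →₀ k) :=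
  monoOp (fun w => (w.2.1, w.2.2 + 1, w.1))
    (fun w => α ^ ((w.1 * w.2.1 : ℤ) - w.1 * w.2.2 - w.2.1))

/-- left multiplication by `z` -/
def opZ (α : k) : Module.End k (Idx →₀ k) :=
  monoOp (fun w => (w.2.1, w.2.2, w.1 + 1))
    (fun w => α ^ ((w.1 * w.2.1 : ℤ) - w.1 * w.2.2 + w.2.1 - w.2.2))

/-- untwisted right multiplication by the generators -/
def opR (α : k) : Fin 3 → Module.End k (Idx →₀ k) :=
  ![monoOp (fun w => (w.1 + 1, w.2.1, w.2.2)) (fun w => α ^ ((w.2.2 : ℤ) - w.2.1)),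
    monoOp (fun w => (w.1, w.2.1 + 1, w.2.2)) (fun w => α ^ (-(w.2.2 : ℤ))),
    monoOp (fun w => (w.1, w.2.1, w.2.2 + 1)) (fun _ => α ^ (0 : ℤ))]

theorem opYX (h : α ≠ 0) : opY α * opX α = α • (opZ α * opZ α) := by
  rw [opY, opX, opZ, monoOp_mul, monoOp_mul, monoOp_smul]
  congr 1
  funext w
  conv_rhs => rw [← zpow_one α]
  simp only [← zpow_mul, ← zpow_add₀ h]
  congr 1
  push_cast
  ring

theorem opXZ (h : α ≠ 0) : opX α * opZ α = α • (opY α * opY α) := by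
  rw [opY, opX, opZ, monoOp_mul, monoOp_mul, monoOp_smul]
  congr 1
  funext w
  conv_rhs => rw [← zpow_one α]
  simp only [← zpow_mul, ← zpow_add₀ h]
  congr 1
  push_cast
  ring

theorem opZY (h : α ≠ 0) : opZ α * opY α = α • (opX α * opX α) := by
  rw [opY, opX, opZ, monoOp_mul, monoOp_mul, monoOp_smul]
  congr 1
  funext w
  conv_rhs => rw [← zpow_one α]
  simp only [← zpow_mul, ← zpow_add₀ h]
  congr 1
  push_cast
  ring

theorem opX_R (h : α ≠ 0) (c : Fin 3) : opX α * opR α c = opR α (c - 1) * opX α := by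
  fin_cases c
  all_goals
    change monoOp _ _ * monoOp _ _ = monoOp _ _ * monoOp _ _
    rw [monoOp_mul, monoOp_mul]
    congr 1
    funext w
    simp only [← zpow_add₀ h]
    congr 1
    push_cast
    ring

theorem opY_R (h : α ≠ 0) (c : Fin 3) : opY α * opR α c = opR α (c - 1) * opY α := by
  fin_cases c
  all_goals
    change monoOp _ _ * monoOp _ _ = monoOp _ _ * monoOp _ _
    rw [monoOp_mul, monoOp_mul]
    congr 1
    funext w
    simp only [← zpow_add₀ h]
    congr 1
    push_cast
    ring

theorem opZ_R (h : α ≠ 0) (c : Fin 3) : opZ α * opR α c = opR α (c - 1) * opZ α := by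
  fin_cases c
  all_goals
    change monoOp _ _ * monoOp _ _ = monoOp _ _ * monoOp _ _
    rw [monoOp_mul, monoOp_mul]
    congr 1
    funext w
    simp only [← zpow_add₀ h]
    congr 1
    push_cast
    ring

/-- The representation of `S_α` on monomials. -/
def opPi (h : α ≠ 0) : Salpha k α →ₐ[k] Module.End k (Idx →₀ k) :=
  Salpha.lift (opX α) (opY α) (opZ α) (opYX h) (opXZ h) (opZY h)

/-- the cyclic automorphism -/
def tauS (k : Type*) [Field k] (α : k) : Salpha k α →ₐ[k] Salpha k α :=
  Salpha.lift (Salpha.y k α) (Salpha.z k α) (Salpha.x k α)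
    Salpha.rel_zy Salpha.rel_yx Salpha.rel_xz

theorem tauS_x : tauS k α (Salpha.x k α) = Salpha.y k α := (Salpha.lift_xyz _ _ _ _ _ _).1
theorem tauS_y : tauS k α (Salpha.y k α) = Salpha.z k α := (Salpha.lift_xyz _ _ _ _ _ _).2.1
theorem tauS_z : tauS k α (Salpha.z k α) = Salpha.x k α := (Salpha.lift_xyz _ _ _ _ _ _).2.2

theorem tauS_three (a : Salpha k α) : tauS k α (tauS k α (tauS k α a)) = a := by
  let N : Submodule k (Salpha k α) := Subalgebra.toSubmodule
    (AlgHom.equalizer (((tauS k α).comp (tauS k α)).comp (tauS k α)) (AlgHom.id k _))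
  have memN : ∀ a, a ∈ N ↔ tauS k α (tauS k α (tauS k α a)) = a := by
    intro a
    simp [N, AlgHom.mem_equalizer]
  refine (memN a).1 (Salpha.left_induction N ?_ ?_ ?_ ?_ a)
  · rw [memN]; simp
  all_goals
    intro a ha
    rw [memN] at ha ⊢
    simp [ha, tauS_x, tauS_y, tauS_z]

/-- twisted left multiplication `b ↦ u τ(b)` -/
def twL (u : Salpha k α) : Module.End k (Salpha k α) :=
  LinearMap.mulLeft k u ∘ₗ (tauS k α).toLinearMap

theorem twL_apply (u b : Salpha k α) : twL u b = u * tauS k α b := rfl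

/-- the inverse of `τ` -/
def sigS (k : Type*) [Field k] (α : k) : Module.End k (Salpha k α) :=
  (tauS k α).toLinearMap ∘ₗ (tauS k α).toLinearMap

theorem sigS_apply (b : Salpha k α) : sigS k α b = tauS k α (tauS k α b) := rfl

theorem mul_eq_twL (u b : Salpha k α) : u * b = twL u (sigS k α b) := by
  rw [twL_apply, sigS_apply, tauS_three]

theorem sig_twx : SemiconjBy (sigS k α) (twL (Salpha.x k α)) (twL (Salpha.z k α)) := by
  ext b
  simp [Module.End.mul_apply, twL_apply, sigS_apply, tauS_x, tauS_y, tauS_z]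

theorem sig_twy : SemiconjBy (sigS k α) (twL (Salpha.y k α)) (twL (Salpha.x k α)) := by
  ext b
  simp [Module.End.mul_apply, twL_apply, sigS_apply, tauS_x, tauS_y, tauS_z]

theorem sig_twz : SemiconjBy (sigS k α) (twL (Salpha.z k α)) (twL (Salpha.y k α)) := by
  ext b
  simp [Module.End.mul_apply, twL_apply, sigS_apply, tauS_x, tauS_y, tauS_z]

theorem tw_zx : twL (Salpha.z k α) * twL (Salpha.x k α) =
    α • (twL (Salpha.x k α) * twL (Salpha.z k α)) := by
  ext b
  simp only [Module.End.mul_apply, twL_apply, LinearMap.smul_apply, map_mul, tauS_x, tauS_z,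
    ← mul_assoc, Salpha.rel_zy, smul_mul_assoc]

theorem tw_yz : twL (Salpha.y k α) * twL (Salpha.z k α) =
    α • (twL (Salpha.z k α) * twL (Salpha.y k α)) := by
  ext b
  simp only [Module.End.mul_apply, twL_apply, LinearMap.smul_apply, map_mul, tauS_y, tauS_z,
    ← mul_assoc, Salpha.rel_yx, smul_mul_assoc]

theorem tw_xy : twL (Salpha.x k α) * twL (Salpha.y k α) =
    α • (twL (Salpha.y k α) * twL (Salpha.x k α)) := by
  ext b
  simp only [Module.End.mul_apply, twL_apply, LinearMap.smul_apply, map_mul, tauS_y, tauS_x,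
    ← mul_assoc, Salpha.rel_xz, smul_mul_assoc]

/-- the ordered monomial, as an operator -/
def monE (k : Type*) [Field k] (α : k) (w : Idx) : Module.End k (Salpha k α) :=
  twL (Salpha.x k α) ^ w.1 * (twL (Salpha.y k α) ^ w.2.1 * twL (Salpha.z k α) ^ w.2.2)

theorem sig_mon (h : α ≠ 0) (w : Idx) : sigS k α (monE k α w 1) =
    α ^ ((w.1 * w.2.1 : ℤ) - w.1 * w.2.2) • monE k α (w.2.1, w.2.2, w.1) 1 := by
  obtain ⟨i, j, l⟩ := w
  have h1 : sigS k α * monE k α (i, j, l) =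
      (twL (Salpha.z k α) ^ i * (twL (Salpha.x k α) ^ j * twL (Salpha.y k α) ^ l)) *
        sigS k α :=
    ((sig_twx.pow_right i).mul_right ((sig_twy.pow_right j).mul_right (sig_twz.pow_right l))).eq
  have h2 : twL (Salpha.z k α) * twL (Salpha.y k α) =
      α⁻¹ • (twL (Salpha.y k α) * twL (Salpha.z k α)) := by
    rw [tw_yz, smul_smul, inv_mul_cancel₀ h, one_smul]
  have h3 : twL (Salpha.z k α) ^ i * (twL (Salpha.x k α) ^ j * twL (Salpha.y k α) ^ l) =
      α ^ ((i * j : ℤ) - i * l) • monE k α (j, l, i) := by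
    rw [← mul_assoc, qcomm_pow tw_zx, smul_mul_assoc, mul_assoc, qcomm_pow h2, mul_smul_comm,
      smul_smul, monE, zpow_sub₀ h]
    congr 1
    rw [inv_pow, div_eq_mul_inv]
    norm_cast
  have h4 := LinearMap.congr_fun h1 1
  rw [h3, Module.End.mul_apply, Module.End.mul_apply] at h4
  rw [h4]
  simp [sigS_apply]

theorem tw_monx (w : Idx) : twL (Salpha.x k α) (monE k α w 1) =
    monE k α (w.1 + 1, w.2.1, w.2.2) 1 := by
  rw [← Module.End.mul_apply, monE, monE, ← mul_assoc, ← pow_succ']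

theorem tw_mony (h : α ≠ 0) (w : Idx) : twL (Salpha.y k α) (monE k α w 1) =
    α ^ (-(w.1 : ℤ)) • monE k α (w.1, w.2.1 + 1, w.2.2) 1 := by
  have h2 : twL (Salpha.y k α) * twL (Salpha.x k α) =
      α⁻¹ • (twL (Salpha.x k α) * twL (Salpha.y k α)) := by
    rw [tw_xy, smul_smul, inv_mul_cancel₀ h, one_smul]
  have h3 := qcomm_pow h2 1 w.1
  rw [pow_one, one_mul] at h3
  rw [← Module.End.mul_apply, monE, monE, ← mul_assoc, h3, ← LinearMap.smul_apply]
  congr 1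
  rw [smul_mul_assoc, zpow_neg, zpow_natCast, inv_pow, pow_succ']
  simp only [mul_assoc]

theorem tw_monz (h : α ≠ 0) (w : Idx) : twL (Salpha.z k α) (monE k α w 1) =
    α ^ ((w.1 : ℤ) - w.2.1) • monE k α (w.1, w.2.1, w.2.2 + 1) 1 := by
  have h2 : twL (Salpha.z k α) * twL (Salpha.y k α) =
      α⁻¹ • (twL (Salpha.y k α) * twL (Salpha.z k α)) := by
    rw [tw_yz, smul_smul, inv_mul_cancel₀ h, one_smul]
  have h3 := qcomm_pow h2 1 w.2.1
  have h4 := qcomm_pow (tw_zx (k := k) (α := α)) 1 w.1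
  rw [pow_one, one_mul] at h3 h4
  rw [← Module.End.mul_apply, monE, monE, ← mul_assoc, h4, ← LinearMap.smul_apply]
  congr 1
  rw [smul_mul_assoc, mul_assoc, ← mul_assoc (twL (Salpha.z k α)), h3, smul_mul_assoc,
    mul_smul_comm, smul_smul, zpow_sub₀ h, zpow_natCast, zpow_natCast, inv_pow, div_eq_mul_inv,
    pow_succ' _ w.2.2]
  simp only [mul_assoc]

/-- Evaluation of monomials. -/
def opPsi (k : Type*) [Field k] (α : k) : (Idx →₀ k) →ₗ[k] Salpha k α :=
  Finsupp.linearCombination k (fun w => monE k α w 1)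

theorem opPsi_single (w : Idx) (c : k) :
    opPsi k α (Finsupp.single w c) = c • monE k α w 1 := by
  simp [opPsi]

theorem opPsi_X (h : α ≠ 0) (f : Idx →₀ k) :
    opPsi k α (opX α f) = Salpha.x k α * opPsi k α f := by
  have : opPsi k α ∘ₗ opX α = LinearMap.mulLeft k (Salpha.x k α) ∘ₗ opPsi k α := by
    refine Finsupp.lhom_ext fun w c => ?_
    rw [LinearMap.comp_apply, LinearMap.comp_apply, opX, monoOp_single, opPsi_single,
      opPsi_single, LinearMap.mulLeft_apply, mul_smul_comm, mul_eq_twL, sig_mon h, map_smul,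
      tw_monx, smul_smul]
  exact LinearMap.congr_fun this f

theorem opPsi_Y (h : α ≠ 0) (f : Idx →₀ k) :
    opPsi k α (opY α f) = Salpha.y k α * opPsi k α f := by
  have : opPsi k α ∘ₗ opY α = LinearMap.mulLeft k (Salpha.y k α) ∘ₗ opPsi k α := by
    refine Finsupp.lhom_ext fun w c => ?_
    rw [LinearMap.comp_apply, LinearMap.comp_apply, opY, monoOp_single, opPsi_single,
      opPsi_single, LinearMap.mulLeft_apply, mul_smul_comm, mul_eq_twL, sig_mon h, map_smul,
      tw_mony h, smul_smul, smul_smul, mul_assoc, ← zpow_add₀ h]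
    congr 1
  exact LinearMap.congr_fun this f

theorem opPsi_Z (h : α ≠ 0) (f : Idx →₀ k) :
    opPsi k α (opZ α f) = Salpha.z k α * opPsi k α f := by
  have : opPsi k α ∘ₗ opZ α = LinearMap.mulLeft k (Salpha.z k α) ∘ₗ opPsi k α := by
    refine Finsupp.lhom_ext fun w c => ?_
    rw [LinearMap.comp_apply, LinearMap.comp_apply, opZ, monoOp_single, opPsi_single,
      opPsi_single, LinearMap.mulLeft_apply, mul_smul_comm, mul_eq_twL, sig_mon h, map_smul,
      tw_monz h, smul_smul, smul_smul, mul_assoc, ← zpow_add₀ h]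
    congr 3
    ring
  exact LinearMap.congr_fun this f

/-- A function whose support is stable under a strictly decreasing shift vanishes. -/
theorem support_shift (f : Idx →₀ k)
    (h : ∀ w, f w ≠ 0 → ∃ v, f v ≠ 0 ∧ v.1 < w.1) : f = 0 := by
  have : ∀ n : ℕ, ∀ w : Idx, w.1 = n → f w = 0 := by
    intro n
    induction n using Nat.strong_induction_on with
    | _ n ih =>
      intro w hw
      by_contra hne
      obtain ⟨v, hv, hlt⟩ := h w hne
      exact hv (ih v.1 (by omega) v rfl)
  ext w
  exact this _ w rfl

/-- `(j+1,l,i)` in the support of `X f`. -/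
theorem opX_ne (h : α ≠ 0) (f : Idx →₀ k) (i j l : ℕ) (hf : f (i, j, l) ≠ 0) :
    opX α f (j + 1, l, i) ≠ 0 := by
  rw [opX, monoOp_apply (fun w : Idx => (w.2.1 + 1, w.2.2, w.1))
    (by rintro ⟨a, b, c⟩ ⟨a2, b2, c2⟩ hh; simp at hh ⊢; omega) _ f (i, j, l)]
  exact mul_ne_zero hf (zpow_ne_zero _ h)

theorem ofNat_succ3 (d : ℕ) : Fin.ofNat 3 (d + 1) = Fin.ofNat 3 d + 1 := by
  apply Fin.ext
  simp [Fin.val_add]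

theorem opY_ne (h : α ≠ 0) (f : Idx →₀ k) (i j l : ℕ) (hf : f (i, j, l) ≠ 0) :
    opY α f (j, l + 1, i) ≠ 0 := by
  rw [opY, monoOp_apply (fun w : Idx => (w.2.1, w.2.2 + 1, w.1))
    (by rintro ⟨a, b, c⟩ ⟨a2, b2, c2⟩ hh; simp at hh ⊢; omega) _ f (i, j, l)]
  exact mul_ne_zero hf (zpow_ne_zero _ h)

theorem opZ_ne (h : α ≠ 0) (f : Idx →₀ k) (i j l : ℕ) (hf : f (i, j, l) ≠ 0) :
    opZ α f (j, l, i + 1) ≠ 0 := by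
  rw [opZ, monoOp_apply (fun w : Idx => (w.2.1, w.2.2, w.1 + 1))
    (by rintro ⟨a, b, c⟩ ⟨a2, b2, c2⟩ hh; simp at hh ⊢; omega) _ f (i, j, l)]
  exact mul_ne_zero hf (zpow_ne_zero _ h)

theorem opR1_ne (h : α ≠ 0) (f : Idx →₀ k) (i j l : ℕ) (hf : f (i, j, l) ≠ 0) :
    opR α 1 f (i, j + 1, l) ≠ 0 := by
  change monoOp _ _ f _ ≠ 0
  rw [monoOp_apply (fun w : Idx => (w.1, w.2.1 + 1, w.2.2))
    (by rintro ⟨a, b, c⟩ ⟨a2, b2, c2⟩ hh; simp at hh ⊢; omega) _ f (i, j, l)]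
  exact mul_ne_zero hf (zpow_ne_zero _ h)

theorem opR2_ne (h : α ≠ 0) (f : Idx →₀ k) (i j l : ℕ) (hf : f (i, j, l) ≠ 0) :
    opR α 2 f (i, j, l + 1) ≠ 0 := by
  change monoOp _ _ f _ ≠ 0
  rw [monoOp_apply (fun w : Idx => (w.1, w.2.1, w.2.2 + 1))
    (by rintro ⟨a, b, c⟩ ⟨a2, b2, c2⟩ hh; simp at hh ⊢; omega) _ f (i, j, l)]
  exact mul_ne_zero hf (zpow_ne_zero _ h)

theorem stmt12_ne (h : α ≠ 0) (𝒜 : ℕ → Submodule k (Salpha k α)) [GradedAlgebra 𝒜]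
    (hx : Salpha.x k α ∈ 𝒜 1) (hy : Salpha.y k α ∈ 𝒜 1) (hz : Salpha.z k α ∈ 𝒜 1)
    (d : ℕ) (a : Salpha k α) (had : a ∈ 𝒜 d)
    (hc : a ∈ Subalgebra.center k (Salpha k α)) (ha0 : a ≠ 0) : 3 ∣ d := by
  obtain ⟨px, py, pz⟩ : opPi h (Salpha.x k α) = opX α ∧ opPi h (Salpha.y k α) = opY α ∧
    opPi h (Salpha.z k α) = opZ α := Salpha.lift_xyz _ _ _ _ _ _
  set e : Idx →₀ k := Finsupp.single (0, 0, 0) 1 with he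
  set f := opPi h a e with hf
  have hΨ : opPsi k α f = a := by
    rw [hf, Salpha.model (opPi h) (opPsi k α) (fun f => by rw [px, opPsi_X h])
      (fun f => by rw [py, opPsi_Y h]) (fun f => by rw [pz, opPsi_Z h])]
    simp [he, opPsi, monE]
  have hf0 : f ≠ 0 := by
    intro h0
    rw [h0, map_zero] at hΨ
    exact ha0 hΨ.symm
  have hcomm : ∀ c : Fin 3, opPi h a * opR α c = opR α (c - Fin.ofNat 3 d) * opPi h a := by
    let B : ℕ → Submodule k (Salpha k α) := fun d =>
      { carrier := {a | ∀ c : Fin 3, opPi h a * opR α c = opR α (c - Fin.ofNat 3 d) * opPi h a}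
        zero_mem' := by simp
        add_mem' := by
          intro a b ha hb c
          rw [map_add, add_mul, mul_add, ha, hb]
        smul_mem' := by
          intro r a ha c
          rw [map_smul, smul_mul_assoc, mul_smul_comm, ha] }
    have gen : ∀ (u : Salpha k α), (∀ c, opPi h u * opR α c = opR α (c - 1) * opPi h u) →
        ∀ d, ∀ a ∈ B d, u * a ∈ B (d + 1) := by
      intro u hu d a ha c
      have ha : ∀ c : Fin 3, opPi h a * opR α c = opR α (c - Fin.ofNat 3 d) * opPi h a := ha
      rw [map_mul, mul_assoc, ha, ← mul_assoc, hu, mul_assoc, ofNat_succ3, sub_sub]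
    exact Salpha.graded_le 𝒜 hx hy hz B
      (by intro c; rw [show Fin.ofNat 3 0 = 0 from rfl, sub_zero]; simp)
      (gen _ (by rw [px]; exact opX_R h)) (gen _ (by rw [py]; exact opY_R h))
      (gen _ (by rw [pz]; exact opZ_R h)) d a had
  have main : ∀ (u : Salpha k α) (c : Fin 3), opPi h u e = opR α c e →
      opPi h u f = opR α (c - Fin.ofNat 3 d) f := by
    intro u c huc
    have h2 : u * a = a * u := by
      rw [Subalgebra.mem_center_iff] at hc
      exact hc _
    rw [hf, ← Module.End.mul_apply, ← map_mul, h2, map_mul, Module.End.mul_apply, huc,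
      ← Module.End.mul_apply, hcomm, Module.End.mul_apply]
  have mx := main (Salpha.x k α) 0 (by
    rw [px, he]; simp [opX, opR, monoOp_single])
  have my := main (Salpha.y k α) 1 (by
    rw [py, he]; simp [opY, opR, monoOp_single])
  have mz := main (Salpha.z k α) 2 (by
    rw [pz, he]; simp [opZ, opR, monoOp_single])
  rw [px] at mx
  rw [py] at my
  rw [pz] at mz
  have hd3 : d % 3 = 0 ∨ d % 3 = 1 ∨ d % 3 = 2 := by omega
  rcases hd3 with hd | hd | hd
  · exact Nat.dvd_of_mod_eq_zero hd
  · exfalso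
    have hcast : Fin.ofNat 3 d = 1 := by
      apply Fin.ext; simpa using hd
    rw [hcast] at mx my
    have mx' : opX α f = opR α 2 f := mx
    have my' : opY α f = opR α 0 f := my
    refine hf0 (support_shift f ?_)
    rintro ⟨p, q, r⟩ hw
    have h1 := opR2_ne h f p q r hw
    rw [← mx'] at h1
    obtain ⟨⟨i, j, l⟩, h2, h3⟩ := monoOp_ne _ _ _ _ h1
    have h4 := opY_ne h f i j l h2
    rw [my'] at h4
    obtain ⟨⟨i2, j2, l2⟩, h5, h6⟩ := monoOp_ne _ _ _ _ h4
    refine ⟨_, h5, ?_⟩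
    simp only [Prod.mk.injEq] at h3 h6 ⊢
    omega
  · exfalso
    have hcast : Fin.ofNat 3 d = 2 := by
      apply Fin.ext; simpa using hd
    rw [hcast] at mx mz
    have mx' : opX α f = opR α 1 f := mx
    have my' : opZ α f = opR α 0 f := mz
    refine hf0 (support_shift f ?_)
    rintro ⟨p, q, r⟩ hw
    have h1 := opR1_ne h f p q r hw
    rw [← mx'] at h1
    obtain ⟨⟨i, j, l⟩, h2, h3⟩ := monoOp_ne _ _ _ _ h1
    have h4 := opZ_ne h f i j l h2
    rw [my'] at h4
    obtain ⟨⟨i2, j2, l2⟩, h5, h6⟩ := monoOp_ne _ _ _ _ h4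
    refine ⟨_, h5, ?_⟩
    simp only [Prod.mk.injEq] at h3 h6 ⊢
    omega

end nonzero

/-- Suppose `k` is algebraically closed of characteristic 0. Let `α ∈ k`
be a primitive `m`th root of unity with `m ∉ {1,3}`, and grade `S_α` with
`deg x = deg y = deg z = 1`. Then the center of `S_α` is contained in the 3-Veronese
subalgebra: every nonzero homogeneous central element has degree divisible by `3`. -/
theorem stmt12 (k : Type*) [Field k] [CharZero k] [IsAlgClosed k]
    (α : k) (m : ℕ) (hα : IsPrimitiveRoot α m) (hm1 : m ≠ 1) (hm3 : m ≠ 3)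
    (𝒜 : ℕ → Submodule k (Salpha k α)) [GradedAlgebra 𝒜]
    (hx : Salpha.x k α ∈ 𝒜 1) (hy : Salpha.y k α ∈ 𝒜 1) (hz : Salpha.z k α ∈ 𝒜 1) :
    ∀ (d : ℕ) (a : Salpha k α), a ∈ 𝒜 d → a ∈ Subalgebra.center k (Salpha k α) →
      a ≠ 0 → 3 ∣ d := by
  intro d a had hc ha0
  by_cases h0 : α = 0
  · subst h0
    rw [stmt12_zero 𝒜 d a had hc ha0]
    exact dvd_zero 3
  · exact stmt12_ne h0 𝒜 hx hy hz d a had hc ha0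
end
end

section
/- Let B be a prime ring which is a finitely generated module over its center Z (so Z is a domain; let F = Frac(Z) and define rk_Z(B) = dim_F(B ⊗_Z F)). Let C be a prime subring of B with Z ⊆ C. Then: (1) rk_Z(C) divides rk_Z(B); (2) rk_{Z(C)}(C) and rk_Z(B) are perfect squares and the PI-degree of C (the square root of rk_{Z(C)}(C)) divides the PI-degree of B (the square root of rk_Z(B)); (3) rk_Z(Z(C)) divides both rk_Z(C) and rk_Z(B). -/
noncomputable section
open scoped TensorProduct

/-- A ring `B` is a **prime ring** if for all `a b`, `a·B·b = 0` implies `a = 0` or `b = 0`. -/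
def IsPrimeRing' (B : Type*) [Ring B] : Prop :=
  ∀ a b : B, (∀ x : B, a * x * b = 0) → a = 0 ∨ b = 0

/-- The rank of a module `M` over a commutative (domain) `R`:
`rk_R(M) = dim_{Frac R}(Frac R ⊗_R M)`. -/
def rkMod (R M : Type*) [CommRing R] [AddCommGroup M] [Module R M] : ℕ :=
  Module.finrank (FractionRing R) (FractionRing R ⊗[R] M)


attribute [local instance] TensorProduct.Algebra.module in
lemma tensor_tower (F A B M : Type*) [Field F] [Ring A] [Algebra F A] [Ring B] [Algebra F B]
    [AddCommGroup M] [Module F M] [Module A M] [Module B M] [IsScalarTower F A M]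
    [IsScalarTower F B M] [SMulCommClass A B M] : IsScalarTower F (A ⊗[F] B) M :=
  IsScalarTower.of_algebraMap_smul fun r m => by
    rw [Algebra.TensorProduct.algebraMap_apply, TensorProduct.Algebra.smul_def, one_smul,
      algebraMap_smul]

attribute [local instance] TensorProduct.Algebra.module in
lemma csa_density (F B : Type*) [Field F] [Ring B] [Algebra F B] [IsSimpleRing B]
    [Algebra.IsCentral F B] [FiniteDimensional F B] (f : B →ₗ[F] B) :
    ∃ t : B ⊗[F] Bᵐᵒᵖ, ∀ b : B, t • b = f b := by
  have hsm : ∀ (u v b : B), (u ⊗ₜ[F] MulOpposite.op v) • b = u * (b * v) := fun u v b => rfl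
  have hsimp : IsSimpleModule (B ⊗[F] Bᵐᵒᵖ) B := by
    rw [isSimpleModule_iff_toSpanSingleton_surjective]
    refine ⟨inferInstance, fun b hb => ?_⟩
    have key : ∀ x ∈ TwoSidedIdeal.span {b}, ∃ t : B ⊗[F] Bᵐᵒᵖ, t • b = x := by
      intro x hx
      rw [TwoSidedIdeal.mem_span_iff_mem_addSubgroup_closure] at hx
      refine AddSubgroup.closure_induction ?_ ⟨0, zero_smul (B ⊗[F] Bᵐᵒᵖ) b⟩ ?_ ?_ hx
      · rintro _ ⟨y, ⟨u, -, b', hb', rfl⟩, v, -, rfl⟩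
        rw [Set.mem_singleton_iff] at hb'
        subst hb'
        exact ⟨u ⊗ₜ MulOpposite.op v, by rw [hsm]; simp [mul_assoc]⟩
      · rintro _ _ _ _ ⟨s, rfl⟩ ⟨t, rfl⟩
        exact ⟨s + t, add_smul _ _ _⟩
      · rintro _ _ ⟨s, rfl⟩
        exact ⟨-s, neg_smul _ _⟩
    intro y
    have h1 : (1 : B) ∈ TwoSidedIdeal.span {b} :=
      IsSimpleRing.one_mem_of_ne_zero_mem _ hb (TwoSidedIdeal.subset_span rfl)
    obtain ⟨t, ht⟩ := key y (by simpa using TwoSidedIdeal.mul_mem_left _ y 1 h1)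
    exact ⟨t, ht⟩
  have hend : ∀ g : Module.End (B ⊗[F] Bᵐᵒᵖ) B, ∃ c : F, ∀ x, g x = c • x := by
    intro g
    have h1 : ∀ x, g x = x * g 1 := by
      intro x
      have := g.map_smul (x ⊗ₜ MulOpposite.op 1) 1
      rw [hsm, hsm] at this
      simpa using this
    have h2 : ∀ x, g x = g 1 * x := by
      intro x
      have := g.map_smul ((1 : B) ⊗ₜ MulOpposite.op x) 1
      rw [hsm, hsm] at this
      simpa using this
    have hc : g 1 ∈ Subalgebra.center F B := by
      rw [Subalgebra.mem_center_iff]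
      intro x
      rw [← h1, ← h2]
    obtain ⟨c, hc⟩ := (Algebra.IsCentral.mem_center_iff F).1 hc
    exact ⟨c, fun x => by rw [h2, hc, Algebra.smul_def]⟩
  let f' : Module.End (Module.End (B ⊗[F] Bᵐᵒᵖ) B) B :=
    { toFun := f
      map_add' := f.map_add
      map_smul' := by
        intro g x
        obtain ⟨c, hc⟩ := hend g
        simp [hc] }
  have bs := Module.finBasis F B
  classical
  obtain ⟨t, ht⟩ := jacobson_density f' (Finset.univ.image bs)
  refine ⟨t, fun b => ?_⟩
  have : IsScalarTower F (B ⊗[F] Bᵐᵒᵖ) B := tensor_tower F B Bᵐᵒᵖ B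
  have h : Algebra.lsmul F F B t = f := by
    refine bs.ext fun i => ?_
    have := ht (bs i) (by simp)
    exact this.symm
  exact congr($h b)

attribute [local instance] TensorProduct.Algebra.module in
lemma simple_tensor (F A B : Type*) [Field F] [Ring A] [Algebra F A] [IsSimpleRing A]
    [Ring B] [Algebra F B] [IsSimpleRing B]
    [Algebra.IsCentral F B] [FiniteDimensional F B] : IsSimpleRing (A ⊗[F] B) := by
  have : IsScalarTower F (B ⊗[F] Bᵐᵒᵖ) B := tensor_tower F B Bᵐᵒᵖ B
  rw [isSimpleRing_iff_isTwoSided_imp]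
  refine ⟨inferInstance, fun I hI => ?_⟩
  by_contra! hne
  obtain ⟨hbot, htop⟩ := hne
  obtain ⟨x, hx, hx0⟩ := Submodule.exists_mem_ne_zero_of_ne_bot hbot
  have key : ∀ t : B ⊗[F] Bᵐᵒᵖ, LinearMap.lTensor A (Algebra.lsmul F F B t) x ∈ I := by
    intro t
    induction t using TensorProduct.induction_on with
    | zero => simp
    | add s t hs ht =>
      rw [map_add, LinearMap.lTensor_add]
      exact I.add_mem hs ht
    | tmul u v =>
      have : LinearMap.lTensor A (Algebra.lsmul F F B (u ⊗ₜ[F] v)) x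
          = ((1 : A) ⊗ₜ[F] u) * (x * ((1 : A) ⊗ₜ[F] v.unop)) := by
        clear hx hx0
        induction x using TensorProduct.induction_on with
        | zero => simp
        | add s t hs ht => rw [map_add, hs, ht, add_mul, mul_add]
        | tmul a b =>
          simp only [LinearMap.lTensor_tmul, Algebra.TensorProduct.tmul_mul_tmul, one_mul, mul_one]
          rfl
      rw [this]
      exact I.mul_mem_left _ (I.mul_mem_right _ hx)
  let bs := Module.finBasis F B
  let bA := Algebra.TensorProduct.basis A bs
  obtain ⟨i, hi⟩ : ∃ i, bA.repr x i ≠ 0 := by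
    by_contra! h
    exact hx0 (bA.repr.map_eq_zero_iff.1 (Finsupp.ext h))
  obtain ⟨t, ht⟩ := csa_density F B ((Algebra.linearMap F B) ∘ₗ bs.coord i)
  have ht' : Algebra.lsmul F F B t = (Algebra.linearMap F B) ∘ₗ bs.coord i := LinearMap.ext ht
  have hmem := key t
  rw [ht'] at hmem
  have hval : LinearMap.lTensor A ((Algebra.linearMap F B) ∘ₗ bs.coord i) x
      = (bA.repr x i) ⊗ₜ[F] 1 := by
    clear hi hmem hx hx0 key
    induction x using TensorProduct.induction_on with
    | zero => simp
    | add s t hs ht => rw [map_add, hs, ht, map_add, Finsupp.add_apply, TensorProduct.add_tmul]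
    | tmul a b =>
      simp only [LinearMap.lTensor_tmul, bA, Algebra.TensorProduct.basis_repr_tmul]
      simp [Algebra.algebraMap_eq_smul_one, TensorProduct.smul_tmul']
  rw [hval] at hmem
  -- pull back along A → A ⊗ B
  let J : Ideal A := I.comap (Algebra.TensorProduct.includeLeft (R := F) (S := F) (A := A) (B := B))
  have hJ : J.IsTwoSided := ⟨fun {a} b ha => by
    change (a * b) ⊗ₜ[F] (1 : B) ∈ I
    have : (a * b) ⊗ₜ[F] (1 : B) = (a ⊗ₜ[F] (1 : B)) * (b ⊗ₜ[F] (1 : B)) := by simp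
    rw [this]
    exact I.mul_mem_right _ ha⟩
  rcases (isSimpleRing_iff_isTwoSided_imp.1 ‹IsSimpleRing A›).2 J hJ with h | h
  · have : bA.repr x i ∈ J := hmem
    rw [h] at this
    exact hi this
  · have : (1 : A) ∈ J := by rw [h]; trivial
    exact htop ((Ideal.eq_top_iff_one _).2 this)

lemma csa_sq (F B : Type*) [Field F] [Ring B] [Algebra F B] [IsSimpleRing B]
    [Algebra.IsCentral F B] [FiniteDimensional F B] : ∃ d : ℕ, Module.finrank F B = d ^ 2 := by
  have := simple_tensor F (AlgebraicClosure F) B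
  obtain ⟨n, _, ⟨e⟩⟩ := IsSimpleRing.exists_algEquiv_matrix_of_isAlgClosed (AlgebraicClosure F)
    (AlgebraicClosure F ⊗[F] B)
  refine ⟨n, ?_⟩
  have h := e.toLinearEquiv.finrank_eq
  rw [Module.finrank_baseChange, Module.finrank_matrix] at h
  simpa [sq] using h

lemma simple_module_dim (F A M : Type*) [Field F] [Ring A] [Algebra F A] [IsSimpleRing A]
    [FiniteDimensional F A] [AddCommGroup M] [Module F M] [Module A M] [IsScalarTower F A M]
    [FiniteDimensional F M] : ∃ r s m d : ℕ, Module.finrank F A = r * s ∧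
      Module.finrank F M = m * s ∧ s = r * d := by
  have := IsArtinianRing.of_finite F A
  have hiso : IsIsotypic A (A × M) := IsSimpleRing.isIsotypic A _
  have : Module.Finite A M := Module.Finite.of_restrictScalars_finite F A M
  obtain ⟨n, _, S, hS, -⟩ := hiso.linearEquiv_fun
  have h0 : IsIsotypicOfType A (A × M) S := hiso S
  have hA : IsIsotypicOfType A A S := h0.of_injective (LinearMap.inl A A M) LinearMap.inl_injective
  have hM : IsIsotypicOfType A M S := h0.of_injective (LinearMap.inr A A M) LinearMap.inr_injective
  have : FiniteDimensional F S :=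
    FiniteDimensional.of_injective (S.subtype.restrictScalars F) S.injective_subtype
  have : FiniteDimensional F (Module.End A S) :=
    Module.Finite.of_injective (LinearMap.restrictScalarsₗ F A S S F)
      (fun a b h => LinearMap.ext fun x => DFunLike.congr_fun h x)
  obtain ⟨r, ⟨eA⟩⟩ := hA.linearEquiv_fun
  obtain ⟨m, ⟨eM⟩⟩ := hM.linearEquiv_fun
  refine ⟨r, Module.finrank F S, m, Module.finrank F (Module.End A S), ?_, ?_, ?_⟩
  · rw [(eA.restrictScalars F).finrank_eq, Module.finrank_pi_fintype]; simp
  · rw [(eM.restrictScalars F).finrank_eq, Module.finrank_pi_fintype]; simp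
  · have e1 : S ≃ₗ[F] (A →ₗ[A] S) := (LinearMap.ringLmapEquivSelf A F S).symm
    have e2 : (A →ₗ[A] S) ≃ₗ[F] ((Fin r → S) →ₗ[A] S) :=
      LinearEquiv.congrLeft S F eA
    have e3 : ((Fin r → S) →ₗ[A] S) ≃ₗ[F] (Fin r → (S →ₗ[A] S)) :=
      (LinearMap.lsum A (fun _ : Fin r => S) F).symm
    rw [(e1.trans (e2.trans e3)).finrank_eq, Module.finrank_pi_fintype]; simp

attribute [local instance] TensorProduct.Algebra.module in
lemma csa_dvd (F B C : Type*) [Field F] [Ring B] [Algebra F B] [IsSimpleRing B]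
    [Algebra.IsCentral F B] [FiniteDimensional F B] [Ring C] [Algebra F C] [IsSimpleRing C]
    [FiniteDimensional F C] (f : C →ₐ[F] B) : Module.finrank F C ∣ Module.finrank F B := by
  let : Module C B := Module.compHom B f.toRingHom
  have hsm : ∀ (c : C) (b : B), c • b = f c * b := fun _ _ => rfl
  have : IsScalarTower F C B := ⟨fun a c b => by simp [hsm]⟩
  have : SMulCommClass C Bᵐᵒᵖ B := ⟨fun c b x => by simp [hsm, mul_assoc]⟩
  have := simple_tensor F C Bᵐᵒᵖ
  have : IsScalarTower F (C ⊗[F] Bᵐᵒᵖ) B := tensor_tower F C Bᵐᵒᵖ B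
  obtain ⟨r, s, m, d, h1, h2, h3⟩ := simple_module_dim F (C ⊗[F] Bᵐᵒᵖ) B
  rw [Module.finrank_tensorProduct, (MulOpposite.opLinearEquiv F (M := B)).symm.finrank_eq, h2] at h1
  have hpos : 0 < Module.finrank F B := Module.finrank_pos
  have hs : 0 < s := by
    rcases Nat.eq_zero_or_pos s with h | h
    · subst h; omega
    · exact h
  have h4 : Module.finrank F C * m = r := by
    apply Nat.eq_of_mul_eq_mul_right hs
    rw [← h1]; ring
  rw [h2, h3, ← h4]
  exact ⟨m * m * d, by ring⟩
open scoped nonZeroDivisors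

lemma prime_artinian_simple (A : Type*) [Ring A] [Nontrivial A] [IsArtinianRing A]
    (h : IsPrimeRing' A) : IsSimpleRing A := by
  have hJ : Ring.jacobson A = ⊥ := by
    by_contra hne
    obtain ⟨a, ha, ha0⟩ := Submodule.exists_mem_ne_zero_of_ne_bot hne
    have key : ∀ k : ℕ, ∃ b ∈ (Ring.jacobson A) ^ k, b ≠ 0 := by
      intro k
      induction k with
      | zero => exact ⟨1, (Ideal.one_eq_top (R := A)).ge Submodule.mem_top, one_ne_zero⟩
      | succ k ih =>
        obtain ⟨b, hb, hb0⟩ := ih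
        have : ∃ x, b * x * a ≠ 0 := by
          by_contra! hx
          rcases h b a hx with h | h
          · exact hb0 h
          · exact ha0 h
        obtain ⟨x, hx⟩ := this
        refine ⟨b * x * a, ?_, hx⟩
        rw [mul_assoc]
        exact (Ideal.mul_mem_mul hb (Ideal.mul_mem_left _ x ha) :
          b * (x * a) ∈ (Ring.jacobson A) ^ k * Ring.jacobson A)
    obtain ⟨n, hn⟩ := IsSemiprimaryRing.isNilpotent (R := A)
    obtain ⟨b, hb, hb0⟩ := key n
    rw [hn] at hb
    exact hb0 (by simpa using hb)
  have hss : IsSemisimpleRing A := IsArtinianRing.isSemisimpleRing_iff_jacobson.2 hJ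
  rw [isSimpleRing_iff_isTwoSided_imp]
  refine ⟨inferInstance, fun I hI => ?_⟩
  obtain ⟨J, hIJ⟩ := exists_isCompl I
  by_cases hIb : I = ⊥
  · exact Or.inl hIb
  right
  obtain ⟨a, ha, ha0⟩ := Submodule.exists_mem_ne_zero_of_ne_bot hIb
  have hJb : J = ⊥ := by
    rw [Submodule.eq_bot_iff]
    intro b hb
    refine (h a b fun x => ?_).resolve_left ha0
    have h1 : a * x * b ∈ I := I.mul_mem_right _ (I.mul_mem_right _ ha)
    have h2 : a * x * b ∈ J := J.mul_mem_left _ hb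
    have : a * x * b ∈ I ⊓ J := ⟨h1, h2⟩
    rw [hIJ.inf_eq_bot] at this
    simpa using this
  have := hIJ.sup_eq_top
  rwa [hJb, sup_bot_eq] at this

lemma rk_eq (R M : Type*) [CommRing R] [AddCommGroup M] [Module R M] :
    rkMod R M = Module.finrank R M := by
  unfold rkMod
  rw [IsFractionRing.finrank_right_eq R (FractionRing R),
    IsLocalizedModule.finrank_eq R⁰ (TensorProduct.mk R (FractionRing R) M 1) le_rfl]

section loc
variable (R A : Type*) [CommRing R] [IsDomain R] [Ring A] [Algebra R A]

/-- Torsion-freeness in elementary form. -/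
def TF : Prop := ∀ (r : R) (a : A), r • a = 0 → r = 0 ∨ a = 0

variable {R A}

lemma loc_surj (q : FractionRing R ⊗[R] A) :
    ∃ (s : FractionRing R) (a : A), s ≠ 0 ∧ q = s ⊗ₜ[R] a := by
  obtain ⟨⟨a, s⟩, h⟩ := IsLocalizedModule.surj R⁰ (TensorProduct.mk R (FractionRing R) A 1) q
  have hs : algebraMap R (FractionRing R) s ≠ 0 := by
    simp
  refine ⟨(algebraMap R (FractionRing R) s)⁻¹, a, inv_ne_zero hs, ?_⟩
  have h' : (algebraMap R (FractionRing R) s) • q = (1 : FractionRing R) ⊗ₜ[R] a := by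
    rw [algebraMap_smul]; exact h
  rw [← inv_smul_smul₀ hs q, h', TensorProduct.smul_tmul', smul_eq_mul, mul_one]

lemma loc_inj (htf : TF R A) {s : FractionRing R} (hs : s ≠ 0) {a : A}
    (h : s ⊗ₜ[R] a = 0) : a = 0 := by
  have h1 : TensorProduct.mk R (FractionRing R) A 1 a = TensorProduct.mk R (FractionRing R) A 1 0 := by
    have := congr(s⁻¹ • $h)
    rw [TensorProduct.smul_tmul', smul_eq_mul, inv_mul_cancel₀ hs, smul_zero] at this
    rw [TensorProduct.mk_apply, this, map_zero]
  obtain ⟨c, hc⟩ := IsLocalizedModule.exists_of_eq (S := R⁰) h1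
  rw [smul_zero] at hc
  exact (htf c a hc).resolve_left (nonZeroDivisors.ne_zero c.2)

lemma loc_prime (htf : TF R A) (h : IsPrimeRing' A) :
    IsPrimeRing' (FractionRing R ⊗[R] A) := by
  intro q q' hq
  obtain ⟨s, a, hs, rfl⟩ := loc_surj q
  obtain ⟨s', a', hs', rfl⟩ := loc_surj q'
  have : a = 0 ∨ a' = 0 := h a a' fun x => by
    have := hq (1 ⊗ₜ x)
    simp only [Algebra.TensorProduct.tmul_mul_tmul] at this
    exact loc_inj htf (by simp [hs, hs']) this
  rcases this with rfl | rfl <;> simp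

lemma loc_nontrivial [Nontrivial A] (htf : TF R A) : Nontrivial (FractionRing R ⊗[R] A) :=
  ⟨1, 0, fun h => one_ne_zero (loc_inj htf (one_ne_zero) (s := 1) (a := (1 : A)) h)⟩

lemma loc_finite (hfin : Module.rank R A < Cardinal.aleph0) :
    FiniteDimensional (FractionRing R) (FractionRing R ⊗[R] A) := by
  rw [FiniteDimensional, ← Module.rank_lt_aleph0_iff, IsFractionRing.rank_right_eq R (FractionRing R)]
  have := IsLocalizedModule.lift_rank_eq R⁰ (TensorProduct.mk R (FractionRing R) A 1) le_rfl
  rw [← Cardinal.lift_lt_aleph0, this, Cardinal.lift_lt_aleph0]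
  exact hfin

lemma loc_simple [Nontrivial A] (htf : TF R A) (h : IsPrimeRing' A)
    (hfin : Module.rank R A < Cardinal.aleph0) : IsSimpleRing (FractionRing R ⊗[R] A) := by
  have := loc_nontrivial htf
  have := loc_finite hfin
  have := IsArtinianRing.of_finite (FractionRing R) (FractionRing R ⊗[R] A)
  exact prime_artinian_simple _ (loc_prime htf h)

lemma loc_central (htf : TF R A)
    (hc : ∀ z : A, (∀ x, x * z = z * x) → ∃ r : R, z = algebraMap R A r) :
    Algebra.IsCentral (FractionRing R) (FractionRing R ⊗[R] A) where
  out q hq := by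
    rw [Subalgebra.mem_center_iff] at hq
    obtain ⟨s, a, hs, rfl⟩ := loc_surj q
    obtain ⟨r, rfl⟩ := hc a fun x => by
      have := hq (1 ⊗ₜ x)
      simp only [Algebra.TensorProduct.tmul_mul_tmul, one_mul, mul_one] at this
      rw [← sub_eq_zero, ← TensorProduct.tmul_sub] at this
      exact sub_eq_zero.1 (loc_inj htf hs this)
    rw [Algebra.mem_bot]
    refine ⟨algebraMap R _ r * s, ?_⟩
    rw [Algebra.algebraMap_eq_smul_one (A := A), ← TensorProduct.smul_tmul,
      Algebra.TensorProduct.algebraMap_apply, Algebra.smul_def]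
    rfl

lemma loc_sq [Nontrivial A] (htf : TF R A) (h : IsPrimeRing' A)
    (hfin : Module.rank R A < Cardinal.aleph0)
    (hc : ∀ z : A, (∀ x, x * z = z * x) → ∃ r : R, z = algebraMap R A r) :
    ∃ d : ℕ, rkMod R A = d ^ 2 := by
  have := loc_simple htf h hfin
  have := loc_finite hfin
  have := loc_central htf hc
  exact csa_sq _ _

lemma loc_dvd [Nontrivial A] (htf : TF R A) (h : IsPrimeRing' A)
    (hfin : Module.rank R A < Cardinal.aleph0)
    (hc : ∀ z : A, (∀ x, x * z = z * x) → ∃ r : R, z = algebraMap R A r)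
    {C : Type*} [Ring C] [Algebra R C] [Nontrivial C] (htfC : TF R C) (hC : IsPrimeRing' C)
    (hfinC : Module.rank R C < Cardinal.aleph0) (f : C →ₐ[R] A) :
    rkMod R C ∣ rkMod R A := by
  have := loc_simple htf h hfin
  have := loc_finite hfin
  have := loc_central htf hc
  have := loc_simple htfC hC hfinC
  have := loc_finite hfinC
  exact csa_dvd _ _ _ (Algebra.TensorProduct.map (AlgHom.id (FractionRing R) (FractionRing R)) f)
end loc

attribute [local instance] FractionRing.liftAlgebra in
lemma rk_tower (R S C : Type*) [CommRing R] [IsDomain R] [CommRing S] [IsDomain S] [Algebra R S]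
    [FaithfulSMul R S] [Algebra.IsAlgebraic R S] [AddCommGroup C] [Module S C] [Module R C]
    [IsScalarTower R S C] : rkMod R S * rkMod S C = rkMod R C := by
  rw [rk_eq R S, rk_eq R C, ← IsFractionRing.finrank_eq R (FractionRing R) S (FractionRing S)]
  unfold rkMod
  have : IsLocalizedModule (Algebra.algebraMapSubmonoid S R⁰)
      (TensorProduct.mk S (FractionRing S) C 1) := by
    rw [isLocalizedModule_iff_isBaseChange (Algebra.algebraMapSubmonoid S R⁰) (FractionRing S)]
    exact TensorProduct.isBaseChange _ _ _
  have := IsLocalizedModule.restrictScalars (R := R) R⁰ (TensorProduct.mk S (FractionRing S) C 1)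
  rw [← IsLocalizedModule.finrank_eq R⁰
    ((TensorProduct.mk S (FractionRing S) C 1).restrictScalars R) le_rfl,
    Module.finrank_mul_finrank,
    IsFractionRing.finrank_right_eq R (FractionRing R)]

lemma center_tf (A : Type*) [Ring A] (h : IsPrimeRing' A) (z a : A) (hz : ∀ x, x * z = z * x)
    (hza : z * a = 0) : z = 0 ∨ a = 0 :=
  h z a fun x => by rw [← hz, mul_assoc, hza, mul_zero]

lemma center_domain (A : Type*) [Ring A] [Nontrivial A] (h : IsPrimeRing' A) :
    IsDomain (Subring.center A) := by
  have : NoZeroDivisors (Subring.center A) := ⟨fun {a b} hab => by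
    have := center_tf A h a b (Subring.mem_center_iff.1 a.2) (congr_arg Subtype.val hab)
    simpa using this⟩
  exact NoZeroDivisors.to_isDomain _

theorem stmt_core (B : Type*) [Ring B] [Nontrivial B] (hB : IsPrimeRing' B)
    [Module.Finite (Subring.center B) B] (C : Type*) [Ring C] (hC : IsPrimeRing' C)
    [Algebra (Subring.center B) C] [Algebra (Subring.center B) (Subring.center C)]
    [IsScalarTower (Subring.center B) (Subring.center C) C]
    (f : C →ₐ[Subring.center B] B) (hf : Function.Injective f) :
    (rkMod (Subring.center B) C ∣ rkMod (Subring.center B) B) ∧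
    (∃ dC dB : ℕ,
      rkMod (Subring.center C) C = dC ^ 2 ∧
      rkMod (Subring.center B) B = dB ^ 2 ∧ dC ∣ dB) ∧
    (rkMod (Subring.center B) (Subring.center C) ∣ rkMod (Subring.center B) C ∧
     rkMod (Subring.center B) (Subring.center C) ∣ rkMod (Subring.center B) B) := by
  have := center_domain B hB
  have : Nontrivial C := f.toRingHom.domain_nontrivial
  have := center_domain C hC
  have htfB : TF (Subring.center B) B := fun r a h => by
    simpa using center_tf B hB r a (Subring.mem_center_iff.1 r.2) h
  have htfC : TF (Subring.center B) C := fun r a h => by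
    have h' := htfB r (f a) (by rw [← map_smul, h, map_zero])
    rwa [map_eq_zero_iff f hf] at h'
  have htfC' : TF (Subring.center C) C := fun r a h => by
    simpa using center_tf C hC r a (Subring.mem_center_iff.1 r.2) h
  have hinj : Function.Injective (algebraMap (Subring.center B) (Subring.center C)) := by
    rw [injective_iff_map_eq_zero]
    intro r hr
    refine (htfC r 1 ?_).resolve_right one_ne_zero
    rw [← Algebra.algebraMap_eq_smul_one,
      IsScalarTower.algebraMap_apply (Subring.center B) (Subring.center C) C, hr, map_zero]
  have hfaith : FaithfulSMul (Subring.center B) (Subring.center C) :=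
    (faithfulSMul_iff_algebraMap_injective _ _).2 hinj
  have hint : Algebra.IsIntegral (Subring.center B) (Subring.center C) :=
    Algebra.IsIntegral.of_injective
      (f.comp (IsScalarTower.toAlgHom (Subring.center B) (Subring.center C) C))
      (hf.comp Subtype.val_injective)
  have hfinB : Module.rank (Subring.center B) B < Cardinal.aleph0 :=
    Module.rank_lt_aleph0 _ _
  have hfinC : Module.rank (Subring.center B) C < Cardinal.aleph0 := by
    have := f.toLinearMap.lift_rank_le_of_injective hf
    rw [← Cardinal.lift_lt_aleph0]
    exact this.trans_lt (Cardinal.lift_lt_aleph0.2 hfinB)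
  have hfinC' : Module.rank (Subring.center C) C < Cardinal.aleph0 := by
    refine lt_of_le_of_lt ?_ hfinC
    have := hfaith
    rw [Module.rank]
    exact ciSup_le' fun ⟨s, hs⟩ => (hs.restrict_scalars' (Subring.center B)).cardinal_le_rank
  obtain ⟨dB, hdB⟩ := loc_sq htfB hB hfinB
    (fun z hz => ⟨⟨z, Subring.mem_center_iff.2 hz⟩, rfl⟩)
  obtain ⟨dC, hdC⟩ := loc_sq htfC' hC hfinC'
    (fun z hz => ⟨⟨z, Subring.mem_center_iff.2 hz⟩, rfl⟩)
  have hdvd := loc_dvd htfB hB hfinB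
    (fun z hz => ⟨⟨z, Subring.mem_center_iff.2 hz⟩, rfl⟩) htfC hC hfinC f
  have htower := rk_tower (Subring.center B) (Subring.center C) C
  have h3 : rkMod (Subring.center B) (Subring.center C) ∣ rkMod (Subring.center B) C :=
    ⟨_, htower.symm⟩
  refine ⟨hdvd, ⟨dC, dB, hdC, hdB, ?_⟩, h3, h3.trans hdvd⟩
  rw [← Nat.pow_dvd_pow_iff two_ne_zero, ← hdC, ← hdB]
  exact (Dvd.intro_left _ htower).trans hdvd

lemma rk_trivial (R M : Type*) [CommRing R] [AddCommGroup M] [Module R M] [Subsingleton R] :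
    rkMod R M = 1 := by
  rw [rk_eq, Module.finrank, rank_subsingleton, Cardinal.one_toNat]

/-- Let `B` be a prime ring which is a finitely generated module over its
center `Z`, and let `C` be a prime subring of `B` containing `Z`. Then
(1) `rk_Z(C) ∣ rk_Z(B)`;
(2) `rk_{Z(C)}(C)` and `rk_Z(B)` are perfect squares and the PI-degree of `C` (the square
root of `rk_{Z(C)}(C)`) divides the PI-degree of `B` (the square root of `rk_Z(B)`);
(3) `rk_Z(Z(C))` divides both `rk_Z(C)` and `rk_Z(B)`. -/
theorem stmt13 (B : Type*) [Ring B] (hB : IsPrimeRing' B)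
    [Module.Finite (Subring.center B) B]
    (C : Subring B) (hZC : Subring.center B ≤ C) (hC : IsPrimeRing' ↥C) :
    letI : Algebra (Subring.center B) ↥C := RingHom.toAlgebra'
      { toFun := fun z => ⟨(z : B), hZC z.2⟩
        map_one' := rfl
        map_mul' := fun _ _ => rfl
        map_zero' := rfl
        map_add' := fun _ _ => rfl }
      (fun z c => Subtype.ext (((Subring.mem_center_iff.mp z.2) (c : B)).symm))
    letI : Algebra (Subring.center B) ↥(Subring.center ↥C) := RingHom.toAlgebra
      { toFun := fun z => ⟨⟨(z : B), hZC z.2⟩, by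
          rw [Subring.mem_center_iff]
          intro g
          exact Subtype.ext ((Subring.mem_center_iff.mp z.2) (g : B))⟩
        map_one' := rfl
        map_mul' := fun _ _ => rfl
        map_zero' := rfl
        map_add' := fun _ _ => rfl }
    (rkMod (Subring.center B) ↥C ∣ rkMod (Subring.center B) B) ∧
    (∃ dC dB : ℕ,
      rkMod (Subring.center ↥C) ↥C = dC ^ 2 ∧
      rkMod (Subring.center B) B = dB ^ 2 ∧ dC ∣ dB) ∧
    (rkMod (Subring.center B) ↥(Subring.center ↥C) ∣ rkMod (Subring.center B) ↥C ∧
     rkMod (Subring.center B) ↥(Subring.center ↥C) ∣ rkMod (Subring.center B) B) := by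
  rcases subsingleton_or_nontrivial B with hsub | hnt
  · refine ⟨?_, ⟨1, 1, ?_, ?_, dvd_rfl⟩, ?_, ?_⟩ <;> simp only [rk_trivial] <;> norm_num
  · have hntC : Nontrivial C := inferInstance
    let i1 : Algebra (Subring.center B) ↥C := RingHom.toAlgebra'
      { toFun := fun z => ⟨(z : B), hZC z.2⟩
        map_one' := rfl
        map_mul' := fun _ _ => rfl
        map_zero' := rfl
        map_add' := fun _ _ => rfl }
      (fun z c => Subtype.ext (((Subring.mem_center_iff.mp z.2) (c : B)).symm))
    let i2 : Algebra (Subring.center B) ↥(Subring.center ↥C) := RingHom.toAlgebra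
      { toFun := fun z => ⟨⟨(z : B), hZC z.2⟩, by
          rw [Subring.mem_center_iff]
          intro g
          exact Subtype.ext ((Subring.mem_center_iff.mp z.2) (g : B))⟩
        map_one' := rfl
        map_mul' := fun _ _ => rfl
        map_zero' := rfl
        map_add' := fun _ _ => rfl }
    have : IsScalarTower (Subring.center B) (Subring.center C) C :=
      IsScalarTower.of_algebraMap_eq fun _ => rfl
    let f : C →ₐ[Subring.center B] B := { C.subtype with commutes' := fun _ => rfl }
    exact stmt_core B hB C hC f Subtype.val_injective
end
end
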